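/- (Uniform a-priori bound for truncated Schrödinger double phase problems.) Assume condition (O). Let γ : ℝ^N → ℝ be bounded Lipschitz with sup_x q(x) < inf_x γ(x) and inf_x (p*(x) − γ(x)) > 0; set s(x) := (γ(x) + p*(x))/2 and F_γ(x,t) := t^{γ(x)} + a(x)^{s(x)/q(x)} t^{s(x)}. Let C_m > 0. Then there exist constants C₀ > 0, τ₁ > 0, τ₂ > 0, depending only on N, p, q, a, V, γ and C_m (in particular not on u or on g), such that: for every Carathéodory function g : ℝ^N × ℝ → ℝ with |g(x,t)| ≤ C_m |t|^{γ(x)−1} for a.e. x and all t, every u ∈ C¹(ℝ^N) which satisfies ρ_V(u) < ∞, is the limit in the Luxemburg norm associated with ρ_V of a sequence of C_c^∞(ℝ^N) functions, and satisfies for every φ ∈ C_c^∞(ℝ^N): ∫_{ℝ^N} (|∇u|^{p(x)−2}∇u + a(x)|∇u|^{q(x)−2}∇u)·∇φ dx + ∫_{ℝ^N} V(x)(|u|^{p(x)−2}u + a(x)|u|^{q(x)−2}u) φ dx = ∫_{ℝ^N} g(x,u) φ dx, belongs to L^∞(ℝ^N) and satisfies ‖u‖_{L^∞(ℝ^N)}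 ≤ C₀ max{‖u‖_{L^{F_γ}(ℝ^N)}^{τ₁}, ‖u‖_{L^{F_γ}(ℝ^N)}^{τ₂}}. -/

import Mathlib

open MeasureTheory Filter
open scoped ENNReal

/-- The double phase integrand `H(x,t) = t^{p(x)} + a(x) t^{q(x)}`. -/
noncomputable def Hfun {N : ℕ} (p q a : EuclideanSpace ℝ (Fin N) → ℝ)
    (x : EuclideanSpace ℝ (Fin N)) (t : ℝ) : ℝ :=
  t ^ p x + a x * t ^ q x

/-- The modular `ρ_V(u) = ∫_{ℝ^N} [H(x,|∇u|) + V(x) H(x,|u|)] dx`. -/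
noncomputable def rhoV {N : ℕ} (p q a V : EuclideanSpace ℝ (Fin N) → ℝ)
    (u : EuclideanSpace ℝ (Fin N) → ℝ) : ℝ≥0∞ :=
  ∫⁻ x, (ENNReal.ofReal (Hfun p q a x ‖gradient u x‖) +
    ENNReal.ofReal (V x * Hfun p q a x |u x|))

/-- The Luxemburg norm `‖u‖ = inf {τ > 0 : ρ_V(u/τ) ≤ 1}` associated with `ρ_V`. -/
noncomputable def VNorm {N : ℕ} (p q a V : EuclideanSpace ℝ (Fin N) → ℝ)
    (u : EuclideanSpace ℝ (Fin N) → ℝ) : ℝ :=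
  sInf {τ : ℝ | 0 < τ ∧
    (∫⁻ x, (ENNReal.ofReal (Hfun p q a x (‖gradient u x‖ / τ)) +
      ENNReal.ofReal (V x * Hfun p q a x (|u x| / τ)))) ≤ 1}

/-- The Luxemburg norm `‖u‖_{L^Φ(U)}` of a Musielak integrand `Φ` on a set `U`. -/
noncomputable def luxNormOn {N : ℕ} (Φ : EuclideanSpace ℝ (Fin N) → ℝ → ℝ)
    (U : Set (EuclideanSpace ℝ (Fin N))) (u : EuclideanSpace ℝ (Fin N) → ℝ) : ℝ :=
  sInf {τ : ℝ | 0 < τ ∧ (∫⁻ x in U, ENNReal.ofReal (Φ x (|u x| / τ))) ≤ 1}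

/-- The Sobolev Luxemburg norm `‖u‖_{W^{1,H}(U)}`. -/
noncomputable def sobNormOn {N : ℕ} (p q a : EuclideanSpace ℝ (Fin N) → ℝ)
    (U : Set (EuclideanSpace ℝ (Fin N))) (u : EuclideanSpace ℝ (Fin N) → ℝ) : ℝ :=
  sInf {τ : ℝ | 0 < τ ∧
    (∫⁻ x in U, (ENNReal.ofReal (Hfun p q a x (‖gradient u x‖ / τ)) +
      ENNReal.ofReal (Hfun p q a x (|u x| / τ)))) ≤ 1}

/-- The open cube `Q_{y,ε}` centered at `y` with edges parallel to the axes of length `ε`. -/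
def cube {N : ℕ} (y : EuclideanSpace ℝ (Fin N)) (ε : ℝ) : Set (EuclideanSpace ℝ (Fin N)) :=
  {x | ∀ i, |x i - y i| < ε / 2}

/-- Condition (D): `p, q` bounded Lipschitz with `1 < inf p`, `sup q < N`,
`p < q < N` pointwise, `sup q/p < 1 + 1/N`; `a ≥ 0` bounded Lipschitz. -/
structure CondD (N : ℕ) (p q a : EuclideanSpace ℝ (Fin N) → ℝ) : Prop where
  lip_p : ∃ K : NNReal, LipschitzWith K p
  lip_q : ∃ K : NNReal, LipschitzWith K q
  lip_a : ∃ K : NNReal, LipschitzWith K a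
  inf_p : ∃ c > (1 : ℝ), ∀ x, c ≤ p x
  sup_q : ∃ c < (N : ℝ), ∀ x, q x ≤ c
  p_lt_q : ∀ x, p x < q x
  q_lt_N : ∀ x, q x < N
  ratio : ∃ c < 1 + 1 / (N : ℝ), ∀ x, q x / p x ≤ c
  a_nonneg : ∀ x, 0 ≤ a x
  a_bdd : ∃ C : ℝ, ∀ x, a x ≤ C

/-- Condition (O): condition (D) together with `V ∈ L¹_loc`, `V ≥ 0` a.e., one of the
two structural alternatives on the potential, and the log-Hölder-type decay of `p`
towards `p_∞` when `ess inf V = 0`. -/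
structure CondO (N : ℕ) (p q a V : EuclideanSpace ℝ (Fin N) → ℝ)
    extends CondD N p q a : Prop where
  V_loc : LocallyIntegrable V volume
  V_nonneg : ∀ᵐ x ∂(volume : Measure (EuclideanSpace ℝ (Fin N))), 0 ≤ V x
  V_alt : (∃ K₀ > (0 : ℝ), {x | V x ≤ K₀}.Nonempty ∧ volume {x | V x ≤ K₀} < ⊤) ∨
    (∃ R > (0 : ℝ),
      0 < essInf V (volume.restrict {x : EuclideanSpace ℝ (Fin N) | R ≤ ‖x‖}))
  V_log : essInf V (volume : Measure (EuclideanSpace ℝ (Fin N))) = 0 →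
    ∃ pinf : ℝ, 1 < pinf ∧ pinf < N ∧
      ∃ C : ℝ, ∀ x, |p x - pinf| * Real.log (Real.exp 1 + ‖x‖) ≤ C

/-! ### Smooth positive parts -/

theorem hasDerivAt_max_zero_rpow {m : ℝ} (hm : 1 < m) (t : ℝ) :
    HasDerivAt (fun s : ℝ => (max s 0) ^ m) (m * (max t 0) ^ (m - 1)) t := by
  rcases lt_trichotomy t 0 with ht | rfl | ht
  · have h : (fun s : ℝ => (max s 0) ^ m) =ᶠ[nhds t] fun _ => 0 := by
      filter_upwards [Iio_mem_nhds ht] with s hs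
      rw [max_eq_right (le_of_lt hs), Real.zero_rpow (by linarith)]
    rw [max_eq_right ht.le, Real.zero_rpow (by linarith), mul_zero]
    exact (hasDerivAt_const t (0 : ℝ)).congr_of_eventuallyEq h
  · rw [max_self, Real.zero_rpow (by linarith), mul_zero, hasDerivAt_iff_isLittleO]
    simp only [sub_zero, smul_zero, max_self, Real.zero_rpow (show m ≠ 0 by linarith)]
    rw [Asymptotics.isLittleO_iff]
    intro c hc
    have hlim : Tendsto (fun s : ℝ => |s| ^ (m - 1)) (nhds 0) (nhds 0) := by
      have : Continuous fun s : ℝ => |s| ^ (m - 1) :=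
        continuous_abs.rpow_const fun _ => Or.inr (by linarith)
      have h0 := this.tendsto 0
      rwa [abs_zero, Real.zero_rpow (by linarith)] at h0
    filter_upwards [hlim.eventually (Iio_mem_nhds hc)] with s hs
    have h1 : max s 0 ≤ |s| := max_le (le_abs_self s) (abs_nonneg s)
    have h2 : (max s 0) ^ m ≤ |s| ^ m :=
      Real.rpow_le_rpow (le_max_right _ _) h1 (by linarith)
    rw [Real.norm_of_nonneg (Real.rpow_nonneg (le_max_right _ _) _), Real.norm_eq_abs]
    rcases eq_or_ne s 0 with rfl | hs0
    · simp [Real.zero_rpow (show m ≠ 0 by linarith)]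
    · have h3 : |s| ^ m = |s| ^ (m - 1) * |s| := by
        rw [← Real.rpow_add_one (abs_ne_zero.mpr hs0)]; ring_nf
      rw [h3] at h2
      exact h2.trans (mul_le_mul_of_nonneg_right (le_of_lt hs) (abs_nonneg s))
  · have h : (fun s : ℝ => (max s 0) ^ m) =ᶠ[nhds t] fun s => s ^ m := by
      filter_upwards [Ioi_mem_nhds ht] with s hs
      rw [max_eq_left (le_of_lt hs)]
    rw [max_eq_left ht.le]
    exact (Real.hasDerivAt_rpow_const (Or.inl ht.ne')).congr_of_eventuallyEq h

theorem contDiff_max_zero_rpow {m : ℝ} (hm : 1 < m) :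
    ContDiff ℝ 1 (fun s : ℝ => (max s 0) ^ m) := by
  rw [contDiff_one_iff_deriv]
  refine ⟨fun t => (hasDerivAt_max_zero_rpow hm t).differentiableAt, ?_⟩
  have : deriv (fun s : ℝ => (max s 0) ^ m) = fun t => m * (max t 0) ^ (m - 1) :=
    funext fun t => (hasDerivAt_max_zero_rpow hm t).deriv
  rw [this]
  exact continuous_const.mul
    ((continuous_id.max continuous_const).rpow_const fun _ => Or.inr (by linarith))

/-- A convex `C¹` regularization of the positive part. -/
noncomputable def softPos (δ t : ℝ) : ℝ := √(δ ^ 2 + (max t 0) ^ 2) - δ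

/-- The derivative of `softPos δ`. -/
noncomputable def softPosDeriv (δ t : ℝ) : ℝ := max t 0 / √(δ ^ 2 + (max t 0) ^ 2)

theorem hasDerivAt_softPos {δ : ℝ} (hδ : 0 < δ) (t : ℝ) :
    HasDerivAt (softPos δ) (softPosDeriv δ t) t := by
  have h1 := hasDerivAt_max_zero_rpow (m := 2) (by norm_num) t
  have h2 : HasDerivAt (fun s : ℝ => (max s 0) ^ 2) (2 * max t 0) t := by
    have e : (2 : ℝ) - 1 = 1 := by norm_num
    simpa only [e, Real.rpow_two, Real.rpow_one] using h1
  have hpos : δ ^ 2 + (max t 0) ^ 2 ≠ 0 := by positivity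
  have h3 := ((h2.const_add (δ ^ 2)).sqrt hpos).sub_const δ
  rw [mul_div_mul_left _ _ two_ne_zero] at h3
  exact h3

theorem continuous_softPosDeriv {δ : ℝ} (hδ : 0 < δ) : Continuous (softPosDeriv δ) := by
  unfold softPosDeriv
  refine Continuous.div (by fun_prop) (by fun_prop) fun t => ?_
  positivity

theorem contDiff_softPos {δ : ℝ} (hδ : 0 < δ) : ContDiff ℝ 1 (softPos δ) := by
  rw [contDiff_one_iff_deriv]
  refine ⟨fun t => (hasDerivAt_softPos hδ t).differentiableAt, ?_⟩
  have : deriv (softPos δ) = softPosDeriv δ := funext fun t => (hasDerivAt_softPos hδ t).deriv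
  rw [this]
  exact continuous_softPosDeriv hδ

theorem softPos_nonneg (δ t : ℝ) : 0 ≤ softPos δ t := by
  rw [softPos, sub_nonneg]
  exact Real.le_sqrt_of_sq_le (by nlinarith [sq_nonneg (max t 0)])

theorem softPos_of_nonpos {δ t : ℝ} (hδ : 0 < δ) (ht : t ≤ 0) : softPos δ t = 0 := by
  rw [softPos, max_eq_right ht]
  simp [Real.sqrt_sq hδ.le]

theorem softPosDeriv_of_nonpos {δ t : ℝ} (ht : t ≤ 0) : softPosDeriv δ t = 0 := by
  rw [softPosDeriv, max_eq_right ht, zero_div]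

theorem softPosDeriv_nonneg (δ t : ℝ) : 0 ≤ softPosDeriv δ t :=
  div_nonneg (le_max_right _ _) (Real.sqrt_nonneg _)

theorem softPosDeriv_le_one (δ t : ℝ) : softPosDeriv δ t ≤ 1 := by
  refine div_le_one_of_le₀ ?_ (Real.sqrt_nonneg _)
  exact Real.le_sqrt_of_sq_le (by nlinarith [sq_nonneg δ])

theorem softPos_le_mul_deriv {δ : ℝ} (hδ : 0 < δ) (t : ℝ) :
    softPos δ t ≤ max t 0 * softPosDeriv δ t := by
  have hpos : 0 < δ ^ 2 + (max t 0) ^ 2 := by positivity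
  have hs := Real.sqrt_pos.mpr hpos
  have hsq := Real.sq_sqrt hpos.le
  have hle : δ ≤ √(δ ^ 2 + (max t 0) ^ 2) :=
    Real.le_sqrt_of_sq_le (by nlinarith [sq_nonneg (max t 0)])
  rw [softPos, softPosDeriv, mul_div_assoc', le_div_iff₀ hs]
  nlinarith

theorem softPos_le {δ : ℝ} (hδ : 0 < δ) (t : ℝ) : softPos δ t ≤ max t 0 :=
  (softPos_le_mul_deriv hδ t).trans
    (mul_le_of_le_one_right (le_max_right _ _) (softPosDeriv_le_one δ t))

theorem sub_le_softPos (δ t : ℝ) : t - δ ≤ softPos δ t := by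
  have h : max t 0 ≤ √(δ ^ 2 + (max t 0) ^ 2) :=
    Real.le_sqrt_of_sq_le (by nlinarith [sq_nonneg δ])
  have := le_max_left t 0
  rw [softPos]; linarith

/-! ### Elementary inequalities for real powers -/

/-- A crude weighted Young inequality. -/
theorem mul_rpow_sub_one_le {p x y : ℝ} (hp : 1 < p) (hx : 0 ≤ x) (hy : 0 ≤ y) :
    x * y ^ (p - 1) ≤ y ^ p / 2 + (2 * x) ^ p := by
  have e : ∀ z : ℝ, 0 ≤ z → z * z ^ (p - 1) = z ^ p := fun z hz => by
    rcases hz.eq_or_lt with rfl | hz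
    · rw [Real.zero_rpow (by linarith : p ≠ 0), zero_mul]
    · rw [mul_comm, ← Real.rpow_add_one hz.ne']; ring_nf
  rcases le_total (2 * x) y with h | h
  · have h1 : x * y ^ (p - 1) ≤ (y / 2) * y ^ (p - 1) :=
      mul_le_mul_of_nonneg_right (by linarith) (Real.rpow_nonneg hy _)
    have h2 := e y hy
    have h3 : 0 ≤ (2 * x) ^ p := by positivity
    linarith
  · have h1 : x * y ^ (p - 1) ≤ (2 * x) * (2 * x) ^ (p - 1) :=
      mul_le_mul (by linarith) (Real.rpow_le_rpow hy h (by linarith))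
        (Real.rpow_nonneg hy _) (by linarith)
    have h2 := e (2 * x) (by linarith)
    have h3 : 0 ≤ y ^ p / 2 := by positivity
    linarith

/-- A crude Young inequality with conjugate exponents. -/
theorem mul_le_rpow_add_rpow {p x y : ℝ} (hp : 1 < p) (hx : 0 ≤ x) (hy : 0 ≤ y) :
    x * y ≤ x ^ (p / (p - 1)) + y ^ p := by
  have hc : (p / (p - 1)).HolderConjugate p := by
    have := (Real.HolderConjugate.conjExponent hp).symm
    simpa [Real.conjExponent] using this
  have h := Real.young_inequality_of_nonneg hx hy hc
  have h1 : x ^ (p / (p - 1)) / (p / (p - 1)) ≤ x ^ (p / (p - 1)) :=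
    div_le_self (by positivity) hc.lt.le
  have h2 : y ^ p / p ≤ y ^ p := div_le_self (by positivity) hp.le
  linarith

theorem rpow_le_one_add_rpow {x s t : ℝ} (hx : 0 ≤ x) (hs : 0 ≤ s) (hst : s ≤ t) :
    x ^ s ≤ 1 + x ^ t := by
  rcases le_total x 1 with h | h
  · have h1 := Real.rpow_le_one hx h hs
    have h2 : 0 ≤ x ^ t := by positivity
    linarith
  · have := Real.rpow_le_rpow_of_exponent_le h hst
    linarith

theorem rpow_neg_le_add {δ s d Γ : ℝ} (hδ : 0 < δ) (hd : d ≤ s) (hs : s ≤ Γ) :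
    δ ^ (-s) ≤ δ ^ (-d) + δ ^ (-Γ) := by
  rcases le_total δ 1 with h | h
  · have h1 := Real.rpow_le_rpow_of_exponent_ge hδ h (neg_le_neg hs)
    have h2 : 0 ≤ δ ^ (-d) := by positivity
    linarith
  · have h1 := Real.rpow_le_rpow_of_exponent_le h (neg_le_neg hd)
    have h2 : 0 ≤ δ ^ (-Γ) := by positivity
    linarith

/-- Above the level `δ` a lower power is controlled by a higher power. -/
theorem rpow_le_of_level {δ w e g Γ : ℝ} (hδ : 0 < δ) (hw : δ ≤ w) (heg : e ≤ g)
    (hge : g - e ≤ Γ) : w ^ e ≤ (1 + δ ^ (-Γ)) * w ^ g := by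
  have hw0 : 0 < w := hδ.trans_le hw
  have h1 : w ^ e = w ^ (-(g - e)) * w ^ g := by
    rw [← Real.rpow_add hw0]; ring_nf
  have h2 : w ^ (-(g - e)) ≤ δ ^ (-(g - e)) :=
    Real.rpow_le_rpow_of_nonpos hδ hw (by linarith)
  have h3 := rpow_neg_le_add hδ (show (0 : ℝ) ≤ g - e by linarith) hge
  rw [neg_zero, Real.rpow_zero] at h3
  rw [h1]
  exact mul_le_mul_of_nonneg_right (h2.trans h3) (by positivity)

/-! ### Gradients, cutoffs and the Sobolev inequality -/

section Gradient

set_option linter.unusedSectionVars false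

variable {F : Type*} [NormedAddCommGroup F] [InnerProductSpace ℝ F] [CompleteSpace F]

theorem HasDerivAt.comp_hasGradientAt {f : F → ℝ} {f' x : F} {g : ℝ → ℝ} {g' : ℝ}
    (hg : HasDerivAt g g' (f x)) (hf : HasGradientAt f f' x) :
    HasGradientAt (fun z => g (f z)) (g' • f') x := by
  rw [hasGradientAt_iff_hasFDerivAt] at hf ⊢
  rw [map_smul]
  exact hg.comp_hasFDerivAt x hf

theorem HasGradientAt.mul_real {f g : F → ℝ} {f' g' x : F}
    (hf : HasGradientAt f f' x) (hg : HasGradientAt g g' x) :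
    HasGradientAt (fun z => f z * g z) (f x • g' + g x • f') x := by
  rw [hasGradientAt_iff_hasFDerivAt] at hf hg ⊢
  rw [map_add, map_smul, map_smul]
  exact hf.mul hg

theorem ContDiff.hasGradientAt_gradient {v : F → ℝ} (hv : ContDiff ℝ 1 v) (x : F) :
    HasGradientAt v (gradient v x) x :=
  (hv.differentiable one_ne_zero x).hasGradientAt

theorem ContDiff.continuous_gradient {v : F → ℝ} (hv : ContDiff ℝ 1 v) :
    Continuous (gradient v) :=
  (LinearIsometryEquiv.continuous _).comp (hv.continuous_fderiv one_ne_zero)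

theorem HasGradientAt.norm_fderiv_eq {f : F → ℝ} {f' x : F} (h : HasGradientAt f f' x) :
    ‖fderiv ℝ f x‖ = ‖f'‖ := by
  rw [h.hasFDerivAt.fderiv, LinearIsometryEquiv.norm_map]

/-- The cutoff `((R² - |x - y|²)₊)^m`. -/
noncomputable def ballCutoff (y : F) (R m : ℝ) (x : F) : ℝ := (max (R ^ 2 - ‖x - y‖ ^ 2) 0) ^ m

theorem ballCutoff_nonneg (y : F) (R m : ℝ) (x : F) : 0 ≤ ballCutoff y R m x :=
  Real.rpow_nonneg (le_max_right _ _) _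

theorem max_sq_sub_le_one {R : ℝ} (hR0 : 0 ≤ R) (hR : R ≤ 1) (y x : F) :
    max (R ^ 2 - ‖x - y‖ ^ 2) 0 ≤ 1 :=
  max_le (by nlinarith [sq_nonneg ‖x - y‖]) zero_le_one

theorem ballCutoff_le_one {R m : ℝ} (hR0 : 0 ≤ R) (hR : R ≤ 1) (hm : 0 ≤ m) (y x : F) :
    ballCutoff y R m x ≤ 1 :=
  Real.rpow_le_one (le_max_right _ _) (max_sq_sub_le_one hR0 hR y x) hm

theorem max_sq_sub_of_notMem {R : ℝ} (hR0 : 0 ≤ R) {y x : F}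
    (hx : x ∉ Metric.closedBall y R) : max (R ^ 2 - ‖x - y‖ ^ 2) 0 = 0 := by
  rw [Metric.mem_closedBall, not_le, dist_eq_norm] at hx
  exact max_eq_right (by nlinarith)

theorem ballCutoff_of_notMem {R m : ℝ} (hR0 : 0 ≤ R) (hm : 0 < m) {y x : F}
    (hx : x ∉ Metric.closedBall y R) : ballCutoff y R m x = 0 := by
  rw [ballCutoff, max_sq_sub_of_notMem hR0 hx, Real.zero_rpow hm.ne']

theorem contDiff_ballCutoff {m : ℝ} (hm : 1 < m) (y : F) (R : ℝ) :
    ContDiff ℝ 1 (ballCutoff y R m) :=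
  (contDiff_max_zero_rpow hm).comp
    (contDiff_const.sub ((contDiff_id.sub contDiff_const).norm_sq ℝ))

theorem hasGradientAt_ballCutoff {m : ℝ} (hm : 1 < m) (y : F) (R : ℝ) (x : F) :
    HasGradientAt (ballCutoff y R m)
      ((m * (max (R ^ 2 - ‖x - y‖ ^ 2) 0) ^ (m - 1)) • ((-2 : ℝ) • (x - y))) x := by
  have h : HasGradientAt (fun z : F => R ^ 2 - ‖z - y‖ ^ 2) ((-2 : ℝ) • (x - y)) x := by
    rw [hasGradientAt_iff_hasFDerivAt]
    have h1 := (((hasFDerivAt_id x).sub_const y).norm_sq).const_sub (R ^ 2)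
    refine h1.congr_fderiv ?_
    ext z
    simp
  exact (hasDerivAt_max_zero_rpow hm _).comp_hasGradientAt h

theorem norm_gradient_ballCutoff_le {m R : ℝ} (hm : 1 < m) (hR0 : 0 ≤ R) (hR : R ≤ 1) (y x : F) :
    ‖gradient (ballCutoff y R m) x‖ ≤ 2 * m * (max (R ^ 2 - ‖x - y‖ ^ 2) 0) ^ (m - 1) := by
  rw [(hasGradientAt_ballCutoff hm y R x).gradient, norm_smul, norm_smul, Real.norm_of_nonneg
    (mul_nonneg (by linarith) (Real.rpow_nonneg (le_max_right _ _) _))]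
  by_cases hx : x ∈ Metric.closedBall y R
  · rw [Metric.mem_closedBall, dist_eq_norm] at hx
    have h0 : 0 ≤ m * (max (R ^ 2 - ‖x - y‖ ^ 2) 0) ^ (m - 1) :=
      mul_nonneg (by linarith) (Real.rpow_nonneg (le_max_right _ _) _)
    have h1 : ‖(-2 : ℝ)‖ * ‖x - y‖ ≤ 2 := by
      rw [norm_neg, Real.norm_two]; linarith
    nlinarith [mul_le_mul_of_nonneg_left h1 h0]
  · rw [max_sq_sub_of_notMem hR0 hx, Real.zero_rpow (by linarith)]
    simp

/-- The product of the cutoff with the smoothed truncation of `v` at level `ℓ`. -/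
noncomputable def cutTrunc (y : F) (R m δ ℓ : ℝ) (v : F → ℝ) (x : F) : ℝ :=
  ballCutoff y R m x * softPos δ (v x - ℓ)

variable {y : F} {R m δ ℓ : ℝ} {v : F → ℝ}

theorem cutTrunc_nonneg (x : F) : 0 ≤ cutTrunc y R m δ ℓ v x :=
  mul_nonneg (ballCutoff_nonneg _ _ _ _) (softPos_nonneg _ _)

theorem contDiff_cutTrunc (hm : 1 < m) (hδ : 0 < δ) (hv : ContDiff ℝ 1 v) :
    ContDiff ℝ 1 (cutTrunc y R m δ ℓ v) :=
  (contDiff_ballCutoff hm y R).mul ((contDiff_softPos hδ).comp (hv.sub contDiff_const))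

theorem hasGradientAt_softPos_sub (hδ : 0 < δ) (hv : ContDiff ℝ 1 v) (x : F) :
    HasGradientAt (fun z => softPos δ (v z - ℓ))
      (softPosDeriv δ (v x - ℓ) • gradient v x) x := by
  have h : HasGradientAt (fun z => v z - ℓ) (gradient v x) x := by
    have := hv.hasGradientAt_gradient x
    rw [hasGradientAt_iff_hasFDerivAt] at this ⊢
    exact this.sub_const ℓ
  exact (hasDerivAt_softPos hδ _).comp_hasGradientAt h

theorem hasGradientAt_cutTrunc (hm : 1 < m) (hδ : 0 < δ) (hv : ContDiff ℝ 1 v) (x : F) :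
    HasGradientAt (cutTrunc y R m δ ℓ v)
      (ballCutoff y R m x • (softPosDeriv δ (v x - ℓ) • gradient v x) +
        softPos δ (v x - ℓ) • gradient (ballCutoff y R m) x) x :=
  ((contDiff_ballCutoff hm y R).hasGradientAt_gradient x).mul_real
    (hasGradientAt_softPos_sub hδ hv x)

theorem cutTrunc_of_notMem (hR0 : 0 ≤ R) (hm : 0 < m) {x : F}
    (hx : x ∉ Metric.closedBall y R) : cutTrunc y R m δ ℓ v x = 0 := by
  rw [cutTrunc, ballCutoff_of_notMem hR0 hm hx, zero_mul]

theorem hasCompactSupport_cutTrunc [ProperSpace F] (hR0 : 0 ≤ R) (hm : 0 < m) :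
    HasCompactSupport (cutTrunc y R m δ ℓ v) :=
  HasCompactSupport.intro (isCompact_closedBall y R) fun _ hx => cutTrunc_of_notMem hR0 hm hx

end Gradient

/-- `C` is an admissible constant in the Gagliardo–Nirenberg–Sobolev inequality for `W^{1,1}`. -/
def IsSobolevConst (N : ℕ) (C : ℝ) : Prop :=
  0 < C ∧ ∀ f : EuclideanSpace ℝ (Fin N) → ℝ, ContDiff ℝ 1 f → HasCompactSupport f →
    (∀ x, 0 ≤ f x) →
    ∫ x, f x ^ ((N : ℝ) / (N - 1)) ≤ C * (∫ x, ‖fderiv ℝ f x‖) ^ ((N : ℝ) / (N - 1))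

theorem exists_isSobolevConst {N : ℕ} (hN : 2 ≤ N) : ∃ C, IsSobolevConst N C := by
  have hN1 : (1 : ℝ) < N := by exact_mod_cast hN
  have hconj : Real.HolderConjugate
      (Module.finrank ℝ (EuclideanSpace ℝ (Fin N))) ((N : ℝ) / (N - 1)) := by
    have := Real.HolderConjugate.conjExponent hN1
    simpa [Real.conjExponent] using this
  set κ : ℝ := (N : ℝ) / (N - 1) with hκ
  have hκ0 : 0 < κ := hconj.symm.pos
  set C := lintegralPowLePowLIntegralFDerivConst
    (volume : Measure (EuclideanSpace ℝ (Fin N))) κ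
  refine ⟨C + 1, by positivity, fun f hf hfc hf0 => ?_⟩
  have h := lintegral_pow_le_pow_lintegral_fderiv
    (volume : Measure (EuclideanSpace ℝ (Fin N))) hf hfc hconj
  have hinteg : Integrable (fun x => ‖fderiv ℝ f x‖) :=
    ((hf.continuous_fderiv one_ne_zero).integrable_of_hasCompactSupport (hfc.fderiv ℝ)).norm
  have hI : ∫⁻ x, ‖fderiv ℝ f x‖ₑ = ENNReal.ofReal (∫ x, ‖fderiv ℝ f x‖) := by
    rw [ofReal_integral_eq_lintegral_ofReal hinteg (Eventually.of_forall fun _ => norm_nonneg _)]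
    simp [ofReal_norm]
  have hI0 : 0 ≤ ∫ x, ‖fderiv ℝ f x‖ := integral_nonneg fun _ => norm_nonneg _
  rw [integral_eq_lintegral_of_nonneg_ae
    (Eventually.of_forall fun x => Real.rpow_nonneg (hf0 x) _)
    ((hf.continuous.rpow_const fun _ => Or.inr hκ0.le).aestronglyMeasurable)]
  refine ENNReal.toReal_le_of_le_ofReal (by positivity) ?_
  rw [ENNReal.ofReal_mul (by positivity), ← ENNReal.ofReal_rpow_of_nonneg hI0 hκ0.le, ← hI]
  calc ∫⁻ x, ENNReal.ofReal (f x ^ κ) = ∫⁻ x, ‖f x‖ₑ ^ κ := by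
        refine lintegral_congr fun x => ?_
        rw [← ofReal_norm, Real.norm_of_nonneg (hf0 x),
          ENNReal.ofReal_rpow_of_nonneg (hf0 x) hκ0.le]
    _ ≤ _ := h
    _ ≤ _ := by
        gcongr
        rw [← ENNReal.ofReal_coe_nnreal]
        exact ENNReal.ofReal_le_ofReal (by linarith)

/-! ### Local energy estimates -/

section Local

variable {N : ℕ}

theorem Continuous.integrableOn_closedBall' {f : EuclideanSpace ℝ (Fin N) → ℝ}
    (hf : Continuous f) (y : EuclideanSpace ℝ (Fin N)) (R : ℝ) :
    IntegrableOn f (Metric.closedBall y R) :=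
  hf.continuousOn.integrableOn_compact (isCompact_closedBall y R)

theorem setIntegral_closedBall_mono {f g : EuclideanSpace ℝ (Fin N) → ℝ}
    (hf : Continuous f) (hg : Continuous g) {y : EuclideanSpace ℝ (Fin N)} {R : ℝ}
    (h : ∀ x ∈ Metric.closedBall y R, f x ≤ g x) :
    ∫ x in Metric.closedBall y R, f x ≤ ∫ x in Metric.closedBall y R, g x :=
  setIntegral_mono_on (hf.integrableOn_closedBall' y R) (hg.integrableOn_closedBall' y R)
    Metric.isClosed_closedBall.measurableSet h

theorem continuous_softPos_sub {δ ℓ : ℝ} (hδ : 0 < δ) {v : EuclideanSpace ℝ (Fin N) → ℝ}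
    (hv : ContDiff ℝ 1 v) : Continuous fun x => softPos δ (v x - ℓ) :=
  (contDiff_softPos hδ).continuous.comp (hv.continuous.sub continuous_const)

theorem continuous_energy {δ ℓ R m : ℝ} {y : EuclideanSpace ℝ (Fin N)} (hm : 1 < m) (hδ : 0 < δ)
    {p v : EuclideanSpace ℝ (Fin N) → ℝ} (hp : Continuous p) (hp1 : ∀ x, 1 < p x)
    (hv : ContDiff ℝ 1 v) :
    Continuous fun x => ballCutoff y R m x * softPosDeriv δ (v x - ℓ) * ‖gradient v x‖ ^ p x :=
  ((contDiff_ballCutoff hm y R).continuous.mul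
    ((continuous_softPosDeriv hδ).comp (hv.continuous.sub continuous_const))).mul
    (hv.continuous_gradient.norm.rpow hp fun x => Or.inr (by linarith [hp1 x]))

/-- The Sobolev inequality for a power of a localized truncation. -/
theorem setIntegral_softPos_rpow_le {C : ℝ} (hC : IsSobolevConst N C) (hN : 2 ≤ N)
    {p v : EuclideanSpace ℝ (Fin N) → ℝ} (hp : Continuous p) (hp1 : ∀ x, 1 < p x)
    (hv : ContDiff ℝ 1 v) {β δ ℓ R R' : ℝ} (hβ : 1 < β) (hδ : 0 < δ) (hR' : 0 ≤ R')
    (hRR : R' ≤ R) (hR : R ≤ 1) (y : EuclideanSpace ℝ (Fin N)) :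
    (R ^ 2 - R' ^ 2) ^ (N * (β * (N / (N - 1)))) *
      ∫ x in Metric.closedBall y R', softPos δ (v x - ℓ) ^ (β * ((N : ℝ) / (N - 1))) ≤
    C * (β * ∫ x in Metric.closedBall y R,
      (softPos δ (v x - ℓ) ^ ((β - 1) * (p x / (p x - 1))) +
        ballCutoff y R N x * softPosDeriv δ (v x - ℓ) * ‖gradient v x‖ ^ p x +
        2 * N * softPos δ (v x - ℓ) ^ β)) ^ ((N : ℝ) / (N - 1)) := by
  have hN1 : (1 : ℝ) < N := by exact_mod_cast hN
  have hR0 : 0 ≤ R := hR'.trans hRR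
  set κ : ℝ := (N : ℝ) / (N - 1) with hκ
  have hκ0 : 0 < κ := div_pos (by linarith) (by linarith)
  have hκβ : 0 < β * κ := by positivity
  set U := cutTrunc y R N δ ℓ v with hU
  set G : EuclideanSpace ℝ (Fin N) → ℝ := fun x => softPos δ (v x - ℓ) with hG
  have hU0 : ∀ x, 0 ≤ U x := fun x => cutTrunc_nonneg x
  have hG0 : ∀ x, 0 ≤ G x := fun x => softPos_nonneg _ _
  have hUG : ∀ x, U x ≤ G x := fun x =>
    mul_le_of_le_one_left (hG0 x) (ballCutoff_le_one hR0 hR (by linarith) y x)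
  have hUd : ContDiff ℝ 1 U := contDiff_cutTrunc hN1 hδ hv
  have hGc : Continuous G := continuous_softPos_sub hδ hv
  set f : EuclideanSpace ℝ (Fin N) → ℝ := fun x => (max (U x) 0) ^ β with hf
  have hfU : ∀ x, f x = U x ^ β := fun x => by simp only [hf, max_eq_left (hU0 x)]
  have hfd : ContDiff ℝ 1 f := (contDiff_max_zero_rpow hβ).comp hUd
  have hUout : ∀ x, x ∉ Metric.closedBall y R → U x = 0 := fun x hx =>
    cutTrunc_of_notMem hR0 (by linarith) hx
  have hfc : HasCompactSupport f :=
    HasCompactSupport.intro (isCompact_closedBall y R) fun x hx => by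
      rw [hfU, hUout x hx, Real.zero_rpow (by linarith)]
  have hf0 : ∀ x, 0 ≤ f x := fun x => Real.rpow_nonneg (le_max_right _ _) _
  have hgrad : ∀ x, HasGradientAt f ((β * U x ^ (β - 1)) •
      (ballCutoff y R N x • (softPosDeriv δ (v x - ℓ) • gradient v x) +
        G x • gradient (ballCutoff y R N) x)) x := fun x => by
    have h := (hasDerivAt_max_zero_rpow hβ (U x)).comp_hasGradientAt
      (hasGradientAt_cutTrunc (y := y) (R := R) (ℓ := ℓ) hN1 hδ hv x)
    rwa [max_eq_left (hU0 x)] at h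
  have hout : ∀ x, x ∉ Metric.closedBall y R → ‖fderiv ℝ f x‖ = 0 := fun x hx => by
    rw [(hgrad x).norm_fderiv_eq, hUout x hx, Real.zero_rpow (by linarith)]
    simp
  have hbound : ∀ x ∈ Metric.closedBall y R, ‖fderiv ℝ f x‖ ≤
      β * (G x ^ ((β - 1) * (p x / (p x - 1))) +
        ballCutoff y R N x * softPosDeriv δ (v x - ℓ) * ‖gradient v x‖ ^ p x +
        2 * N * G x ^ β) := fun x _ => by
    set η := ballCutoff y R N x
    set F' := softPosDeriv δ (v x - ℓ)
    set s := ‖gradient v x‖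
    have hη0 : 0 ≤ η := ballCutoff_nonneg _ _ _ _
    have hη1 : η ≤ 1 := ballCutoff_le_one hR0 hR (by linarith) y x
    have hF0 : 0 ≤ F' := softPosDeriv_nonneg _ _
    have hF1 : F' ≤ 1 := softPosDeriv_le_one _ _
    have hs0 : 0 ≤ s := norm_nonneg _
    have hgη : ‖gradient (ballCutoff y R N) x‖ ≤ 2 * N :=
      (norm_gradient_ballCutoff_le hN1 hR0 hR y x).trans
        (mul_le_of_le_one_right (by linarith) (Real.rpow_le_one (le_max_right _ _)
          (max_sq_sub_le_one hR0 hR y x) (by linarith)))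
    have hUp : U x ^ (β - 1) ≤ G x ^ (β - 1) :=
      Real.rpow_le_rpow (hU0 x) (hUG x) (by linarith)
    have hUp0 : 0 ≤ U x ^ (β - 1) := Real.rpow_nonneg (hU0 x) _
    have h1 : ‖η • (F' • gradient v x) + G x • gradient (ballCutoff y R N) x‖ ≤
        η * F' * s + G x * (2 * N) := by
      refine (norm_add_le _ _).trans (add_le_add ?_ ?_)
      · rw [norm_smul, norm_smul, Real.norm_of_nonneg hη0, Real.norm_of_nonneg hF0, mul_assoc]
      · rw [norm_smul, Real.norm_of_nonneg (hG0 x)]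
        exact mul_le_mul_of_nonneg_left hgη (hG0 x)
    have h2 : G x ^ (β - 1) * (η * F' * s) ≤
        G x ^ ((β - 1) * (p x / (p x - 1))) + η * F' * s ^ p x := by
      have h := mul_le_rpow_add_rpow (hp1 x) (Real.rpow_nonneg (hG0 x) (β - 1))
        (by positivity : 0 ≤ η * F' * s)
      rw [← Real.rpow_mul (hG0 x), Real.mul_rpow (by positivity) hs0] at h
      refine h.trans (add_le_add_right (mul_le_mul_of_nonneg_right ?_ (by positivity)) _)
      exact Real.rpow_le_self_of_le_one (by positivity) (mul_le_one₀ hη1 hF0 hF1) (hp1 x).le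
    have h3 : G x ^ (β - 1) * G x = G x ^ β := by
      rcases (hG0 x).eq_or_lt with h | h
      · rw [← h, Real.zero_rpow (by linarith : β ≠ 0), mul_zero]
      · rw [← Real.rpow_add_one h.ne']; ring_nf
    rw [(hgrad x).norm_fderiv_eq, norm_smul, Real.norm_of_nonneg (by positivity), mul_assoc]
    refine mul_le_mul_of_nonneg_left ?_ (by linarith)
    calc U x ^ (β - 1) * ‖_‖ ≤ G x ^ (β - 1) * (η * F' * s + G x * (2 * N)) :=
          mul_le_mul hUp h1 (norm_nonneg _) (Real.rpow_nonneg (hG0 x) _)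
      _ = G x ^ (β - 1) * (η * F' * s) + 2 * N * (G x ^ (β - 1) * G x) := by ring
      _ ≤ _ := by rw [h3]; linarith
  have hIfd : ∫ x, ‖fderiv ℝ f x‖ ≤ β * ∫ x in Metric.closedBall y R,
      (G x ^ ((β - 1) * (p x / (p x - 1))) +
        ballCutoff y R N x * softPosDeriv δ (v x - ℓ) * ‖gradient v x‖ ^ p x +
        2 * N * G x ^ β) := by
    rw [← setIntegral_eq_integral_of_forall_compl_eq_zero hout, ← integral_const_mul]
    refine setIntegral_closedBall_mono (hfd.continuous_fderiv one_ne_zero).norm ?_ hbound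
    refine continuous_const.mul (((hGc.rpow ?_ ?_).add ?_).add ?_)
    · refine continuous_const.mul (hp.div (hp.sub continuous_const) fun x => ?_)
      linarith [hp1 x]
    · intro x
      have := hp1 x
      exact Or.inr (mul_pos (by linarith) (div_pos (by linarith) (by linarith)))
    · exact continuous_energy hN1 hδ hp hp1 hv
    · exact continuous_const.mul (hGc.rpow_const fun x => Or.inr (by linarith))
  have hS := hC.2 f hfd hfc hf0
  have hlow : (R ^ 2 - R' ^ 2) ^ (N * (β * κ)) * ∫ x in Metric.closedBall y R', G x ^ (β * κ) ≤
      ∫ x, f x ^ κ := by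
    have hfκc : Continuous fun x => f x ^ κ := hfd.continuous.rpow_const fun _ => Or.inr hκ0.le
    have hfκ : Integrable fun x => f x ^ κ :=
      hfκc.integrable_of_hasCompactSupport
        (HasCompactSupport.intro (isCompact_closedBall y R) fun x hx => by
          rw [hfU, hUout x hx, Real.zero_rpow (by linarith), Real.zero_rpow hκ0.ne'])
    rw [← integral_const_mul]
    refine le_trans (setIntegral_closedBall_mono (g := fun x => f x ^ κ)
      (continuous_const.mul (hGc.rpow_const fun _ => Or.inr hκβ.le)) hfκc ?_)
      (setIntegral_le_integral hfκ (Eventually.of_forall fun x => Real.rpow_nonneg (hf0 x) _))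
    intro x hx
    rw [Metric.mem_closedBall, dist_eq_norm] at hx
    have hd : 0 ≤ R ^ 2 - R' ^ 2 := by nlinarith
    have hb : R ^ 2 - R' ^ 2 ≤ max (R ^ 2 - ‖x - y‖ ^ 2) 0 :=
      le_max_of_le_left (by nlinarith [norm_nonneg (x - y)])
    rw [hfU, ← Real.rpow_mul (hU0 x), hU, cutTrunc, Real.mul_rpow (ballCutoff_nonneg _ _ _ _)
      (hG0 x), ballCutoff, ← Real.rpow_mul (le_max_right _ _)]
    exact mul_le_mul_of_nonneg_right
      (Real.rpow_le_rpow hd hb (by positivity)) (Real.rpow_nonneg (hG0 x) _)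
  refine hlow.trans (hS.trans (mul_le_mul_of_nonneg_left ?_ hC.1.le))
  exact Real.rpow_le_rpow (integral_nonneg fun _ => norm_nonneg _) hIfd hκ0.le

/-- The double phase flux `|∇v|^{p-2}∇v + a|∇v|^{q-2}∇v`. -/
noncomputable def doublePhaseFlux (p q a v : EuclideanSpace ℝ (Fin N) → ℝ)
    (x : EuclideanSpace ℝ (Fin N)) : EuclideanSpace ℝ (Fin N) :=
  (‖gradient v x‖ ^ (p x - 2) + a x * ‖gradient v x‖ ^ (q x - 2)) • gradient v x

theorem rpow_sub_two_mul_self {s p : ℝ} (hs : 0 ≤ s) (hp : 1 < p) :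
    s ^ (p - 2) * s = s ^ (p - 1) := by
  rcases hs.eq_or_lt with rfl | hs
  · rw [mul_zero, Real.zero_rpow (by linarith)]
  · rw [← Real.rpow_add_one hs.ne']; ring_nf

theorem rpow_sub_one_mul_self {s p : ℝ} (hs : 0 ≤ s) (hp : 1 < p) :
    s ^ (p - 1) * s = s ^ p := by
  rcases hs.eq_or_lt with rfl | hs
  · rw [mul_zero, Real.zero_rpow (by linarith)]
  · rw [← Real.rpow_add_one hs.ne']; ring_nf

section Flux

variable {p q a v : EuclideanSpace ℝ (Fin N) → ℝ}

theorem norm_doublePhaseFlux (hp1 : ∀ x, 1 < p x) (hq1 : ∀ x, 1 < q x) (ha : ∀ x, 0 ≤ a x)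
    (x : EuclideanSpace ℝ (Fin N)) : ‖doublePhaseFlux p q a v x‖ =
      ‖gradient v x‖ ^ (p x - 1) + a x * ‖gradient v x‖ ^ (q x - 1) := by
  have := ha x
  rw [doublePhaseFlux, norm_smul, Real.norm_of_nonneg (by positivity), add_mul, mul_assoc,
    rpow_sub_two_mul_self (norm_nonneg _) (hp1 x), rpow_sub_two_mul_self (norm_nonneg _) (hq1 x)]

theorem inner_doublePhaseFlux_gradient (hp1 : ∀ x, 1 < p x) (hq1 : ∀ x, 1 < q x)
    (x : EuclideanSpace ℝ (Fin N)) : inner ℝ (doublePhaseFlux p q a v x) (gradient v x) =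
      ‖gradient v x‖ ^ p x + a x * ‖gradient v x‖ ^ q x := by
  rw [doublePhaseFlux, real_inner_smul_left, real_inner_self_eq_norm_mul_norm, ← mul_assoc,
    add_mul, mul_assoc, rpow_sub_two_mul_self (norm_nonneg _) (hp1 x),
    rpow_sub_two_mul_self (norm_nonneg _) (hq1 x), add_mul, mul_assoc,
    rpow_sub_one_mul_self (norm_nonneg _) (hp1 x), rpow_sub_one_mul_self (norm_nonneg _) (hq1 x)]

theorem locallyIntegrable_doublePhaseFlux (hp : Continuous p) (hq : Continuous q)
    (hac : Continuous a) (hp1 : ∀ x, 1 < p x) (hq1 : ∀ x, 1 < q x) (ha : ∀ x, 0 ≤ a x)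
    (hv : ContDiff ℝ 1 v) : LocallyIntegrable (doublePhaseFlux p q a v) := by
  have hg := hv.continuous_gradient
  have hb : Continuous fun x =>
      ‖gradient v x‖ ^ (p x - 1) + a x * ‖gradient v x‖ ^ (q x - 1) :=
    (hg.norm.rpow (hp.sub continuous_const) fun x => Or.inr (sub_pos.mpr (hp1 x))).add
      (hac.mul (hg.norm.rpow (hq.sub continuous_const) fun x => Or.inr (sub_pos.mpr (hq1 x))))
  have hm : Measurable (doublePhaseFlux p q a v) := by
    have h1 := hg.measurable
    have h2 := hp.measurable
    have h3 := hq.measurable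
    have h4 := hac.measurable
    unfold doublePhaseFlux
    fun_prop
  refine hb.locallyIntegrable.mono hm.aestronglyMeasurable (Eventually.of_forall fun x => ?_)
  rw [norm_doublePhaseFlux hp1 hq1 ha]
  exact le_abs_self _

end Flux

theorem integrable_inner_of_hasCompactSupport {X Y : EuclideanSpace ℝ (Fin N) →
    EuclideanSpace ℝ (Fin N)} (hX : LocallyIntegrable X) (hY : Continuous Y)
    (hYc : HasCompactSupport Y) : Integrable fun x => inner ℝ (X x) (Y x) := by
  obtain ⟨M, hM⟩ := hY.bounded_above_of_compact_support hYc
  have hK : IsCompact (tsupport Y) := hYc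
  have h1 : IntegrableOn (fun x => inner ℝ (X x) (Y x)) (tsupport Y) := by
    have hXi := hX.integrableOn_isCompact hK
    refine (hXi.norm.mul_const M).mono'
      (hXi.aestronglyMeasurable.inner hY.aestronglyMeasurable) (Eventually.of_forall fun x => ?_)
    exact (norm_inner_le_norm _ _).trans (mul_le_mul_of_nonneg_left (hM x) (norm_nonneg _))
  rw [← integrableOn_iff_integrable_of_support_subset (s := tsupport Y)]
  · exact h1
  · intro x hx
    by_contra hx'
    exact hx (by simp [image_eq_zero_of_notMem_tsupport hx'])

end Local

section DeGiorgi

variable {N : ℕ}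

/-- `v` is a weak subsolution, on the set `{v > 0}`, of the double phase equation whose right-hand
side has growth `Cm |v|^{γ-1}`. -/
def IsSubsolution (p q a γ : EuclideanSpace ℝ (Fin N) → ℝ) (Cm : ℝ)
    (v : EuclideanSpace ℝ (Fin N) → ℝ) : Prop :=
  ∀ φ : EuclideanSpace ℝ (Fin N) → ℝ, ContDiff ℝ 1 φ → HasCompactSupport φ → (∀ x, 0 ≤ φ x) →
    (∀ x, v x ≤ 0 → φ x = 0) →
    ∫ x, inner ℝ (doublePhaseFlux p q a v x) (gradient φ x) ≤
      ∫ x, Cm * |v x| ^ (γ x - 1) * φ x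

theorem HasCompactSupport.gradient {φ : EuclideanSpace ℝ (Fin N) → ℝ} (hφ : HasCompactSupport φ) :
    HasCompactSupport (gradient φ) :=
  (hφ.fderiv ℝ).comp_left (map_zero _)

variable {p q a γ v : EuclideanSpace ℝ (Fin N) → ℝ} {Cm Λ : ℝ}

/-- The Caccioppoli inequality for subsolutions. -/
theorem IsSubsolution.caccioppoli (hv : IsSubsolution p q a γ Cm v) (hvd : ContDiff ℝ 1 v)
    (hN : 2 ≤ N) (hp : Continuous p) (hq : Continuous q) (hac : Continuous a) (hγ : Continuous γ)
    (hp1 : ∀ x, 1 < p x) (hpq : ∀ x, p x ≤ q x) (hqN : ∀ x, q x ≤ N) (hγ1 : ∀ x, 1 < γ x)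
    (ha : ∀ x, 0 ≤ a x) (haΛ : ∀ x, a x ≤ Λ) (hCm : 0 ≤ Cm) {δ ℓ R : ℝ} (hδ : 0 < δ) (hℓ : 0 ≤ ℓ)
    (hR0 : 0 ≤ R) (hR : R ≤ 1) (y : EuclideanSpace ℝ (Fin N)) :
    ∫ x in Metric.closedBall y R,
      ballCutoff y R N x * softPosDeriv δ (v x - ℓ) * ‖gradient v x‖ ^ p x ≤
    ∫ x in Metric.closedBall y R, 2 * ((4 * N) ^ (N : ℝ) * (1 + Λ) + Cm) *
      (max (v x - ℓ) 0 ^ p x + max (v x - ℓ) 0 ^ q x +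
        |v x| ^ (γ x - 1) * max (v x - ℓ) 0) := by
  have hN1 : (1 : ℝ) < N := by exact_mod_cast hN
  have hq1 : ∀ x, 1 < q x := fun x => (hp1 x).trans_le (hpq x)
  have hΛ : 0 ≤ Λ := (ha y).trans (haΛ y)
  have hvc := hvd.continuous
  set φ := cutTrunc y R N δ ℓ v with hφ
  have hφd : ContDiff ℝ 1 φ := contDiff_cutTrunc hN1 hδ hvd
  have hφc : HasCompactSupport φ := hasCompactSupport_cutTrunc hR0 (by linarith)
  have hφ0 : ∀ x, 0 ≤ φ x := fun x => cutTrunc_nonneg x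
  have hsub := hv φ hφd hφc hφ0 fun x hx => by
    rw [hφ, cutTrunc, softPos_of_nonpos hδ (by linarith), mul_zero]
  set t : EuclideanSpace ℝ (Fin N) → ℝ := fun x => max (v x - ℓ) 0 with ht
  have ht0 : ∀ x, 0 ≤ t x := fun x => le_max_right _ _
  have htc : Continuous t := (hvc.sub continuous_const).max continuous_const
  set K : ℝ := (4 * N) ^ (N : ℝ) with hK
  have hK0 : 0 ≤ K := by positivity
  set e : EuclideanSpace ℝ (Fin N) → ℝ := fun x =>
    ballCutoff y R N x * softPosDeriv δ (v x - ℓ) * ‖gradient v x‖ ^ p x with he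
  have hec : Continuous e := continuous_energy hN1 hδ hp hp1 hvd
  have htp : Continuous fun x => t x ^ p x := htc.rpow hp fun x => Or.inr (by linarith [hp1 x])
  have htq : Continuous fun x => t x ^ q x := htc.rpow hq fun x => Or.inr (by linarith [hq1 x])
  have hvg : Continuous fun x => |v x| ^ (γ x - 1) :=
    hvc.abs.rpow (hγ.sub continuous_const) fun x => Or.inr (sub_pos.mpr (hγ1 x))
  have hinteg : Integrable fun x => inner ℝ (doublePhaseFlux p q a v x) (gradient φ x) :=
    integrable_inner_of_hasCompactSupport
      (locallyIntegrable_doublePhaseFlux hp hq hac hp1 hq1 ha hvd) hφd.continuous_gradient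
      hφc.gradient
  have hgrad : ∀ x, gradient φ x =
      ballCutoff y R N x • (softPosDeriv δ (v x - ℓ) • gradient v x) +
        softPos δ (v x - ℓ) • gradient (ballCutoff y R N) x := fun x =>
    (hasGradientAt_cutTrunc hN1 hδ hvd x).gradient
  have hout : ∀ x, x ∉ Metric.closedBall y R →
      inner ℝ (doublePhaseFlux p q a v x) (gradient φ x) = 0 := fun x hx => by
    have h1 : gradient (ballCutoff y R N) x = 0 := by
      rw [← norm_le_zero_iff]
      refine (norm_gradient_ballCutoff_le hN1 hR0 hR y x).trans ?_
      rw [max_sq_sub_of_notMem hR0 hx, Real.zero_rpow (by linarith), mul_zero]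
    rw [hgrad, h1, ballCutoff_of_notMem hR0 (by linarith) hx]
    simp
  have hyoung : ∀ x, ∀ r : ℝ, 1 < r → r ≤ N →
      softPos δ (v x - ℓ) * (‖gradient v x‖ ^ (r - 1) * ‖gradient (ballCutoff y R N) x‖) ≤
        ballCutoff y R N x * softPosDeriv δ (v x - ℓ) * ‖gradient v x‖ ^ r / 2 +
          K * t x ^ r := fun x r hr1 hrN => by
    set ζ := max (R ^ 2 - ‖x - y‖ ^ 2) 0 with hζ
    have hζ0 : 0 ≤ ζ := le_max_right _ _
    have hζ1 : ζ ≤ 1 := max_sq_sub_le_one hR0 hR y x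
    set s := ‖gradient v x‖
    have hs0 : 0 ≤ s := norm_nonneg _
    have hF0 := softPosDeriv_nonneg δ (v x - ℓ)
    have hF1 := softPosDeriv_le_one δ (v x - ℓ)
    have hG0 := softPos_nonneg δ (v x - ℓ)
    have hGF : softPos δ (v x - ℓ) ≤ t x * softPosDeriv δ (v x - ℓ) := softPos_le_mul_deriv hδ _
    have hη := norm_gradient_ballCutoff_le hN1 hR0 hR y x
    rw [← hζ] at hη
    have hbc : ballCutoff y R N x = ζ ^ (N : ℝ) := rfl
    rw [hbc]
    set F' := softPosDeriv δ (v x - ℓ)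
    set G := softPos δ (v x - ℓ)
    have hKt : (4 * N * t x) ^ r ≤ K * t x ^ r := by
      rw [Real.mul_rpow (by positivity) (ht0 x)]
      exact mul_le_mul_of_nonneg_right
        (Real.rpow_le_rpow_of_exponent_le (by linarith) hrN) (Real.rpow_nonneg (ht0 x) _)
    rcases hζ0.eq_or_lt with h0 | hζpos
    · have hz : ‖gradient (ballCutoff y R N) x‖ = 0 := by
        refine le_antisymm (hη.trans ?_) (norm_nonneg _)
        rw [← h0, Real.zero_rpow (by linarith), mul_zero]
      rw [hz, mul_zero, mul_zero]
      have := ht0 x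
      positivity
    · have hy1 := mul_rpow_sub_one_le hr1
        (div_nonneg (mul_nonneg (by positivity : (0 : ℝ) ≤ 2 * N) (ht0 x)) hζ0) hs0
      have hζN : ζ ^ ((N : ℝ) - 1) = ζ ^ (N : ℝ) / ζ := by
        rw [Real.rpow_sub hζpos, Real.rpow_one]
      have hr2 : ζ ^ (N : ℝ) * (2 * (2 * N * t x / ζ)) ^ r ≤ (4 * N * t x) ^ r := by
        have e1 : 2 * (2 * N * t x / ζ) = (4 * N * t x) / ζ := by ring
        rw [e1, Real.div_rpow (mul_nonneg (by positivity) (ht0 x)) hζ0, mul_div_assoc',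
          div_le_iff₀ (by positivity), mul_comm]
        exact mul_le_mul_of_nonneg_left (Real.rpow_le_rpow_of_exponent_ge hζpos hζ1 hrN)
          (Real.rpow_nonneg (mul_nonneg (by positivity) (ht0 x)) _)
      calc G * (s ^ (r - 1) * ‖gradient (ballCutoff y R N) x‖)
          ≤ (t x * F') * (s ^ (r - 1) * (2 * N * ζ ^ ((N : ℝ) - 1))) := by
            gcongr
        _ = F' * (ζ ^ (N : ℝ) * (2 * N * t x / ζ * s ^ (r - 1))) := by
            rw [hζN]; field_simp
        _ ≤ F' * (ζ ^ (N : ℝ) * (s ^ r / 2 + (2 * (2 * N * t x / ζ)) ^ r)) := by gcongr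
        _ = ζ ^ (N : ℝ) * F' * s ^ r / 2 +
            F' * (ζ ^ (N : ℝ) * (2 * (2 * N * t x / ζ)) ^ r) := by ring
        _ ≤ ζ ^ (N : ℝ) * F' * s ^ r / 2 + 1 * (4 * N * t x) ^ r := by
            gcongr
        _ ≤ _ := by linarith
  have hpt : ∀ x, e x / 2 - K * (1 + Λ) * (t x ^ p x + t x ^ q x) ≤
      inner ℝ (doublePhaseFlux p q a v x) (gradient φ x) := fun x => by
    have h1 := hyoung x (p x) (hp1 x) ((hpq x).trans (hqN x))
    have h2 := mul_le_mul_of_nonneg_left (hyoung x (q x) (hq1 x) (hqN x)) (ha x)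
    have hG0 := softPos_nonneg δ (v x - ℓ)
    have h3 : -(softPos δ (v x - ℓ) * ((‖gradient v x‖ ^ (p x - 1) +
        a x * ‖gradient v x‖ ^ (q x - 1)) * ‖gradient (ballCutoff y R N) x‖)) ≤
        softPos δ (v x - ℓ) *
          inner ℝ (doublePhaseFlux p q a v x) (gradient (ballCutoff y R N) x) := by
      rw [← mul_neg]
      refine mul_le_mul_of_nonneg_left ?_ hG0
      have := abs_le.mp (abs_real_inner_le_norm (doublePhaseFlux p q a v x)
        (gradient (ballCutoff y R N) x))
      rw [norm_doublePhaseFlux hp1 hq1 ha] at this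
      exact this.1
    rw [hgrad, inner_add_right, real_inner_smul_right, real_inner_smul_right,
      real_inner_smul_right, inner_doublePhaseFlux_gradient hp1 hq1]
    have hη0 : 0 ≤ ballCutoff y R N x := ballCutoff_nonneg _ _ _ _
    have hF0 := softPosDeriv_nonneg δ (v x - ℓ)
    have h4 : 0 ≤ a x * (ballCutoff y R N x * softPosDeriv δ (v x - ℓ) *
        ‖gradient v x‖ ^ q x) := by
      have := ha x
      positivity
    have htp0 : 0 ≤ t x ^ p x := Real.rpow_nonneg (ht0 x) _
    have htq0 : 0 ≤ t x ^ q x := Real.rpow_nonneg (ht0 x) _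
    have h5 : a x * (K * t x ^ q x) ≤ Λ * (K * t x ^ q x) :=
      mul_le_mul_of_nonneg_right (haΛ x) (by positivity)
    have h6 : 0 ≤ K * Λ * t x ^ p x := by positivity
    have h7 : 0 ≤ K * t x ^ q x := by positivity
    simp only [he]
    nlinarith
  have hec2 : Continuous fun x => e x / 2 := hec.div_const 2
  have hKc : Continuous fun x => K * (1 + Λ) * (t x ^ p x + t x ^ q x) :=
    continuous_const.mul (htp.add htq)
  have hCc : Continuous fun x => Cm * (|v x| ^ (γ x - 1) * t x) :=
    continuous_const.mul (hvg.mul htc)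
  have hlow : ∫ x in Metric.closedBall y R,
      (e x / 2 - K * (1 + Λ) * (t x ^ p x + t x ^ q x)) ≤
      ∫ x, inner ℝ (doublePhaseFlux p q a v x) (gradient φ x) := by
    rw [← setIntegral_eq_integral_of_forall_compl_eq_zero hout]
    refine setIntegral_mono ?_ hinteg.integrableOn hpt
    exact (hec2.sub hKc).integrableOn_closedBall' y R
  have hup : ∫ x, Cm * |v x| ^ (γ x - 1) * φ x ≤
      ∫ x in Metric.closedBall y R, Cm * (|v x| ^ (γ x - 1) * t x) := by
    rw [← setIntegral_eq_integral_of_forall_compl_eq_zero (s := Metric.closedBall y R)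
      fun x hx => by rw [hφ, cutTrunc_of_notMem hR0 (by linarith) hx, mul_zero]]
    refine setIntegral_closedBall_mono ((continuous_const.mul hvg).mul hφd.continuous) hCc
      fun x _ => ?_
    rw [mul_assoc]
    have hφt : φ x ≤ t x := (mul_le_of_le_one_left (softPos_nonneg _ _)
      (ballCutoff_le_one hR0 hR (by linarith) y x)).trans (softPos_le hδ _)
    exact mul_le_mul_of_nonneg_left (mul_le_mul_of_nonneg_left hφt
      (Real.rpow_nonneg (abs_nonneg _) _)) hCm
  have hfin := hlow.trans (hsub.trans hup)
  rw [integral_sub (hec2.integrableOn_closedBall' y R) (hKc.integrableOn_closedBall' y R),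
    integral_div] at hfin
  have hsum : (∫ x in Metric.closedBall y R, K * (1 + Λ) * (t x ^ p x + t x ^ q x)) +
      ∫ x in Metric.closedBall y R, Cm * (|v x| ^ (γ x - 1) * t x) ≤
      ∫ x in Metric.closedBall y R, (K * (1 + Λ) + Cm) *
      (t x ^ p x + t x ^ q x + |v x| ^ (γ x - 1) * t x) := by
    rw [← integral_add (hKc.integrableOn_closedBall' y R) (hCc.integrableOn_closedBall' y R)]
    refine setIntegral_closedBall_mono (hKc.add hCc)
      (continuous_const.mul ((htp.add htq).add (hvg.mul htc))) fun x _ => ?_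
    have htp0 : 0 ≤ t x ^ p x := Real.rpow_nonneg (ht0 x) _
    have htq0 : 0 ≤ t x ^ q x := Real.rpow_nonneg (ht0 x) _
    have h3 : 0 ≤ |v x| ^ (γ x - 1) * t x :=
      mul_nonneg (Real.rpow_nonneg (abs_nonneg _) _) (ht0 x)
    have h4 : 0 ≤ Cm * (t x ^ p x + t x ^ q x) := by positivity
    have h5 : 0 ≤ K * (1 + Λ) * (|v x| ^ (γ x - 1) * t x) := by positivity
    rw [Pi.add_apply, Pi.mul_apply, Pi.add_apply, Pi.add_apply, Pi.mul_apply, add_mul]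
    linarith [mul_add (K * (1 + Λ)) (t x ^ p x + t x ^ q x) (|v x| ^ (γ x - 1) * t x),
      mul_add Cm (t x ^ p x + t x ^ q x) (|v x| ^ (γ x - 1) * t x)]
  simp_rw [mul_assoc (2 : ℝ)]
  rw [integral_const_mul]
  linarith

end DeGiorgi

section Iteration

variable {N : ℕ} {p q a γ v : EuclideanSpace ℝ (Fin N) → ℝ} {Cm Λ : ℝ}

theorem rpow_le_mul_of_level {δ w z e g Γ : ℝ} (hδ : 0 < δ) (hz : 0 ≤ z) (hzw : z ≤ w)
    (hw : 0 < z → δ ≤ w) (he : 0 < e) (heg : e ≤ g) (hge : g ≤ Γ) :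
    z ^ e ≤ (1 + δ ^ (-Γ)) * w ^ g := by
  have hw0 : 0 ≤ w := hz.trans hzw
  rcases hz.eq_or_lt with rfl | hz'
  · rw [Real.zero_rpow he.ne']
    positivity
  · exact (Real.rpow_le_rpow hz hzw he.le).trans
      (rpow_le_of_level hδ (hw hz') heg (by linarith))

/-- One step of the De Giorgi iteration. -/
theorem IsSubsolution.level_step (hv : IsSubsolution p q a γ Cm v) (hvd : ContDiff ℝ 1 v)
    {C : ℝ} (hC : IsSobolevConst N C)
    (hN : 2 ≤ N) (hp : Continuous p) (hq : Continuous q) (hac : Continuous a) (hγ : Continuous γ)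
    (hp1 : ∀ x, 1 < p x) (hpq : ∀ x, p x ≤ q x) (hqN : ∀ x, q x ≤ N) (hqγ : ∀ x, q x ≤ γ x)
    (ha : ∀ x, 0 ≤ a x) (haΛ : ∀ x, a x ≤ Λ) (hCm : 0 ≤ Cm) {β d Γ ρ : ℝ}
    (hβ : 1 < β) (hd : 0 ≤ d) (hγΓ : ∀ x, γ x ≤ Γ) (hβΓ : β * ((N : ℝ) / (N - 1)) ≤ Γ) (hρ : ρ ≤ 1)
    (y : EuclideanSpace ℝ (Fin N))
    (hβγ : ∀ x ∈ Metric.closedBall y ρ, β ≤ γ x)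
    (hβp : ∀ x ∈ Metric.closedBall y ρ, (β - 1) * (p x / (p x - 1)) ≤ γ x)
    (hγβ : ∀ x ∈ Metric.closedBall y ρ, γ x + d ≤ β * ((N : ℝ) / (N - 1)))
    {h δ R R' : ℝ} (hh : 0 ≤ h) (hδ : 0 < δ) (hR' : 0 ≤ R') (hRR : R' ≤ R) (hRρ : R ≤ ρ) :
    (R ^ 2 - R' ^ 2) ^ (N * Γ) *
      ∫ x in Metric.closedBall y R', max (v x - (h + 3 * δ)) 0 ^ γ x ≤
    (δ ^ (-d) + δ ^ (-Γ)) * (C * (Γ * ((1 + h / δ) ^ Γ * (1 + δ ^ (-Γ)) *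
      (1 + 2 * N + 3 * (2 * ((4 * N) ^ (N : ℝ) * (1 + Λ) + Cm)))) *
      ∫ x in Metric.closedBall y R, max (v x - h) 0 ^ γ x) ^ ((N : ℝ) / (N - 1))) := by
  have hN1 : (1 : ℝ) < N := by exact_mod_cast hN
  have hR1 : R ≤ 1 := hRρ.trans hρ
  have hR0 : 0 ≤ R := hR'.trans hRR
  have hρ0 : 0 ≤ ρ := hR0.trans hRρ
  set κ : ℝ := (N : ℝ) / (N - 1) with hκ
  have hκ1 : 1 ≤ κ := by rw [hκ, le_div_iff₀ (by linarith)]; linarith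
  have hκ0 : 0 < κ := by linarith
  have hΛ : 0 ≤ Λ := (ha y).trans (haΛ y)
  have hvc := hvd.continuous
  have hγ1 : ∀ x, 1 < γ x := fun x => (hp1 x).trans_le ((hpq x).trans (hqγ x))
  have hΓ1 : 1 < Γ := (hγ1 y).trans_le (hγΓ y)
  have hβΓ' : β ≤ Γ := (le_mul_of_one_le_right (by linarith) hκ1).trans hβΓ
  set K : ℝ := 2 * ((4 * N) ^ (N : ℝ) * (1 + Λ) + Cm) with hK
  have hK0 : 0 ≤ K := by positivity
  set D : ℝ := 1 + δ ^ (-Γ) with hD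
  have hD1 : 1 ≤ D := by have : 0 ≤ δ ^ (-Γ) := by positivity
                         linarith
  set E : ℝ := (1 + h / δ) ^ Γ with hE
  have hhδ : 0 ≤ h / δ := by positivity
  have hE1 : 1 ≤ E := Real.one_le_rpow (by linarith) (by linarith)
  set w : EuclideanSpace ℝ (Fin N) → ℝ := fun x => max (v x - h) 0 with hw
  set t : EuclideanSpace ℝ (Fin N) → ℝ := fun x => max (v x - (h + δ)) 0 with ht
  set G : EuclideanSpace ℝ (Fin N) → ℝ := fun x => softPos δ (v x - (h + δ)) with hG
  have hw0 : ∀ x, 0 ≤ w x := fun x => le_max_right _ _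
  have ht0 : ∀ x, 0 ≤ t x := fun x => le_max_right _ _
  have hG0 : ∀ x, 0 ≤ G x := fun x => softPos_nonneg _ _
  have hGt : ∀ x, G x ≤ t x := fun x => softPos_le hδ _
  have htw : ∀ x, t x ≤ w x := fun x => max_le_max (by linarith) le_rfl
  have hlev : ∀ x, 0 < t x → δ ≤ w x := fun x hx => by
    have h1 : 0 < v x - (h + δ) := by
      by_contra! h2
      exact hx.ne' (max_eq_right h2)
    exact le_trans (by linarith) (le_max_left (v x - h) 0)
  have hwc : Continuous w := (hvc.sub continuous_const).max continuous_const
  have htc : Continuous t := (hvc.sub continuous_const).max continuous_const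
  have hGc : Continuous G := continuous_softPos_sub hδ hvd
  have hwγ : Continuous fun x => w x ^ γ x :=
    hwc.rpow hγ fun x => Or.inr (by linarith [hγ1 x])
  set Y : ℝ := ∫ x in Metric.closedBall y R, w x ^ γ x with hY
  have hY0 : 0 ≤ Y := integral_nonneg fun x => Real.rpow_nonneg (hw0 x) _
  set e : EuclideanSpace ℝ (Fin N) → ℝ := fun x =>
    ballCutoff y R N x * softPosDeriv δ (v x - (h + δ)) * ‖gradient v x‖ ^ p x with he
  have hec : Continuous e := continuous_energy hN1 hδ hp hp1 hvd
  have hen : ∫ x in Metric.closedBall y R, e x ≤ K * (3 * E * D) * Y := by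
    refine (hv.caccioppoli hvd hN hp hq hac hγ hp1 hpq hqN hγ1 ha haΛ hCm hδ
      (by linarith : 0 ≤ h + δ) hR0 hR1 y).trans ?_
    rw [hY, ← integral_const_mul]
    refine setIntegral_closedBall_mono ?_ (continuous_const.mul hwγ) fun x _ => ?_
    · exact continuous_const.mul (((htc.rpow hp fun x => Or.inr (by linarith [hp1 x])).add
        (htc.rpow hq fun x => Or.inr (by linarith [hp1 x, hpq x]))).add
        ((hvc.abs.rpow (hγ.sub continuous_const) fun x => Or.inr (sub_pos.mpr (hγ1 x))).mul htc))
    · change K * (t x ^ p x + t x ^ q x + |v x| ^ (γ x - 1) * t x) ≤ K * (3 * E * D) * w x ^ γ x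
      rw [mul_assoc K]
      refine mul_le_mul_of_nonneg_left ?_ hK0
      have hwp : 0 ≤ w x ^ γ x := Real.rpow_nonneg (hw0 x) _
      have hDw : D * w x ^ γ x ≤ E * D * w x ^ γ x := by
        rw [mul_assoc]; exact le_mul_of_one_le_left (by positivity) hE1
      have e1 : t x ^ p x ≤ D * w x ^ γ x :=
        rpow_le_mul_of_level hδ (ht0 x) (htw x) (hlev x) (by linarith [hp1 x])
          ((hpq x).trans (hqγ x)) (hγΓ x)
      have e2 : t x ^ q x ≤ D * w x ^ γ x :=
        rpow_le_mul_of_level hδ (ht0 x) (htw x) (hlev x) (by linarith [hp1 x, hpq x])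
          (hqγ x) (hγΓ x)
      have e3 : |v x| ^ (γ x - 1) * t x ≤ E * D * w x ^ γ x := by
        rcases (ht0 x).eq_or_lt with h0 | hpos
        · rw [← h0, mul_zero]; positivity
        · have hwδ := hlev x hpos
          have hwx : w x = v x - h := by
            rcases max_choice (v x - h) 0 with h1 | h1
            · exact h1
            · simp only [hw] at hwδ ⊢; rw [h1] at hwδ; linarith
          have hv0 : |v x| ≤ (1 + h / δ) * w x := by
            rw [abs_of_nonneg (by linarith)]
            have h1 : h ≤ h / δ * w x := by
              rw [div_mul_eq_mul_div, le_div_iff₀ hδ]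
              exact mul_le_mul_of_nonneg_left hwδ hh
            linarith
          have h1 : |v x| ^ (γ x - 1) ≤ E * w x ^ (γ x - 1) := by
            refine (Real.rpow_le_rpow (abs_nonneg _) hv0 (by linarith [hγ1 x])).trans ?_
            rw [Real.mul_rpow (by linarith) (hw0 x)]
            exact mul_le_mul_of_nonneg_right (Real.rpow_le_rpow_of_exponent_le (by linarith)
              (by linarith [hγΓ x])) (Real.rpow_nonneg (hw0 x) _)
          calc |v x| ^ (γ x - 1) * t x ≤ E * w x ^ (γ x - 1) * w x :=
                mul_le_mul h1 (htw x) (ht0 x)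
                  (mul_nonneg (by linarith) (Real.rpow_nonneg (hw0 x) _))
            _ = E * 1 * w x ^ γ x := by
                rw [mul_assoc, rpow_sub_one_mul_self (hw0 x) (hγ1 x), mul_one]
            _ ≤ E * D * w x ^ γ x := by gcongr
      linarith
  have hGβ : Continuous fun x => G x ^ β := hGc.rpow_const fun x => Or.inr (by linarith)
  have hGp : Continuous fun x => G x ^ ((β - 1) * (p x / (p x - 1))) :=
    hGc.rpow (continuous_const.mul (hp.div (hp.sub continuous_const)
      fun x => by linarith [hp1 x])) fun x => Or.inr
      (mul_pos (by linarith) (div_pos (by linarith [hp1 x]) (by linarith [hp1 x])))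
  have hsob := setIntegral_softPos_rpow_le hC hN hp hp1 hvd hβ hδ hR' hRR hR1 y (ℓ := h + δ)
  have hrhs : β * ∫ x in Metric.closedBall y R,
      (G x ^ ((β - 1) * (p x / (p x - 1))) + e x + 2 * N * G x ^ β) ≤
      Γ * (E * D * (1 + 2 * N + 3 * K)) * Y := by
    have h1 : ∫ x in Metric.closedBall y R,
        (G x ^ ((β - 1) * (p x / (p x - 1))) + e x + 2 * N * G x ^ β) ≤
        ∫ x in Metric.closedBall y R, (e x + (1 + 2 * N) * D * w x ^ γ x) := by
      refine setIntegral_closedBall_mono ((hGp.add hec).add (continuous_const.mul hGβ))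
        (hec.add (continuous_const.mul hwγ)) fun x hx => ?_
      have hx' := Metric.closedBall_subset_closedBall hRρ hx
      have hl : 0 < G x → δ ≤ w x := fun h => hlev x (h.trans_le (hGt x))
      have e1 := rpow_le_mul_of_level hδ (hG0 x) ((hGt x).trans (htw x)) hl
        (mul_pos (by linarith) (div_pos (by linarith [hp1 x]) (by linarith [hp1 x])))
          (hβp x hx') (hγΓ x)
      have e2 := rpow_le_mul_of_level hδ (hG0 x) ((hGt x).trans (htw x)) hl
        (by linarith) (hβγ x hx') (hγΓ x)
      have e3 := mul_le_mul_of_nonneg_left e2 (by positivity : (0 : ℝ) ≤ 2 * N)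
      rw [← hD] at e1 e3
      change G x ^ ((β - 1) * (p x / (p x - 1))) + e x + 2 * N * G x ^ β ≤
        e x + (1 + 2 * N) * D * w x ^ γ x
      linarith
    have h2 : ∫ x in Metric.closedBall y R, (e x + (1 + 2 * N) * D * w x ^ γ x) =
        (∫ x in Metric.closedBall y R, e x) + (1 + 2 * N) * D * Y := by
      have hc : Continuous fun x => (1 + 2 * N) * D * w x ^ γ x := continuous_const.mul hwγ
      rw [integral_add (hec.integrableOn_closedBall' y R) (hc.integrableOn_closedBall' y R),
        integral_const_mul]
    have h3 : (1 + 2 * N) * D * Y ≤ (1 + 2 * N) * (E * D) * Y := by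
      have : D ≤ E * D := le_mul_of_one_le_left (by linarith) hE1
      gcongr
    have h4 : 0 ≤ E * D * (1 + 2 * N + 3 * K) * Y := by positivity
    calc _ ≤ β * (E * D * (1 + 2 * N + 3 * K) * Y) := by
          refine mul_le_mul_of_nonneg_left ?_ (by linarith)
          linarith
      _ ≤ Γ * (E * D * (1 + 2 * N + 3 * K) * Y) := mul_le_mul_of_nonneg_right hβΓ' h4
      _ = _ := by ring
  have hI0 : ∀ x, 0 ≤ G x ^ (β * κ) := fun x => Real.rpow_nonneg (hG0 x) _
  have hGβκ : Continuous fun x => G x ^ (β * κ) :=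
    hGc.rpow_const fun x => Or.inr (by positivity)
  have hYI : ∫ x in Metric.closedBall y R', max (v x - (h + 3 * δ)) 0 ^ γ x ≤
      (δ ^ (-d) + δ ^ (-Γ)) * ∫ x in Metric.closedBall y R', G x ^ (β * κ) := by
    rw [← integral_const_mul]
    refine setIntegral_closedBall_mono (((hvc.sub continuous_const).max continuous_const).rpow hγ
      fun x => Or.inr (by linarith [hγ1 x])) (continuous_const.mul hGβκ) fun x hx => ?_
    have hx' := Metric.closedBall_subset_closedBall (hRR.trans hRρ) hx
    change max (v x - (h + 3 * δ)) 0 ^ γ x ≤ (δ ^ (-d) + δ ^ (-Γ)) * G x ^ (β * κ)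
    rcases le_or_gt (v x) (h + 3 * δ) with hle | hlt
    · rw [max_eq_right (by linarith), Real.zero_rpow (by linarith [hγ1 x])]
      have := hI0 x
      positivity
    · rw [max_eq_left (by linarith)]
      have hGx : v x - (h + 2 * δ) ≤ G x := by
        have := sub_le_softPos δ (v x - (h + δ))
        simp only [hG]; linarith
      have hGδ : δ ≤ G x := by linarith
      have hGpos : 0 < G x := by linarith
      calc (v x - (h + 3 * δ)) ^ γ x ≤ G x ^ γ x :=
            Real.rpow_le_rpow (by linarith) (by linarith) (by linarith [hγ1 x])
        _ = G x ^ (-(β * κ - γ x)) * G x ^ (β * κ) := by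
            rw [← Real.rpow_add hGpos]; ring_nf
        _ ≤ δ ^ (-(β * κ - γ x)) * G x ^ (β * κ) := by
            refine mul_le_mul_of_nonneg_right ?_ (hI0 x)
            exact Real.rpow_le_rpow_of_nonpos hδ hGδ (by linarith [hγβ x hx'])
        _ ≤ _ := mul_le_mul_of_nonneg_right
            (rpow_neg_le_add hδ (by linarith [hγβ x hx']) (by linarith [hγ1 x])) (hI0 x)
  have hr0 : 0 ≤ R ^ 2 - R' ^ 2 := by nlinarith
  have hr1 : R ^ 2 - R' ^ 2 ≤ 1 := by nlinarith
  have hpow : (R ^ 2 - R' ^ 2) ^ (N * Γ) ≤ (R ^ 2 - R' ^ 2) ^ (N * (β * κ)) := by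
    refine Real.rpow_le_rpow_of_exponent_ge_of_imp hr0 hr1
      (mul_le_mul_of_nonneg_left hβΓ (by positivity)) fun h0 h1 => ?_
    have : 0 < N * Γ := by positivity
    exact absurd h1 this.ne'
  set I := ∫ x in Metric.closedBall y R', G x ^ (β * κ) with hI
  have hI0' : 0 ≤ I := integral_nonneg hI0
  have hδ2 : 0 ≤ δ ^ (-d) + δ ^ (-Γ) := by positivity
  have hC0 := hC.1
  calc _ ≤ (R ^ 2 - R' ^ 2) ^ (N * (β * κ)) * ((δ ^ (-d) + δ ^ (-Γ)) * I) :=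
        mul_le_mul hpow hYI (integral_nonneg fun x => Real.rpow_nonneg (le_max_right _ _) _)
          (Real.rpow_nonneg hr0 _)
    _ = (δ ^ (-d) + δ ^ (-Γ)) * ((R ^ 2 - R' ^ 2) ^ (N * (β * κ)) * I) := by ring
    _ ≤ _ := by
        refine mul_le_mul_of_nonneg_left (hsob.trans (mul_le_mul_of_nonneg_left
          (Real.rpow_le_rpow ?_ hrhs hκ0.le) hC0.le)) hδ2
        refine mul_nonneg (by linarith) (integral_nonneg fun x => ?_)
        have h1 : 0 ≤ e x := mul_nonneg (mul_nonneg (ballCutoff_nonneg _ _ _ _)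
          (softPosDeriv_nonneg _ _)) (Real.rpow_nonneg (norm_nonneg _) _)
        have h2 : 0 ≤ G x ^ β := Real.rpow_nonneg (hG0 x) _
        have h3 : 0 ≤ G x ^ ((β - 1) * (p x / (p x - 1))) := Real.rpow_nonneg (hG0 x) _
        show 0 ≤ G x ^ ((β - 1) * (p x / (p x - 1))) + e x + 2 * N * G x ^ β
        positivity

end Iteration

/-- Fast geometric convergence. -/
theorem tendsto_zero_of_le_mul_rpow {Y : ℕ → ℝ} {A b α : ℝ} (hY : ∀ n, 0 ≤ Y n) (hA : 0 ≤ A)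
    (hb : 1 < b) (hα : 0 < α) (hstep : ∀ n, Y (n + 1) ≤ A * b ^ n * Y n ^ (1 + α))
    (h0 : A * b ^ (1 / α) * Y 0 ^ α ≤ 1) : Tendsto Y atTop (nhds 0) := by
  have hb0 : 0 < b := by linarith
  set r : ℝ := b ^ (-(1 / α)) with hr
  have hr0 : 0 < r := Real.rpow_pos_of_pos hb0 _
  have hr1 : r < 1 := Real.rpow_lt_one_of_one_lt_of_neg hb (by simp [hα])
  have hrα : r ^ α = b⁻¹ := by
    rw [hr, ← Real.rpow_mul hb0.le, neg_mul, one_div_mul_cancel hα.ne', Real.rpow_neg_one]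
  have h0' : A * Y 0 ^ α ≤ r := by
    rw [hr, Real.rpow_neg hb0.le, ← one_div, le_div_iff₀ (Real.rpow_pos_of_pos hb0 _)]
    linarith
  have key : ∀ n, Y n ≤ Y 0 * r ^ n := fun n => by
    induction n with
    | zero => simp
    | succ n ih =>
      have hrn : 0 ≤ r ^ n := pow_nonneg hr0.le n
      have e1 : (Y 0 * r ^ n) ^ (1 + α) = Y 0 ^ α * b⁻¹ ^ n * (Y 0 * r ^ n) := by
        rw [add_comm, Real.rpow_add_one' (mul_nonneg (hY 0) hrn) (by linarith),
          Real.mul_rpow (hY 0) hrn, ← Real.rpow_natCast r n, ← Real.rpow_mul hr0.le,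
          mul_comm (n : ℝ) α, Real.rpow_mul hr0.le, hrα, Real.rpow_natCast, Real.rpow_natCast]
      calc Y (n + 1) ≤ A * b ^ n * Y n ^ (1 + α) := hstep n
        _ ≤ A * b ^ n * (Y 0 * r ^ n) ^ (1 + α) := by
            have := Real.rpow_le_rpow (hY n) ih (by linarith : 0 ≤ 1 + α)
            gcongr
        _ = A * Y 0 ^ α * (Y 0 * r ^ n) := by
            rw [e1, inv_pow]
            field_simp
        _ ≤ r * (Y 0 * r ^ n) := mul_le_mul_of_nonneg_right h0' (mul_nonneg (hY 0) hrn)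
        _ = Y 0 * r ^ (n + 1) := by ring
  have hlim : Tendsto (fun n => Y 0 * r ^ n) atTop (nhds 0) := by
    simpa using (tendsto_pow_atTop_nhds_zero_of_lt_one hr0.le hr1).const_mul (Y 0)
  exact squeeze_zero hY key hlim

section LocalBound

variable {N : ℕ}

/-- The standing assumptions on the exponents and the weight. -/
structure Admissible (p q a γ : EuclideanSpace ℝ (Fin N) → ℝ) (Λ Γ : ℝ) : Prop where
  two_le : 2 ≤ N
  cont_p : Continuous p
  cont_q : Continuous q
  cont_a : Continuous a
  cont_γ : Continuous γ
  one_lt_p : ∀ x, 1 < p x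
  p_le_q : ∀ x, p x ≤ q x
  q_le_N : ∀ x, q x ≤ N
  q_le_γ : ∀ x, q x ≤ γ x
  γ_le : ∀ x, γ x ≤ Γ
  a_nonneg : ∀ x, 0 ≤ a x
  a_le : ∀ x, a x ≤ Λ

/-- `β` is an admissible exponent for the De Giorgi iteration in the ball of radius `ρ` centered
at `y`. -/
structure IsIterationExponent (p γ : EuclideanSpace ℝ (Fin N) → ℝ) (Γ d ρ β : ℝ)
    (y : EuclideanSpace ℝ (Fin N)) : Prop where
  one_lt : 1 < β
  mul_le : β * ((N : ℝ) / (N - 1)) ≤ Γ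
  le_γ : ∀ x ∈ Metric.closedBall y ρ, β ≤ γ x
  mul_conj_le : ∀ x ∈ Metric.closedBall y ρ, (β - 1) * (p x / (p x - 1)) ≤ γ x
  add_le : ∀ x ∈ Metric.closedBall y ρ, γ x + d ≤ β * ((N : ℝ) / (N - 1))

theorem le_of_setIntegral_eq_zero {f : EuclideanSpace ℝ (Fin N) → ℝ} (hf : Continuous f)
    (hf0 : ∀ x, 0 ≤ f x) {y : EuclideanSpace ℝ (Fin N)} {R : ℝ} (hR : 0 < R)
    (h : ∫ x in Metric.closedBall y R, f x = 0) : f y = 0 := by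
  by_contra hne
  have hpos : 0 < ∫ x in Metric.closedBall y R, f x := by
    rw [setIntegral_pos_iff_support_of_nonneg_ae (Eventually.of_forall hf0)
      (hf.integrableOn_closedBall' y R)]
    have hopen : IsOpen (Function.support f ∩ Metric.ball y R) :=
      hf.isOpen_support.inter Metric.isOpen_ball
    exact (hopen.measure_pos volume ⟨y, hne, Metric.mem_ball_self hR⟩).trans_le
      (measure_mono (Set.inter_subset_inter_right _ Metric.ball_subset_closedBall))
  exact hpos.ne' h

/-- The iteration, with the constants collected. -/
theorem level_constants {δ k C Γ M d κ NΓ s ρ R R' Y Y' : ℝ} {n : ℕ} (hk : 0 < k) (hC : 0 ≤ C)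
    (hΓ : 0 ≤ Γ) (hM : 0 ≤ M) (hκ : 0 ≤ κ) (hNΓ : 0 ≤ NΓ) (hρ : 0 < ρ) (hd0 : 0 ≤ d) (hd : d ≤ Γ)
    (hs : s = 2 ^ n)
    (hδ : δ = k / 6 / s) (hR : R = ρ / 2 * (1 + s⁻¹)) (hR' : R' = ρ / 2 * (1 + s⁻¹ / 2))
    (hY : 0 ≤ Y) (hY' : 0 ≤ Y')
    (h : (R ^ 2 - R' ^ 2) ^ NΓ * Y' ≤ (δ ^ (-d) + δ ^ (-Γ)) * (C * (Γ * ((1 + k * (1 - s⁻¹) / δ) ^ Γ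
      * (1 + δ ^ (-Γ)) * M) * Y) ^ κ)) :
    Y' ≤ ((ρ ^ 2 / 4) ^ (-NΓ) * (C * (Γ * (6 ^ Γ * M)) ^ κ) *
      (((k / 6) ^ (-d) + (k / 6) ^ (-Γ)) * (1 + (k / 6) ^ (-Γ)) ^ κ)) *
      (2 ^ (NΓ + Γ + 2 * Γ * κ)) ^ n * Y ^ κ := by
  set m := k / 6 with hm
  have hm0 : 0 < m := by positivity
  have hs0 : 0 < s := by rw [hs]; positivity
  have hs1 : 1 ≤ s := by rw [hs]; exact one_le_pow₀ (by norm_num)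
  have hpow : ∀ e : ℝ, 0 ≤ e → δ ^ (-e) = m ^ (-e) * s ^ e := fun e _ => by
    rw [hδ, Real.div_rpow hm0.le hs0.le, Real.rpow_neg hs0.le, div_inv_eq_mul]
  have hsΓ : 1 ≤ s ^ Γ := Real.one_le_rpow hs1 hΓ
  have hD1 : δ ^ (-d) + δ ^ (-Γ) ≤ (m ^ (-d) + m ^ (-Γ)) * s ^ Γ := by
    rw [hpow d hd0, hpow Γ hΓ, add_mul]
    have := Real.rpow_le_rpow_of_exponent_le hs1 hd
    gcongr
  have hD2 : 1 + δ ^ (-Γ) ≤ (1 + m ^ (-Γ)) * s ^ Γ := by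
    rw [hpow Γ hΓ, add_mul]
    linarith
  have hE : (1 + k * (1 - s⁻¹) / δ) ^ Γ ≤ 6 ^ Γ * s ^ Γ := by
    have e1 : 1 + k * (1 - s⁻¹) / δ = 6 * s - 5 := by
      rw [hδ, hm]; field_simp; ring
    rw [e1, ← Real.mul_rpow (by norm_num) hs0.le]
    exact Real.rpow_le_rpow (by linarith) (by linarith) hΓ
  have hE0 : 0 ≤ (1 + k * (1 - s⁻¹) / δ) ^ Γ := by
    have : s⁻¹ ≤ 1 := inv_le_one_of_one_le₀ hs1
    have h2 : 0 ≤ k * (1 - s⁻¹) / δ := by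
      rw [hδ]; exact div_nonneg (mul_nonneg hk.le (by linarith)) (by positivity)
    positivity
  have hδ0 : 0 < δ := by rw [hδ]; positivity
  have hrad : (ρ ^ 2 / 4) ^ NΓ * (s ^ NΓ)⁻¹ ≤ (R ^ 2 - R' ^ 2) ^ NΓ := by
    rw [← Real.inv_rpow hs0.le, ← Real.mul_rpow (by positivity) (by positivity)]
    refine Real.rpow_le_rpow (by positivity) ?_ hNΓ
    rw [hR, hR']
    have h1 : 0 ≤ ρ ^ 2 * s⁻¹ ^ 2 := by positivity
    nlinarith
  have hmain : (ρ ^ 2 / 4) ^ NΓ * (s ^ NΓ)⁻¹ * Y' ≤ ((m ^ (-d) + m ^ (-Γ)) * s ^ Γ) *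
      (C * (Γ * ((6 ^ Γ * s ^ Γ) * ((1 + m ^ (-Γ)) * s ^ Γ) * M) * Y) ^ κ) := by
    refine (mul_le_mul_of_nonneg_right hrad hY').trans (h.trans ?_)
    gcongr
  have e2 : (Γ * ((6 ^ Γ * s ^ Γ) * ((1 + m ^ (-Γ)) * s ^ Γ) * M) * Y) ^ κ =
      (Γ * (6 ^ Γ * M)) ^ κ * (1 + m ^ (-Γ)) ^ κ * s ^ (2 * Γ * κ) * Y ^ κ := by
    have e3 : Γ * ((6 ^ Γ * s ^ Γ) * ((1 + m ^ (-Γ)) * s ^ Γ) * M) * Y =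
        (Γ * (6 ^ Γ * M)) * (1 + m ^ (-Γ)) * s ^ (2 * Γ) * Y := by
      rw [two_mul, Real.rpow_add hs0]; ring
    rw [e3, Real.mul_rpow (by positivity) hY, Real.mul_rpow (by positivity) (by positivity),
      Real.mul_rpow (by positivity) (by positivity), ← Real.rpow_mul hs0.le]
  have e4 : (2 ^ (NΓ + Γ + 2 * Γ * κ) : ℝ) ^ n = s ^ NΓ * s ^ Γ * s ^ (2 * Γ * κ) := by
    rw [← Real.rpow_natCast, ← Real.rpow_mul (by norm_num), mul_comm, Real.rpow_mul (by norm_num),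
      Real.rpow_natCast, ← hs, Real.rpow_add hs0, Real.rpow_add hs0]
  rw [e2] at hmain
  have hρp : 0 < (ρ ^ 2 / 4) ^ NΓ := by positivity
  have hsp : 0 < s ^ NΓ := by positivity
  rw [e4, Real.rpow_neg (by positivity)]
  rw [mul_assoc, ← le_div_iff₀' hρp, inv_mul_le_iff₀ hsp] at hmain
  refine hmain.trans (le_of_eq ?_)
  field_simp

end LocalBound

section SupBound

variable {N : ℕ}

theorem rpow_neg_add_mul_le {m d Γ κ : ℝ} (hm : 0 < m) (hd : 0 ≤ d) (hdΓ : d ≤ Γ) (hκ0 : 0 ≤ κ)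
    (hκ : κ ≤ 2) : (m ^ (-d) + m ^ (-Γ)) * (1 + m ^ (-Γ)) ^ κ ≤
      2 * 2 ^ κ * max (m ^ (-d)) (m ^ (-(3 * Γ))) := by
  rcases le_total 1 m with h | h
  · have h1 : m ^ (-Γ) ≤ m ^ (-d) := Real.rpow_le_rpow_of_exponent_le h (neg_le_neg hdΓ)
    have h2 : m ^ (-Γ) ≤ 1 := Real.rpow_le_one_of_one_le_of_nonpos h (by linarith)
    calc _ ≤ (2 * m ^ (-d)) * 2 ^ κ := by
          have : 0 ≤ m ^ (-Γ) := by positivity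
          gcongr <;> linarith
      _ = 2 * 2 ^ κ * m ^ (-d) := by ring
      _ ≤ _ := by gcongr; exact le_max_left _ _
  · have h1 : m ^ (-d) ≤ m ^ (-Γ) := Real.rpow_le_rpow_of_exponent_ge hm h (neg_le_neg hdΓ)
    have h2 : 1 ≤ m ^ (-Γ) := Real.one_le_rpow_of_pos_of_le_one_of_nonpos hm h (by linarith)
    calc _ ≤ (2 * m ^ (-Γ)) * (2 * m ^ (-Γ)) ^ κ := by
          gcongr <;> linarith
      _ = 2 * 2 ^ κ * m ^ (-Γ + -Γ * κ) := by
          rw [Real.mul_rpow (by norm_num) (by positivity), ← Real.rpow_mul hm.le,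
            Real.rpow_add hm]
          ring
      _ ≤ 2 * 2 ^ κ * m ^ (-(3 * Γ)) := by
          have : m ^ (-Γ + -Γ * κ) ≤ m ^ (-(3 * Γ)) :=
            Real.rpow_le_rpow_of_exponent_ge hm h (by nlinarith)
          gcongr
      _ ≤ _ := by gcongr; exact le_max_right _ _

/-- The local boundedness estimate, with constants that depend only on the data. -/
theorem exists_local_sup_bound {C Λ Γ Cm d ρ : ℝ} (hC : IsSobolevConst N C) (hN : 2 ≤ N)
    (hCm : 0 ≤ Cm) (hΛ : 0 ≤ Λ) (hΓ : 1 < Γ) (hd : 0 < d) (hdΓ : d ≤ Γ) (hρ0 : 0 < ρ)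
    (hρ : ρ ≤ 1) :
    ∃ K > 0, ∀ (p q a γ v : EuclideanSpace ℝ (Fin N) → ℝ) (y : EuclideanSpace ℝ (Fin N)) (β : ℝ),
      Admissible p q a γ Λ Γ → IsIterationExponent p γ Γ d ρ β y →
      IsSubsolution p q a γ Cm v → ContDiff ℝ 1 v → ∀ Z > 0,
      ∫ x in Metric.closedBall y ρ, max (v x) 0 ^ γ x ≤ Z →
      v y ≤ K * max (Z ^ (1 / (((N : ℝ) - 1) * d))) (Z ^ (1 / (((N : ℝ) - 1) * (3 * Γ)))) := by
  have hN1 : (1 : ℝ) < N := by exact_mod_cast hN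
  have hN2 : (2 : ℝ) ≤ N := by exact_mod_cast hN
  set κ : ℝ := (N : ℝ) / (N - 1) with hκ
  set α : ℝ := 1 / ((N : ℝ) - 1) with hα
  have hα0 : 0 < α := one_div_pos.mpr (by linarith)
  have hκα : κ = 1 + α := by
    have : (N : ℝ) - 1 ≠ 0 := by linarith
    rw [hκ, hα]; field_simp; ring
  have hκ2 : κ ≤ 2 := by rw [hκ, div_le_iff₀ (by linarith)]; linarith
  set M : ℝ := 1 + 2 * N + 3 * (2 * ((4 * N) ^ (N : ℝ) * (1 + Λ) + Cm)) with hM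
  have hM0 : 0 < M := by positivity
  have hC0 := hC.1
  have hΓ0 : 0 < Γ := by linarith
  set A₀ : ℝ := (ρ ^ 2 / 4) ^ (-(N * Γ)) * (C * (Γ * (6 ^ Γ * M)) ^ κ) with hA₀
  have hA₀0 : 0 < A₀ := by positivity
  set b : ℝ := 2 ^ (N * Γ + Γ + 2 * Γ * κ) with hb
  have hκ0 : 0 < κ := by linarith
  have hb1 : 1 < b := Real.one_lt_rpow (by norm_num) (by positivity)
  have hb0 : 0 < b := by linarith
  set B : ℝ := A₀ * (2 * 2 ^ κ) * b ^ (1 / α) with hB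
  have hB0 : 0 < B := by positivity
  refine ⟨6 * max (B ^ (1 / d)) (B ^ (1 / (3 * Γ))), by positivity, ?_⟩
  intro p q a γ v y β hadm hit hv hvd Z hZ hZint
  set X : ℝ := B * Z ^ α with hX
  have hX0 : 0 < X := by positivity
  set m : ℝ := max (X ^ (1 / d)) (X ^ (1 / (3 * Γ))) with hm
  have hm0 : 0 < m := by positivity
  set k : ℝ := 6 * m with hk
  have hk0 : 0 < k := by positivity
  have hkm : k / 6 = m := by rw [hk]; ring
  have hγ1 : ∀ x, 1 < γ x := fun x =>
    (hadm.one_lt_p x).trans_le ((hadm.p_le_q x).trans (hadm.q_le_γ x))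
  have hvc := hvd.continuous
  have hcont : ∀ h : ℝ, Continuous fun x => max (v x - h) 0 ^ γ x := fun h =>
    ((hvc.sub continuous_const).max continuous_const).rpow hadm.cont_γ
      fun x => Or.inr (by linarith [hγ1 x])
  have hnn : ∀ h x, 0 ≤ max (v x - h) 0 ^ γ x := fun h x =>
    Real.rpow_nonneg (le_max_right _ _) _
  set Y : ℕ → ℝ := fun n => ∫ x in Metric.closedBall y (ρ / 2 * (1 + (2 ^ n)⁻¹)),
    max (v x - k * (1 - (2 ^ n)⁻¹)) 0 ^ γ x with hY
  have hY0 : ∀ n, 0 ≤ Y n := fun n => integral_nonneg (hnn _)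
  have hstep : ∀ n, Y (n + 1) ≤ (A₀ * (((k / 6) ^ (-d) + (k / 6) ^ (-Γ)) *
      (1 + (k / 6) ^ (-Γ)) ^ κ)) * b ^ n * Y n ^ (1 + α) := fun n => by
    rw [← hκα]
    have hs1 : (1 : ℝ) ≤ 2 ^ n := one_le_pow₀ (by norm_num)
    have hsi : ((2 : ℝ) ^ n)⁻¹ ≤ 1 := inv_le_one_of_one_le₀ hs1
    have hs0 : 0 < ((2 : ℝ) ^ n)⁻¹ := by positivity
    have e1 : ((2 : ℝ) ^ (n + 1))⁻¹ = (2 ^ n)⁻¹ / 2 := by rw [pow_succ]; field_simp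
    refine level_constants (δ := k / 6 / 2 ^ n) hk0 hC0.le hΓ0.le hM0.le hκ0.le (by positivity) hρ0
      hd.le hdΓ rfl rfl rfl (by rw [← e1]) (hY0 n) (hY0 (n + 1)) ?_
    have e2 : k * (1 - ((2 : ℝ) ^ (n + 1))⁻¹) =
        k * (1 - (2 ^ n)⁻¹) + 3 * (k / 6 / 2 ^ n) := by rw [e1]; ring
    simp only [hY]
    rw [e2, e1]
    exact hv.level_step hvd hC hN hadm.cont_p hadm.cont_q hadm.cont_a hadm.cont_γ hadm.one_lt_p
      hadm.p_le_q hadm.q_le_N hadm.q_le_γ hadm.a_nonneg hadm.a_le hCm hit.one_lt hd.le hadm.γ_le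
      hit.mul_le hρ y hit.le_γ hit.mul_conj_le hit.add_le
      (mul_nonneg hk0.le (by linarith)) (by positivity) (by positivity)
      (mul_le_mul_of_nonneg_left (by linarith) (by linarith))
      (by nlinarith [mul_nonneg hρ0.le (sub_nonneg.mpr hsi)])
  have hYZ : Y 0 ≤ Z := by
    refine le_trans (le_of_eq ?_) hZint
    simp only [hY, pow_zero, inv_one, sub_self, mul_zero, sub_zero]
    congr 3; ring
  have hsmall : (A₀ * (((k / 6) ^ (-d) + (k / 6) ^ (-Γ)) * (1 + (k / 6) ^ (-Γ)) ^ κ)) *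
      b ^ (1 / α) * Y 0 ^ α ≤ 1 := by
    have h1 : ∀ e : ℝ, 0 < e → X ^ (1 / e) ≤ m → X * m ^ (-e) ≤ 1 := fun e he hle => by
      rw [Real.rpow_neg hm0.le, ← div_eq_mul_inv, div_le_one (by positivity)]
      calc X = (X ^ (1 / e)) ^ e := by
            rw [← Real.rpow_mul hX0.le, one_div_mul_cancel he.ne', Real.rpow_one]
        _ ≤ m ^ e := Real.rpow_le_rpow (by positivity) hle he.le
    have h2 : X * max (m ^ (-d)) (m ^ (-(3 * Γ))) ≤ 1 := by
      rw [mul_max_of_nonneg _ _ hX0.le]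
      exact max_le (h1 d hd (le_max_left _ _)) (h1 (3 * Γ) (by positivity) (le_max_right _ _))
    have h3 := rpow_neg_add_mul_le hm0 hd.le hdΓ hκ0.le hκ2
    have h4 : Y 0 ^ α ≤ Z ^ α := Real.rpow_le_rpow (hY0 0) hYZ hα0.le
    rw [hkm]
    calc _ ≤ (A₀ * (2 * 2 ^ κ * max (m ^ (-d)) (m ^ (-(3 * Γ))))) * b ^ (1 / α) * Z ^ α := by
          have := hY0 0
          gcongr
      _ = X * max (m ^ (-d)) (m ^ (-(3 * Γ))) := by rw [hX, hB]; ring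
      _ ≤ 1 := h2
  have hlim := tendsto_zero_of_le_mul_rpow hY0 (by positivity) hb1 hα0 hstep hsmall
  have hzero : ∫ x in Metric.closedBall y (ρ / 2), max (v x - k) 0 ^ γ x = 0 := by
    refine le_antisymm (ge_of_tendsto' hlim fun n => ?_) (integral_nonneg (hnn k))
    have hs0 : 0 < ((2 : ℝ) ^ n)⁻¹ := by positivity
    refine (setIntegral_closedBall_mono (hcont k) (hcont (k * (1 - (2 ^ n)⁻¹)))
      fun x _ => ?_).trans (setIntegral_mono_set ((hcont _).integrableOn_closedBall' y _)
        (Eventually.of_forall (hnn _)) (Metric.closedBall_subset_closedBall ?_).eventuallyLE)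
    · refine Real.rpow_le_rpow (le_max_right _ _) (max_le_max ?_ le_rfl) (by linarith [hγ1 x])
      linarith [mul_nonneg hk0.le hs0.le]
    · exact le_mul_of_one_le_right (by positivity) (by linarith)
  have hy := le_of_setIntegral_eq_zero (hcont k) (hnn k) (by positivity : 0 < ρ / 2) hzero
  have hvk : v y ≤ k := by
    by_contra! hlt
    rw [max_eq_left (by linarith)] at hy
    have : 0 < (v y - k) ^ γ y := Real.rpow_pos_of_pos (by linarith) _
    exact this.ne' hy
  refine hvk.trans ?_
  rw [hk, mul_assoc]
  refine mul_le_mul_of_nonneg_left ?_ (by norm_num)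
  have h1 : ∀ e : ℝ, 0 < e → X ^ (1 / e) = B ^ (1 / e) * Z ^ (1 / (((N : ℝ) - 1) * e)) :=
    fun e he => by
      rw [hX, Real.mul_rpow hB0.le (by positivity), ← Real.rpow_mul hZ.le, hα,
        one_div_mul_one_div]
  rw [hm, h1 d hd, h1 (3 * Γ) (by positivity)]
  exact max_le (mul_le_mul (le_max_left _ _) (le_max_left _ _) (by positivity) (by positivity))
    (mul_le_mul (le_max_right _ _) (le_max_right _ _) (by positivity) (by positivity))

end SupBound

section Exponents

variable {N : ℕ}

theorem IsIterationExponent.mono {p γ : EuclideanSpace ℝ (Fin N) → ℝ} {Γ d ρ ρ' β : ℝ}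
    {y : EuclideanSpace ℝ (Fin N)} (h : IsIterationExponent p γ Γ d ρ β y) (hρ : ρ' ≤ ρ) :
    IsIterationExponent p γ Γ d ρ' β y where
  one_lt := h.one_lt
  mul_le := h.mul_le
  le_γ x hx := h.le_γ x (Metric.closedBall_subset_closedBall hρ hx)
  mul_conj_le x hx := h.mul_conj_le x (Metric.closedBall_subset_closedBall hρ hx)
  add_le x hx := h.add_le x (Metric.closedBall_subset_closedBall hρ hx)

/-- The gain of integrability below the critical exponent. -/
theorem subcritical_gain {N p g c cN : ℝ} (hN : 1 < N) (hp1 : 1 < p) (hpN : p ≤ cN) (hcN : cN < N)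
    (hc : 0 < c) (hg : c ≤ N * p / (N - p) - g) :
    g + (N - cN) * c / N ^ 2 ≤ (1 + (g - g / p)) * (N / (N - 1)) := by
  have hNp : 0 < N - p := by linarith
  have hp0 : 0 < p := by linarith
  have hN1 : 0 < N - 1 := by linarith
  have e1 : (1 + (g - g / p)) * (N / (N - 1)) =
      g + (N - p) * (N * p / (N - p) - g) / (p * (N - 1)) := by
    field_simp
    ring
  rw [e1]
  gcongr g + ?_
  have h1 : p * (N - 1) ≤ N ^ 2 := by nlinarith
  calc (N - cN) * c / N ^ 2 ≤ (N - p) * (N * p / (N - p) - g) / N ^ 2 := by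
        have : N - cN ≤ N - p := by linarith
        gcongr
    _ ≤ _ := by
        have : 0 ≤ (N - p) * (N * p / (N - p) - g) := mul_nonneg hNp.le (by linarith)
        gcongr

theorem abs_sub_div_sub_le {g g' p p' B L : ℝ} (hp : 1 < p) (hp' : 1 < p') (hpB : p' ≤ B)
    (hg : 0 ≤ g') (hgL : g' ≤ L) :
    |(g - g / p) - (g' - g' / p')| ≤ (1 + B) * |g - g'| + L * |p - p'| := by
  have h1 : |g / p - g' / p'| ≤ B * |g - g'| + L * |p - p'| := by
    have e : g / p - g' / p' = ((g - g') * p' - g' * (p - p')) / (p * p') := by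
      field_simp
      ring
    rw [e, abs_div, abs_of_pos (by positivity : 0 < p * p')]
    refine (div_le_self (abs_nonneg _) (by nlinarith)).trans ((abs_sub _ _).trans ?_)
    rw [abs_mul, abs_mul, abs_of_nonneg hg, abs_of_pos (by linarith : 0 < p'), mul_comm]
    gcongr
  calc |(g - g / p) - (g' - g' / p')| = |(g - g') - (g / p - g' / p')| := by ring_nf
    _ ≤ |g - g'| + |g / p - g' / p'| := abs_sub _ _
    _ ≤ _ := by linarith

/-- Iteration exponents exist at every point, with uniform parameters. -/
theorem exists_isIterationExponent (hN : 2 ≤ N) {p : EuclideanSpace ℝ (Fin N) → ℝ}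
    {Kp : NNReal} (hp : LipschitzWith Kp p) {cp cN : ℝ} (hcp : 1 < cp) (hp1 : ∀ x, cp ≤ p x)
    (hcN : cN < N) (hpN : ∀ x, p x ≤ cN) (L : NNReal) {cg c : ℝ} (Γ₀ : ℝ) (hcg : 1 < cg)
    (hc : 0 < c) :
    ∃ Γ d ρ : ℝ, 1 < Γ ∧ Γ₀ ≤ Γ ∧ 0 < d ∧ d ≤ Γ ∧ 0 < ρ ∧ ρ ≤ 1 ∧
      ∀ g : EuclideanSpace ℝ (Fin N) → ℝ, LipschitzWith L g → (∀ x, cg ≤ g x) →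
      (∀ x, g x ≤ Γ₀) → (∀ x, c ≤ N * p x / (N - p x) - g x) →
      ∀ y, ∃ β, IsIterationExponent p g Γ d ρ β y := by
  have hN1 : (1 : ℝ) < N := by exact_mod_cast hN
  have hN2 : (2 : ℝ) ≤ N := by exact_mod_cast hN
  set κ : ℝ := (N : ℝ) / (N - 1) with hκ
  have hκ2 : κ ≤ 2 := by rw [hκ, div_le_iff₀ (by linarith)]; linarith
  have hκ1 : 1 + 1 / (N : ℝ) ≤ κ := by
    rw [hκ, le_div_iff₀ (by linarith)]
    field_simp
    nlinarith
  have hN0 : 0 < 1 / (N : ℝ) := by positivity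
  set c' : ℝ := min (((N : ℝ) - cN) * c / N ^ 2) (1 / N) with hc'
  have hc'0 : 0 < c' := lt_min (div_pos (mul_pos (by linarith) hc) (by positivity)) (by positivity)
  have hc'1 : c' ≤ 1 := (min_le_right _ _).trans (by rw [div_le_one (by linarith)]; linarith)
  set e₀ : ℝ := min ((cp - 1) / cp) (min (cg - 1) c') with he₀
  have he₀0 : 0 < e₀ := lt_min (div_pos (by linarith) (by linarith)) (lt_min (by linarith) hc'0)
  set ε : ℝ := e₀ / 6 with hε
  have hε0 : 0 < ε := by positivity
  have hε1 : 6 * ε ≤ (cp - 1) / cp := by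
    rw [hε]
    linarith [min_le_left ((cp - 1) / cp) (min (cg - 1) c')]
  have hε23 : 6 * ε ≤ min (cg - 1) c' := by
    rw [hε]; linarith [min_le_right ((cp - 1) / cp) (min (cg - 1) c')]
  have hε2 := hε23.trans (min_le_left _ _)
  have hε3 := hε23.trans (min_le_right _ _)
  set A : ℝ := (1 + N) * L + |Γ₀| * Kp + 1 with hA
  have hA1 : 1 ≤ A := by
    have : 0 ≤ (1 + (N : ℝ)) * L + |Γ₀| * Kp := by positivity
    linarith
  refine ⟨2 * |Γ₀| + 2, c' / 2, min 1 (ε / A), by linarith [abs_nonneg Γ₀],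
    ?_, by linarith, ?_, ?_, min_le_left _ _, ?_⟩
  · linarith [le_abs_self Γ₀, abs_nonneg Γ₀]
  · linarith [abs_nonneg Γ₀]
  · exact lt_min one_pos (by positivity)
  intro g hg hcgx hgΓ hgc y
  have hgy : 0 ≤ g y := by linarith [hcgx y]
  have hclose : ∀ x ∈ Metric.closedBall y (min 1 (ε / A)), |g x - g y| ≤ ε ∧
      |(g x - g x / p x) - (g y - g y / p y)| ≤ ε := fun x hx => by
    have hd : dist x y ≤ ε / A := (Metric.mem_closedBall.mp hx).trans (min_le_right _ _)
    have hd' : A * dist x y ≤ ε := by rwa [le_div_iff₀' (by linarith)] at hd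
    have h1 : |g x - g y| ≤ L * dist x y := hg.dist_le_mul x y
    have h2 : |p x - p y| ≤ Kp * dist x y := hp.dist_le_mul x y
    have h3 := abs_sub_div_sub_le (g := g x) (g' := g y) (hcp.trans_le (hp1 x))
      (hcp.trans_le (hp1 y)) ((hpN y).trans hcN.le) hgy ((hgΓ y).trans (le_abs_self _))
    have h4 : (1 + (N : ℝ)) * |g x - g y| + |Γ₀| * |p x - p y| ≤ ε := by
      calc _ ≤ (1 + (N : ℝ)) * (L * dist x y) + |Γ₀| * (Kp * dist x y) := by gcongr
        _ ≤ A * dist x y := by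
          have := dist_nonneg (x := x) (y := y)
          rw [hA]; linarith
        _ ≤ ε := hd'
    have h5 : 0 ≤ N * |g x - g y| := by positivity
    have h6 : 0 ≤ |Γ₀| * |p x - p y| := by positivity
    exact ⟨by linarith, h3.trans h4⟩
  have hpy := hcp.trans_le (hp1 y)
  have hθy : (cp - 1) / cp ≤ g y - g y / p y := by
    have e1 : g y - g y / p y = g y * (1 - 1 / p y) := by ring
    have e2 : (cp - 1) / cp = 1 - 1 / cp := by field_simp
    have h1 : 1 / p y ≤ 1 / cp := one_div_le_one_div_of_le (by linarith) (hp1 y)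
    have h2 : 0 ≤ (cp - 1) / cp := by linarith
    rw [e1, e2]
    rw [e2] at h2
    nlinarith [hcgx y]
  set μ : ℝ := min (g y - g y / p y) (g y - 1) with hμ
  have hμ1 : μ ≤ g y - g y / p y := min_le_left _ _
  have hμ2 : μ ≤ g y - 1 := min_le_right _ _
  have hμε : ε < μ := lt_min (by linarith) (by linarith [hcgx y])
  refine ⟨1 + μ - ε, by linarith, ?_, fun x hx => ?_, fun x hx => ?_, fun x hx => ?_⟩
  · have h1 : 1 + μ - ε ≤ |Γ₀| := by linarith [hgΓ y, le_abs_self Γ₀]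
    nlinarith [abs_nonneg Γ₀]
  · have := abs_le.mp (hclose x hx).1
    linarith
  · have h1 := abs_le.mp (hclose x hx).2
    have hpx := hcp.trans_le (hp1 x)
    have h2 : 1 + μ - ε - 1 ≤ g x - g x / p x := by linarith
    have h3 : 0 ≤ p x / (p x - 1) := div_nonneg (by linarith) (by linarith)
    refine (mul_le_mul_of_nonneg_right h2 h3).trans (le_of_eq ?_)
    have : p x - 1 ≠ 0 := by linarith
    field_simp
  · have h1 := abs_le.mp (hclose x hx).1
    have h2 : g y + c' ≤ (1 + μ) * κ := by
      rcases min_choice (g y - g y / p y) (g y - 1) with h | h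
      · rw [hμ, h]
        have := subcritical_gain hN1 hpy (hpN y) hcN hc (hgc y)
        exact le_trans (by linarith [min_le_left (((N : ℝ) - cN) * c / N ^ 2) (1 / N)]) this
      · rw [hμ, h]
        have h3 : g y * (1 + 1 / N) ≤ g y * κ := mul_le_mul_of_nonneg_left hκ1 hgy
        have h4 : 1 * (1 / (N : ℝ)) ≤ g y * (1 / N) :=
          mul_le_mul_of_nonneg_right (by linarith [hcgx y]) hN0.le
        have h5 := min_le_right (((N : ℝ) - cN) * c / N ^ 2) (1 / N)
        have h6 : (1 + (g y - 1)) * κ = g y * κ := by ring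
        rw [h6]
        linarith
    have h7 : ε * κ ≤ ε * 2 := mul_le_mul_of_nonneg_left hκ2 hε0.le
    have h8 : (1 + μ - ε) * κ = (1 + μ) * κ - ε * κ := by ring
    rw [h8]
    linarith

end Exponents

section Qualitative

variable {N : ℕ} {p v : EuclideanSpace ℝ (Fin N) → ℝ} {C : ℝ}

/-- Truncation at height about `L` by a smooth concave function. -/
theorem hasDerivAt_div_one_add_div {L t : ℝ} (hL : 0 < L) (ht : 0 ≤ t) :
    HasDerivAt (fun s : ℝ => s / (1 + s / L)) (1 / (1 + t / L) ^ 2) t := by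
  have hpos : 0 < 1 + t / L := by positivity
  have h := (hasDerivAt_id t).div (((hasDerivAt_id t).div_const L).const_add 1) hpos.ne'
  refine h.congr_deriv ?_
  simp only [id]
  field_simp
  ring

/-- Global Sobolev integrability of a truncation whose support has finite measure. -/
theorem exists_setIntegral_softPos_sobolev_bound (hC : IsSobolevConst N C) (hN : 2 ≤ N)
    (hp1 : ∀ x, 1 < p x) (hv : ContDiff ℝ 1 v) (hS : volume {x | 1 < v x} ≠ ⊤)
    (hinteg : Integrable fun x => ‖gradient v x‖ ^ p x) :
    ∃ B, ∀ y, ∫ x in Metric.closedBall y 1, softPos 1 (v x - 1) ^ ((N : ℝ) / (N - 1)) ≤ B := by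
  have hN1 : (1 : ℝ) < N := by exact_mod_cast hN
  set κ : ℝ := (N : ℝ) / (N - 1) with hκ
  have hκ0 : 0 < κ := div_pos (by linarith) (by linarith)
  set S : Set (EuclideanSpace ℝ (Fin N)) := {x | 1 < v x} with hSdef
  have hSm : MeasurableSet S := (isOpen_lt continuous_const hv.continuous).measurableSet
  have hSi : Integrable (S.indicator fun _ => (1 : ℝ)) :=
    (integrable_indicator_iff hSm).mpr (integrableOn_const hS)
  set G : EuclideanSpace ℝ (Fin N) → ℝ := fun x => softPos 1 (v x - 1) with hG
  have hG0 : ∀ x, 0 ≤ G x := fun x => softPos_nonneg _ _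
  have hGc : Continuous G := continuous_softPos_sub one_pos hv
  refine ⟨4 ^ κ * (C * ((∫ x, ‖gradient v x‖ ^ p x) + 5 * volume.real S) ^ κ), fun y => ?_⟩
  obtain ⟨M, hM⟩ := (isCompact_closedBall y (1 : ℝ)).bddAbove_image hGc.continuousOn
  set R : ℝ := max 2 M with hR
  have hR2 : 2 ≤ R := le_max_left _ _
  have hR0 : 0 < R := by linarith
  have hGR : ∀ x ∈ Metric.closedBall y 1, G x ≤ R := fun x hx =>
    (hM (Set.mem_image_of_mem _ hx)).trans (le_max_right _ _)
  set H : ℝ → ℝ := fun s => s / (1 + s / R) with hH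
  have hden : ∀ x, 0 < 1 + G x / R := fun x => by have := hG0 x; positivity
  set η : EuclideanSpace ℝ (Fin N) → ℝ := ballCutoff y R 2 with hη
  have hη0 : ∀ x, 0 ≤ η x := fun x => ballCutoff_nonneg _ _ _ _
  have hηd : ContDiff ℝ 1 η := contDiff_ballCutoff (by norm_num) y R
  set f : EuclideanSpace ℝ (Fin N) → ℝ := fun x => η x * (H (G x) / R ^ 4) with hf
  have hGd : ContDiff ℝ 1 G := (contDiff_softPos one_pos).comp (hv.sub contDiff_const)
  have hHd : ContDiff ℝ 1 fun x => H (G x) :=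
    hGd.div (contDiff_const.add (hGd.div_const R)) fun x => (hden x).ne'
  have hfd : ContDiff ℝ 1 f := hηd.mul (hHd.div_const _)
  have hH0 : ∀ x, 0 ≤ H (G x) := fun x => div_nonneg (hG0 x) (hden x).le
  have hHR : ∀ x, H (G x) ≤ R := fun x => by
    simp only [hH]
    rw [div_le_iff₀ (hden x), mul_add, mul_div_cancel₀ _ hR0.ne']
    linarith
  have hf0 : ∀ x, 0 ≤ f x := fun x =>
    mul_nonneg (hη0 x) (div_nonneg (hH0 x) (by positivity))
  have hmax : ∀ x, max (R ^ 2 - ‖x - y‖ ^ 2) 0 ≤ R ^ 2 := fun x =>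
    max_le (by linarith [sq_nonneg ‖x - y‖]) (by positivity)
  have hη1 : ∀ x, η x ≤ R ^ 4 := fun x => by
    have := Real.rpow_le_rpow (le_max_right _ _) (hmax x) (by norm_num : (0 : ℝ) ≤ 2)
    refine this.trans (le_of_eq ?_)
    rw [Real.rpow_two]; ring
  have hηg : ∀ x, ‖gradient η x‖ ≤ 4 * R ^ 3 := fun x => by
    rw [(hasGradientAt_ballCutoff (by norm_num) y R x).gradient, norm_smul, norm_smul,
      Real.norm_of_nonneg (mul_nonneg (by norm_num) (Real.rpow_nonneg (le_max_right _ _) _)),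
      norm_neg, Real.norm_two, show (2 : ℝ) - 1 = 1 by norm_num, Real.rpow_one]
    by_cases hx : x ∈ Metric.closedBall y R
    · rw [Metric.mem_closedBall, dist_eq_norm] at hx
      calc _ ≤ 2 * R ^ 2 * (2 * R) := by
            have := hmax x
            gcongr
        _ = 4 * R ^ 3 := by ring
    · rw [max_sq_sub_of_notMem hR0.le hx, mul_zero, zero_mul]
      positivity
  have hgrad : ∀ x, HasGradientAt f (η x • ((1 / (1 + G x / R) ^ 2 / R ^ 4) •
      (softPosDeriv 1 (v x - 1) • gradient v x)) + (H (G x) / R ^ 4) • gradient η x) x := fun x =>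
    (hηd.hasGradientAt_gradient x).mul_real
      (((hasDerivAt_div_one_add_div hR0 (hG0 x)).div_const (R ^ 4)).comp_hasGradientAt
        (hasGradientAt_softPos_sub one_pos hv x))
  have hbound : ∀ x, ‖fderiv ℝ f x‖ ≤ ‖gradient v x‖ ^ p x + 5 * S.indicator (fun _ => 1) x :=
    fun x => by
    rw [(hgrad x).norm_fderiv_eq]
    have hpn : 0 ≤ ‖gradient v x‖ ^ p x := by positivity
    by_cases hx : x ∈ S
    · rw [Set.indicator_of_mem hx]
      have h1 : ‖η x • ((1 / (1 + G x / R) ^ 2 / R ^ 4) •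
          (softPosDeriv 1 (v x - 1) • gradient v x))‖ ≤ ‖gradient v x‖ := by
        rw [← mul_smul, ← mul_smul, norm_smul]
        refine mul_le_of_le_one_left (norm_nonneg _) ?_
        have hF0 := softPosDeriv_nonneg 1 (v x - 1)
        have hF1 := softPosDeriv_le_one 1 (v x - 1)
        have hd := hden x
        have hd1 : 1 / (1 + G x / R) ^ 2 ≤ 1 := by
          rw [div_le_one (by positivity)]
          exact one_le_pow₀ (by have := hG0 x; have : 0 ≤ G x / R := by positivity
                                linarith)
        have hη0' := hη0 x
        rw [Real.norm_of_nonneg (by positivity)]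
        calc η x * (1 / (1 + G x / R) ^ 2 / R ^ 4) * softPosDeriv 1 (v x - 1)
            ≤ R ^ 4 * (1 / R ^ 4) * 1 := by
              have := hη1 x
              gcongr
          _ = 1 := by field_simp
      have h2 : ‖(H (G x) / R ^ 4) • gradient η x‖ ≤ 4 := by
        rw [norm_smul, Real.norm_of_nonneg (div_nonneg (hH0 x) (by positivity))]
        calc _ ≤ R / R ^ 4 * (4 * R ^ 3) := by
              have := hHR x
              have := hηg x
              gcongr
          _ = 4 := by field_simp
      have h3 := rpow_le_one_add_rpow (norm_nonneg (gradient v x)) zero_le_one (hp1 x).le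
      rw [Real.rpow_one] at h3
      refine (norm_add_le _ _).trans ?_
      linarith
    · have hx' : v x - 1 ≤ 0 := by simpa [hSdef] using hx
      have hGx : G x = 0 := softPos_of_nonpos one_pos hx'
      have hHx : H (G x) = 0 := by simp [hH, hGx]
      rw [Set.indicator_of_notMem hx, softPosDeriv_of_nonpos hx', hHx]
      simpa using hpn
  have hfc : HasCompactSupport f :=
    HasCompactSupport.intro (isCompact_closedBall y R) fun x hx => by
      simp only [hf, hη]
      rw [ballCutoff_of_notMem hR0.le (by norm_num) hx, zero_mul]
  have hfd1 : ∫ x, ‖fderiv ℝ f x‖ ≤ (∫ x, ‖gradient v x‖ ^ p x) + 5 * volume.real S := by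
    have h1 : ∫ x, S.indicator (fun _ => (1 : ℝ)) x = volume.real S := by
      rw [integral_indicator_const _ hSm, smul_eq_mul, mul_one]
    rw [← h1, ← integral_const_mul, ← integral_add hinteg (hSi.const_mul 5)]
    exact integral_mono
      ((hfd.continuous_fderiv one_ne_zero).integrable_of_hasCompactSupport (hfc.fderiv ℝ)).norm
      (hinteg.add (hSi.const_mul 5)) hbound
  have hlow : ∀ x ∈ Metric.closedBall y 1, G x ^ κ ≤ 4 ^ κ * f x ^ κ := fun x hx => by
    rw [← Real.mul_rpow (by norm_num) (hf0 x)]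
    refine Real.rpow_le_rpow (hG0 x) ?_ hκ0.le
    have h1 : G x / 2 ≤ H (G x) := by
      simp only [hH]
      have h2 : G x / R ≤ 1 := by rw [div_le_one hR0]; exact hGR x hx
      exact div_le_div_of_nonneg_left (hG0 x) (hden x) (by linarith)
    have h2 : R ^ 4 / 2 ≤ η x := by
      rw [Metric.mem_closedBall, dist_eq_norm] at hx
      have h3 : 3 / 4 * R ^ 2 ≤ max (R ^ 2 - ‖x - y‖ ^ 2) 0 :=
        le_max_of_le_left (by nlinarith [norm_nonneg (x - y)])
      have h4 := Real.rpow_le_rpow (by positivity) h3 (by norm_num : (0 : ℝ) ≤ 2)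
      rw [Real.rpow_two] at h4
      refine le_trans ?_ h4
      nlinarith [pow_pos hR0 4]
    calc G x = 4 * (R ^ 4 / 2 * (G x / 2 / R ^ 4)) := by field_simp; norm_num
      _ ≤ 4 * (η x * (H (G x) / R ^ 4)) := by
          have := hG0 x
          have := hη0 x
          gcongr
  have hfκc : Continuous fun x => f x ^ κ := hfd.continuous.rpow_const fun _ => Or.inr hκ0.le
  have hfκ : Integrable fun x => f x ^ κ :=
    hfκc.integrable_of_hasCompactSupport (hfc.comp_left (g := fun t : ℝ => t ^ κ)
      (Real.zero_rpow hκ0.ne'))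
  calc ∫ x in Metric.closedBall y 1, G x ^ κ
      ≤ ∫ x in Metric.closedBall y 1, 4 ^ κ * f x ^ κ :=
        setIntegral_closedBall_mono (hGc.rpow_const fun _ => Or.inr hκ0.le)
          (continuous_const.mul hfκc) hlow
    _ ≤ 4 ^ κ * ∫ x, f x ^ κ := by
        rw [integral_const_mul]
        refine mul_le_mul_of_nonneg_left ?_ (by positivity)
        exact setIntegral_le_integral hfκ
          (Eventually.of_forall fun x => Real.rpow_nonneg (hf0 x) _)
    _ ≤ _ := by
        refine mul_le_mul_of_nonneg_left ((hC.2 f hfd hfc hf0).trans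
          (mul_le_mul_of_nonneg_left (Real.rpow_le_rpow
            (integral_nonneg fun _ => norm_nonneg _) hfd1 hκ0.le) hC.1.le)) (by positivity)

end Qualitative

section LocalGain

variable {N : ℕ} {p v : EuclideanSpace ℝ (Fin N) → ℝ} {C : ℝ}

theorem volume_real_closedBall_eq (y : EuclideanSpace ℝ (Fin N)) (R : ℝ) :
    volume.real (Metric.closedBall y R) =
      volume.real (Metric.closedBall (0 : EuclideanSpace ℝ (Fin N)) R) := by
  rw [measureReal_def, measureReal_def, Measure.addHaar_closedBall_center]

theorem setIntegral_closedBall_const (c : ℝ) (y : EuclideanSpace ℝ (Fin N)) (R : ℝ) :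
    ∫ _ in Metric.closedBall y R, c =
      volume.real (Metric.closedBall (0 : EuclideanSpace ℝ (Fin N)) R) * c := by
  rw [setIntegral_const, volume_real_closedBall_eq, smul_eq_mul]

theorem continuous_rpow_of_pos {f g : EuclideanSpace ℝ (Fin N) → ℝ} (hf : Continuous f)
    (hg : Continuous g) (hg0 : ∀ x, 0 < g x) : Continuous fun x => f x ^ g x :=
  hf.rpow hg fun x => Or.inr (hg0 x)

/-- One gain of local integrability, uniform in the centre of the ball. -/
theorem exists_setIntegral_softPos_gain (hC : IsSobolevConst N C) (hN : 2 ≤ N)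
    (hp : Continuous p) (hp1 : ∀ x, 1 < p x) (hv : ContDiff ℝ 1 v)
    (hinteg : Integrable fun x => ‖gradient v x‖ ^ p x) {g g' : EuclideanSpace ℝ (Fin N) → ℝ}
    (hg : Continuous g) (hg' : Continuous g') {Γ d ρ R B : ℝ} (hR0 : 0 < R) (hRρ : R ≤ ρ)
    (hR1 : R ≤ 1) (hβ : ∀ y, ∃ β, IsIterationExponent p g Γ d ρ β y) (hg'0 : ∀ x, 0 < g' x)
    (hg'd : ∀ x, g' x ≤ g x + d)
    (hB : ∀ y, ∫ x in Metric.closedBall y R, softPos 1 (v x - 1) ^ g x ≤ B) :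
    ∃ B', ∀ y, ∫ x in Metric.closedBall y (R / 2), softPos 1 (v x - 1) ^ g' x ≤ B' := by
  have hN1 : (1 : ℝ) < N := by exact_mod_cast hN
  have hκ1 : 1 ≤ (N : ℝ) / (N - 1) := by rw [le_div_iff₀ (by linarith)]; linarith
  set κ : ℝ := (N : ℝ) / (N - 1)
  have hGc : Continuous fun x => softPos 1 (v x - 1) := continuous_softPos_sub one_pos hv
  have hG0 : ∀ x, 0 ≤ softPos 1 (v x - 1) := fun x => softPos_nonneg _ _
  have hg0 : ∀ x, 0 < g x := fun x => by
    obtain ⟨β, h⟩ := hβ x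
    have := h.le_γ x (Metric.mem_closedBall_self (hR0.le.trans hRρ))
    linarith [h.one_lt]
  have hGgc : Continuous fun x => softPos 1 (v x - 1) ^ g x := continuous_rpow_of_pos hGc hg hg0
  have hnabla : Continuous fun x => ‖gradient v x‖ ^ p x :=
    continuous_rpow_of_pos hv.continuous_gradient.norm hp fun x => by linarith [hp1 x]
  set W : ℝ := (1 + 2 * N) * (volume.real (Metric.closedBall (0 : EuclideanSpace ℝ (Fin N)) R) + B)
    + ∫ x, ‖gradient v x‖ ^ p x with hW
  refine ⟨volume.real (Metric.closedBall (0 : EuclideanSpace ℝ (Fin N)) (R / 2)) +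
    C * (Γ * W) ^ κ / (3 / 4 * R ^ 2) ^ (N * Γ), fun y => ?_⟩
  obtain ⟨β, h⟩ := hβ y
  have hβ1 := h.one_lt
  have hβΓ : β ≤ Γ := le_trans (le_mul_of_one_le_right (by linarith) hκ1) h.mul_le
  have hb0 : 0 < 3 / 4 * R ^ 2 := by positivity
  have hb1 : 3 / 4 * R ^ 2 ≤ 1 := by nlinarith
  have hsub : ∀ x ∈ Metric.closedBall y R, x ∈ Metric.closedBall y ρ := fun x hx =>
    Metric.closedBall_subset_closedBall hRρ hx
  have hmain := setIntegral_softPos_rpow_le hC hN hp hp1 hv hβ1 one_pos (half_pos hR0).le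
    (half_le_self hR0.le) hR1 y (ℓ := 1)
  have hdom : ∀ x ∈ Metric.closedBall y R,
      softPos 1 (v x - 1) ^ ((β - 1) * (p x / (p x - 1))) +
        ballCutoff y R N x * softPosDeriv 1 (v x - 1) * ‖gradient v x‖ ^ p x +
        2 * N * softPos 1 (v x - 1) ^ β ≤
      (1 + 2 * N) * (1 + softPos 1 (v x - 1) ^ g x) + ‖gradient v x‖ ^ p x := fun x hx => by
    have hpx := hp1 x
    have h1 := rpow_le_one_add_rpow (hG0 x) (mul_nonneg (by linarith)
      (div_nonneg (by linarith) (by linarith))) (h.mul_conj_le x (hsub x hx))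
    have h2 := rpow_le_one_add_rpow (hG0 x) (by linarith) (h.le_γ x (hsub x hx))
    have h3 : ballCutoff y R N x * softPosDeriv 1 (v x - 1) * ‖gradient v x‖ ^ p x ≤
        ‖gradient v x‖ ^ p x := mul_le_of_le_one_left (by positivity)
      (mul_le_one₀ (ballCutoff_le_one hR0.le hR1 (by linarith) y x) (softPosDeriv_nonneg _ _)
        (softPosDeriv_le_one _ _))
    have h4 := mul_le_mul_of_nonneg_left h2 (by linarith : (0 : ℝ) ≤ 2 * N)
    linarith
  set F : EuclideanSpace ℝ (Fin N) → ℝ := fun x =>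
    softPos 1 (v x - 1) ^ ((β - 1) * (p x / (p x - 1))) +
      ballCutoff y R N x * softPosDeriv 1 (v x - 1) * ‖gradient v x‖ ^ p x +
      2 * N * softPos 1 (v x - 1) ^ β with hF
  have hF0 : ∀ x, 0 ≤ F x := fun x => by
    have := hG0 x
    have := ballCutoff_nonneg y R N x
    have := softPosDeriv_nonneg 1 (v x - 1)
    positivity
  have hFc : Continuous F := by
    have hp0 : ∀ x, 0 < p x - 1 := fun x => sub_pos.mpr (hp1 x)
    have hconj : ∀ x, 0 < (β - 1) * (p x / (p x - 1)) := fun x =>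
      mul_pos (by linarith) (div_pos (by linarith [hp0 x]) (hp0 x))
    exact ((continuous_rpow_of_pos hGc (continuous_const.mul (hp.div (hp.sub continuous_const)
      fun x => (hp0 x).ne')) hconj).add
      (continuous_energy (by exact_mod_cast hN1) one_pos hp hp1 hv)).add
      (continuous_const.mul (hGc.rpow_const fun _ => Or.inr (by linarith)))
  have hFW : ∫ x in Metric.closedBall y R, F x ≤ W := by
    have hi1 : IntegrableOn (fun x => (1 + 2 * (N : ℝ)) * (1 + softPos 1 (v x - 1) ^ g x))
        (Metric.closedBall y R) :=
      (continuous_const.mul (continuous_const.add hGgc)).integrableOn_closedBall' y R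
    refine (setIntegral_closedBall_mono hFc ((continuous_const.mul
      (continuous_const.add hGgc)).add hnabla) (g := fun x => (1 + 2 * (N : ℝ)) *
        (1 + softPos 1 (v x - 1) ^ g x) + ‖gradient v x‖ ^ p x) hdom).trans ?_
    rw [integral_add hi1 hinteg.integrableOn, integral_const_mul,
      integral_add (continuous_const.integrableOn_closedBall' y R)
        (hGgc.integrableOn_closedBall' y R), setIntegral_closedBall_const, mul_one, hW]
    have := hB y
    have := setIntegral_le_integral (s := Metric.closedBall y R) hinteg
      (Eventually.of_forall fun x => by positivity)
    gcongr
  have hβW : β * ∫ x in Metric.closedBall y R, F x ≤ Γ * W := by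
    have : 0 ≤ ∫ x in Metric.closedBall y R, F x := integral_nonneg hF0
    gcongr
    linarith
  have hGβ : ∫ x in Metric.closedBall y (R / 2), softPos 1 (v x - 1) ^ (β * κ) ≤
      C * (Γ * W) ^ κ / (3 / 4 * R ^ 2) ^ (N * Γ) := by
    rw [le_div_iff₀ (Real.rpow_pos_of_pos hb0 _), mul_comm]
    refine le_trans ?_ (hmain.trans (mul_le_mul_of_nonneg_left (Real.rpow_le_rpow
      (mul_nonneg (by linarith) (integral_nonneg hF0)) hβW (by linarith)) hC.1.le))
    rw [show R ^ 2 - (R / 2) ^ 2 = 3 / 4 * R ^ 2 by ring]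
    refine mul_le_mul_of_nonneg_right (Real.rpow_le_rpow_of_exponent_ge hb0 hb1
      (mul_le_mul_of_nonneg_left h.mul_le (by linarith)))
      (integral_nonneg fun x => Real.rpow_nonneg (hG0 x) _)
  have hGβc : Continuous fun x => softPos 1 (v x - 1) ^ (β * κ) :=
    hGc.rpow_const fun _ => Or.inr (by positivity)
  refine (setIntegral_closedBall_mono (continuous_rpow_of_pos hGc hg' hg'0)
    (continuous_const.add hGβc) (g := fun x => 1 + softPos 1 (v x - 1) ^ (β * κ))
    fun x hx => ?_).trans ?_
  · have hx' := hsub x (Metric.closedBall_subset_closedBall (half_le_self hR0.le) hx)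
    exact rpow_le_one_add_rpow (hG0 x) (hg'0 x).le ((hg'd x).trans (h.add_le x hx'))
  · rw [integral_add (continuous_const.integrableOn_closedBall' y _)
      (hGβc.integrableOn_closedBall' y _), setIntegral_closedBall_const, mul_one]
    linarith

end LocalGain

section Bootstrap

variable {N : ℕ} {p v : EuclideanSpace ℝ (Fin N) → ℝ} {C : ℝ}

theorem setIntegral_closedBall_le_of_le {f : EuclideanSpace ℝ (Fin N) → ℝ} (hf : Continuous f)
    (hf0 : ∀ x, 0 ≤ f x) {R R' : ℝ} (h : R' ≤ R) (y : EuclideanSpace ℝ (Fin N)) :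
    ∫ x in Metric.closedBall y R', f x ≤ ∫ x in Metric.closedBall y R, f x :=
  setIntegral_mono_set (hf.integrableOn_closedBall' y R) (Eventually.of_forall hf0)
    (Metric.closedBall_subset_closedBall h).eventuallyLE

/-- Subcritical powers of a truncated Sobolev function are integrable on balls, uniformly in the
centre. -/
theorem exists_setIntegral_softPos_rpow_bound (hC : IsSobolevConst N C) (hN : 2 ≤ N)
    {Kp L : NNReal} (hp : LipschitzWith Kp p) {cp cN : ℝ} (hcp : 1 < cp) (hp1 : ∀ x, cp ≤ p x)
    (hcN : cN < N) (hpN : ∀ x, p x ≤ cN) {γ : EuclideanSpace ℝ (Fin N) → ℝ}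
    (hγ : LipschitzWith L γ) {cγ c Γ₀ : ℝ} (hcγ : 1 < cγ) (hγ1 : ∀ x, cγ ≤ γ x)
    (hγΓ : ∀ x, γ x ≤ Γ₀) (hc : 0 < c) (hgap : ∀ x, c ≤ N * p x / (N - p x) - γ x)
    (hv : ContDiff ℝ 1 v) (hS : volume {x | 1 < v x} ≠ ⊤)
    (hinteg : Integrable fun x => ‖gradient v x‖ ^ p x) {ρ₀ : ℝ} (hρ₀ : 0 < ρ₀) :
    ∃ R B, 0 < R ∧ R ≤ ρ₀ ∧ R ≤ 1 ∧
      ∀ y, ∫ x in Metric.closedBall y R, softPos 1 (v x - 1) ^ γ x ≤ B := by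
  have hN1 : (1 : ℝ) < N := by exact_mod_cast hN
  have hκ1 : 1 < (N : ℝ) / (N - 1) := by rw [lt_div_iff₀ (by linarith)]; linarith
  obtain ⟨B₀, hB₀⟩ := exists_setIntegral_softPos_sobolev_bound hC hN
    (fun x => hcp.trans_le (hp1 x)) hv hS hinteg
  set κ : ℝ := (N : ℝ) / (N - 1)
  obtain ⟨Γ, d, ρ, -, -, hd, -, hρ, hρ1, hexp⟩ := exists_isIterationExponent hN hp hcp hp1 hcN hpN
    L Γ₀ (lt_min hκ1 hcγ) hc
  have hGc : Continuous fun x => softPos 1 (v x - 1) := continuous_softPos_sub one_pos hv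
  have hG0 : ∀ x, 0 ≤ softPos 1 (v x - 1) := fun x => softPos_nonneg _ _
  have hg1 : ∀ (j : ℕ) x, min κ cγ ≤ min (κ + j * d) (γ x) := fun j x =>
    min_le_min (le_add_of_nonneg_right (by positivity)) (hγ1 x)
  have hg0 : ∀ (j : ℕ) x, 0 < min (κ + j * d) (γ x) := fun j x =>
    (zero_lt_one.trans (lt_min hκ1 hcγ)).trans_le (hg1 j x)
  have hgc : ∀ j : ℕ, Continuous fun x => min (κ + j * d) (γ x) := fun j =>
    (hγ.const_min _).continuous
  have key : ∀ j : ℕ, ∃ R B, 0 < R ∧ R ≤ ρ₀ ∧ R ≤ ρ ∧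
      ∀ y, ∫ x in Metric.closedBall y R, softPos 1 (v x - 1) ^ min (κ + j * d) (γ x) ≤ B := by
    intro j
    induction j with
    | zero =>
      refine ⟨min ρ₀ ρ, volume.real (Metric.closedBall (0 : EuclideanSpace ℝ (Fin N)) 1) + B₀,
        lt_min hρ₀ hρ, min_le_left _ _, min_le_right _ _, fun y => ?_⟩
      have hGκ : Continuous fun x => softPos 1 (v x - 1) ^ κ :=
        hGc.rpow_const fun _ => Or.inr (by linarith)
      calc _ ≤ ∫ x in Metric.closedBall y 1, softPos 1 (v x - 1) ^ min (κ + (0 : ℕ) * d) (γ x) :=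
            setIntegral_closedBall_le_of_le (continuous_rpow_of_pos hGc (hgc 0) (hg0 0))
              (fun x => Real.rpow_nonneg (hG0 x) _) ((min_le_right _ _).trans hρ1) y
        _ ≤ ∫ x in Metric.closedBall y 1, (1 + softPos 1 (v x - 1) ^ κ) := by
            refine setIntegral_closedBall_mono (continuous_rpow_of_pos hGc (hgc 0) (hg0 0))
              (continuous_const.add hGκ) fun x _ =>
              rpow_le_one_add_rpow (hG0 x) (hg0 0 x).le (min_le_of_left_le (by simp))
        _ ≤ _ := by
            rw [integral_add (continuous_const.integrableOn_closedBall' y _)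
              (hGκ.integrableOn_closedBall' y _), setIntegral_closedBall_const, mul_one]
            linarith [hB₀ y]
    | succ j ih =>
      obtain ⟨R, B, hR, hR0, hRρ, hB⟩ := ih
      obtain ⟨B', hB'⟩ := exists_setIntegral_softPos_gain hC hN hp.continuous
        (fun x => hcp.trans_le (hp1 x)) hv hinteg (hgc j) (hgc (j + 1)) hR hRρ (hRρ.trans hρ1)
        (hexp _ (hγ.const_min _) (hg1 j) (fun x => (min_le_right _ _).trans (hγΓ x)) fun x =>
          (hgap x).trans (sub_le_sub_left (min_le_right _ _) _)) (hg0 (j + 1)) (fun x => by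
          rw [← min_add_add_right]
          refine min_le_min (le_of_eq ?_) (by linarith)
          push_cast; ring) hB
      exact ⟨R / 2, B', by linarith, by linarith, by linarith, hB'⟩
  obtain ⟨j, hj⟩ := exists_nat_ge ((Γ₀ - κ) / d)
  obtain ⟨R, B, hR, hR0, hRρ, hB⟩ := key j
  refine ⟨R, B, hR, hR0, hRρ.trans hρ1, fun y => ?_⟩
  rw [div_le_iff₀ hd] at hj
  have heq : ∀ x, min (κ + j * d) (γ x) = γ x := fun x =>
    min_eq_right ((hγΓ x).trans (by linarith))
  simpa only [heq] using hB y

/-- A subsolution with finite energy is bounded above. -/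
theorem IsSubsolution.exists_bound (hC : IsSobolevConst N C) {Kp L : NNReal}
    (hp : LipschitzWith Kp p) {cp cN : ℝ} (hcp : 1 < cp) (hp1 : ∀ x, cp ≤ p x)
    (hcN : cN < N) (hpN : ∀ x, p x ≤ cN) {q a γ : EuclideanSpace ℝ (Fin N) → ℝ}
    (hγ : LipschitzWith L γ) {c Γ Λ Cm d ρ : ℝ} (hc : 0 < c)
    (hgap : ∀ x, c ≤ N * p x / (N - p x) - γ x) (hadm : Admissible p q a γ Λ Γ)
    (hexp : ∀ y, ∃ β, IsIterationExponent p γ Γ d ρ β y) (hCm : 0 ≤ Cm) (hΛ : 0 ≤ Λ)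
    (hΓ : 1 < Γ) (hd : 0 < d) (hdΓ : d ≤ Γ) (hρ : 0 < ρ) (hsub : IsSubsolution p q a γ Cm v)
    (hv : ContDiff ℝ 1 v) (hS : volume {x | 1 < v x} ≠ ⊤)
    (hinteg : Integrable fun x => ‖gradient v x‖ ^ p x) : ∃ M, ∀ y, v y ≤ M := by
  have hγ1 : ∀ x, cp ≤ γ x := fun x =>
    (hp1 x).trans ((hadm.p_le_q x).trans (hadm.q_le_γ x))
  obtain ⟨R, B, hR, hRρ, hR1, hB⟩ := exists_setIntegral_softPos_rpow_bound hC hadm.two_le hp hcp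
    hp1 hcN hpN hγ hcp hγ1 hadm.γ_le hc hgap hv hS hinteg hρ
  obtain ⟨K, -, hK⟩ := exists_local_sup_bound hC hadm.two_le hCm hΛ hΓ hd hdΓ hR hR1
  have hγ0 : ∀ x, 0 < γ x := fun x => by linarith [hγ1 x]
  have hGγ : Continuous fun x => softPos 1 (v x - 1) ^ γ x :=
    continuous_rpow_of_pos (continuous_softPos_sub one_pos hv) hγ.continuous hγ0
  have hGγ2 : Continuous fun x => (2 : ℝ) ^ Γ * softPos 1 (v x - 1) ^ γ x :=
    continuous_const.mul hGγ
  have hpt : ∀ x, max (v x) 0 ^ γ x ≤ 4 ^ Γ + 2 ^ Γ * softPos 1 (v x - 1) ^ γ x := fun x => by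
    have hG0 := softPos_nonneg 1 (v x - 1)
    have h2 : (2 : ℝ) ^ γ x ≤ 2 ^ Γ := Real.rpow_le_rpow_of_exponent_le (by norm_num) (hadm.γ_le x)
    have h4 : (4 : ℝ) ^ γ x ≤ 4 ^ Γ := Real.rpow_le_rpow_of_exponent_le (by norm_num) (hadm.γ_le x)
    have hle : max (v x) 0 ≤ softPos 1 (v x - 1) + 2 :=
      max_le (by linarith [sub_le_softPos 1 (v x - 1)]) (by linarith)
    rcases le_total (softPos 1 (v x - 1)) 2 with h | h
    · have := Real.rpow_le_rpow (le_max_right _ _) (hle.trans (by linarith : _ ≤ (4 : ℝ)))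
        (hγ0 x).le
      have : 0 ≤ (2 : ℝ) ^ Γ * softPos 1 (v x - 1) ^ γ x := by positivity
      linarith
    · have h5 := Real.rpow_le_rpow (le_max_right _ _)
        (hle.trans (by linarith : _ ≤ 2 * softPos 1 (v x - 1))) (hγ0 x).le
      rw [Real.mul_rpow (by norm_num) hG0] at h5
      have h6 := mul_le_mul_of_nonneg_right h2 (Real.rpow_nonneg hG0 (γ x))
      have : (0 : ℝ) ≤ 4 ^ Γ := by positivity
      linarith
  set Z : ℝ := volume.real (Metric.closedBall (0 : EuclideanSpace ℝ (Fin N)) R) * 4 ^ Γ +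
    2 ^ Γ * B with hZ
  have hZy : ∀ y, ∫ x in Metric.closedBall y R, max (v x) 0 ^ γ x ≤ Z := fun y => by
    refine (setIntegral_closedBall_mono (continuous_rpow_of_pos
      (hv.continuous.max continuous_const) hγ.continuous hγ0) (continuous_const.add hGγ2)
      (g := fun x => 4 ^ Γ + 2 ^ Γ * softPos 1 (v x - 1) ^ γ x)
      fun x _ => hpt x).trans ?_
    rw [integral_add (continuous_const.integrableOn_closedBall' y R)
      (hGγ2.integrableOn_closedBall' y R), setIntegral_closedBall_const,
      integral_const_mul, hZ]
    gcongr
    exact hB y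
  choose β hβ using hexp
  exact ⟨_, fun y => hK p q a γ v y (β y) hadm ((hβ y).mono hRρ) hsub hv (max Z 1)
    (lt_max_of_lt_right one_pos) ((hZy y).trans (le_max_left _ _))⟩

end Bootstrap

section FiniteModular

variable {N : ℕ} {p q a V u : EuclideanSpace ℝ (Fin N) → ℝ}

theorem CondO.exists_volume_le_lt_top (hO : CondO N p q a V) :
    ∃ K > 0, volume {x | V x ≤ K} < ⊤ := by
  rcases hO.V_alt with ⟨K, hK, -, h⟩ | ⟨R, -, h⟩
  · exact ⟨K, hK, h⟩
  rw [essInf, Filter.liminf_eq] at h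
  have hne : {b | ∀ᵐ x ∂volume.restrict {x : EuclideanSpace ℝ (Fin N) | R ≤ ‖x‖},
      b ≤ V x}.Nonempty := by
    by_contra hne
    rw [Set.not_nonempty_iff_eq_empty] at hne
    rw [hne, Real.sSup_empty] at h
    exact h.ne rfl
  obtain ⟨K, hKmem, hK⟩ := exists_lt_of_lt_csSup hne h
  refine ⟨K / 2, half_pos hK, ?_⟩
  have hm : MeasurableSet {x : EuclideanSpace ℝ (Fin N) | R ≤ ‖x‖} :=
    measurableSet_le measurable_const measurable_norm
  rw [Set.mem_ofPred_eq, ae_restrict_iff' hm] at hKmem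
  have hae : ∀ᵐ x : EuclideanSpace ℝ (Fin N), x ∈ {x | V x ≤ K / 2} → x ∈ Metric.ball 0 R := by
    filter_upwards [hKmem] with x hx hVx
    rw [mem_ball_zero_iff]
    by_contra! hxR
    have := hx hxR
    have hVx' : V x ≤ K / 2 := hVx
    linarith
  exact (measure_mono_ae hae).trans_lt measure_ball_lt_top

theorem lintegral_Hfun_gradient_lt_top (hu : rhoV p q a V u < ⊤) :
    ∫⁻ x, ENNReal.ofReal (Hfun p q a x ‖gradient u x‖) < ⊤ :=
  (lintegral_mono fun _ => le_self_add).trans_lt hu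

theorem lintegral_mul_Hfun_lt_top (hu : rhoV p q a V u < ⊤) :
    ∫⁻ x, ENNReal.ofReal (V x * Hfun p q a x |u x|) < ⊤ :=
  (lintegral_mono fun _ => le_add_self).trans_lt hu

theorem rpow_le_Hfun {x : EuclideanSpace ℝ (Fin N)} (ha : 0 ≤ a x) {t : ℝ} (ht : 0 ≤ t) :
    t ^ p x ≤ Hfun p q a x t :=
  le_add_of_nonneg_right (mul_nonneg ha (Real.rpow_nonneg ht _))

theorem integrable_of_lintegral_ofReal_lt_top {f : EuclideanSpace ℝ (Fin N) → ℝ}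
    (hf : Continuous f) (hf0 : ∀ x, 0 ≤ f x) (h : ∫⁻ x, ENNReal.ofReal (f x) < ⊤) :
    Integrable f := by
  refine ⟨hf.aestronglyMeasurable, ?_⟩
  rw [hasFiniteIntegral_iff_ofReal (Eventually.of_forall hf0)]
  exact h

theorem CondO.one_lt_p (hO : CondO N p q a V) (x : EuclideanSpace ℝ (Fin N)) : 1 < p x := by
  obtain ⟨c, hc, h⟩ := hO.inf_p
  linarith [h x]

theorem CondO.one_lt_q (hO : CondO N p q a V) (x : EuclideanSpace ℝ (Fin N)) : 1 < q x :=
  (hO.one_lt_p x).trans (hO.p_lt_q x)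

theorem CondO.continuous_p (hO : CondO N p q a V) : Continuous p := hO.lip_p.choose_spec.continuous

theorem CondO.continuous_q (hO : CondO N p q a V) : Continuous q := hO.lip_q.choose_spec.continuous

theorem CondO.continuous_a (hO : CondO N p q a V) : Continuous a := hO.lip_a.choose_spec.continuous

theorem CondO.continuous_Hfun_abs (hO : CondO N p q a V) (hu : Continuous u) :
    Continuous fun x => Hfun p q a x |u x| :=
  (continuous_rpow_of_pos hu.abs hO.continuous_p fun x => by linarith [hO.one_lt_p x]).add
    (hO.continuous_a.mul (continuous_rpow_of_pos hu.abs hO.continuous_q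
      fun x => by linarith [hO.one_lt_q x]))

theorem CondO.aemeasurable_mul_Hfun (hO : CondO N p q a V) (hu : Continuous u) :
    AEMeasurable fun x => ENNReal.ofReal (V x * Hfun p q a x |u x|) :=
  (hO.V_loc.aestronglyMeasurable.aemeasurable.mul
    (hO.continuous_Hfun_abs hu).measurable.aemeasurable).ennreal_ofReal

theorem CondO.integrable_gradient_rpow (hO : CondO N p q a V) (hu : ContDiff ℝ 1 u)
    (hfin : rhoV p q a V u < ⊤) :
    Integrable fun x => ‖gradient u x‖ ^ p x :=
  integrable_of_lintegral_ofReal_lt_top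
    (continuous_rpow_of_pos hu.continuous_gradient.norm hO.continuous_p
      fun x => by linarith [hO.one_lt_p x])
    (fun x => Real.rpow_nonneg (norm_nonneg _) _)
    ((lintegral_mono fun x => ENNReal.ofReal_le_ofReal
      (rpow_le_Hfun (hO.a_nonneg x) (norm_nonneg _))).trans_lt
      (lintegral_Hfun_gradient_lt_top hfin))

theorem CondO.volume_one_lt_abs_lt_top (hO : CondO N p q a V) (hu : ContDiff ℝ 1 u)
    (hfin : rhoV p q a V u < ⊤) : volume {x | 1 < |u x|} < ⊤ := by
  obtain ⟨K, hK, hKV⟩ := hO.exists_volume_le_lt_top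
  have hK' : ENNReal.ofReal K ≠ 0 := by simpa using hK
  have hsub : {x | 1 < |u x|} ⊆ {x | V x ≤ K} ∪
      {x | ENNReal.ofReal K ≤ ENNReal.ofReal (V x * Hfun p q a x |u x|)} := fun x hx => by
    rcases le_or_gt (V x) K with h | h
    · exact Or.inl h
    · refine Or.inr (ENNReal.ofReal_le_ofReal ?_)
      have h1 : 1 ≤ Hfun p q a x |u x| :=
        (Real.one_le_rpow (le_of_lt hx) (by linarith [hO.one_lt_p x])).trans
          (rpow_le_Hfun (hO.a_nonneg x) (abs_nonneg _))
      nlinarith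
  refine (measure_mono hsub).trans_lt ((measure_union_le _ _).trans_lt (ENNReal.add_lt_top.mpr
    ⟨hKV, (meas_ge_le_lintegral_div (hO.aemeasurable_mul_Hfun hu.continuous) hK'
      ENNReal.ofReal_ne_top).trans_lt ?_⟩))
  exact ENNReal.div_lt_top (lintegral_mul_Hfun_lt_top hfin).ne hK'

theorem CondO.integrable_abs_rpow (hO : CondO N p q a V) (hu : ContDiff ℝ 1 u)
    (hfin : rhoV p q a V u < ⊤) {γ : EuclideanSpace ℝ (Fin N) → ℝ} (hγ : Continuous γ) {Γ M : ℝ}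
    (hqγ : ∀ x, q x ≤ γ x) (hγΓ : ∀ x, γ x ≤ Γ) (hM : ∀ x, |u x| ≤ M) :
    Integrable fun x => |u x| ^ γ x := by
  obtain ⟨K, hK, hKV⟩ := hO.exists_volume_le_lt_top
  have hγ0 : ∀ x, 0 < γ x := fun x => by linarith [hO.one_lt_q x, hqγ x]
  refine integrable_of_lintegral_ofReal_lt_top (continuous_rpow_of_pos hu.continuous.abs hγ hγ0)
    (fun x => Real.rpow_nonneg (abs_nonneg _) _) ?_
  set T := toMeasurable volume ({x | V x ≤ K} ∪ {x | 1 < |u x|}) with hT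
  have hTfin : volume T < ⊤ := by
    rw [hT, measure_toMeasurable]
    exact (measure_union_le _ _).trans_lt
      (ENNReal.add_lt_top.mpr ⟨hKV, hO.volume_one_lt_abs_lt_top hu hfin⟩)
  have hTm : MeasurableSet T := measurableSet_toMeasurable _ _
  have hpt : ∀ x, ENNReal.ofReal (|u x| ^ γ x) ≤
      T.indicator (fun _ => ENNReal.ofReal (1 + |M| ^ Γ)) x +
        ENNReal.ofReal K⁻¹ * ENNReal.ofReal (V x * Hfun p q a x |u x|) := fun x => by
    by_cases hx : x ∈ T
    · rw [Set.indicator_of_mem hx]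
      refine le_add_right (ENNReal.ofReal_le_ofReal ?_)
      exact (Real.rpow_le_rpow (abs_nonneg _) ((hM x).trans (le_abs_self M)) (hγ0 x).le).trans
        (rpow_le_one_add_rpow (abs_nonneg M) (hγ0 x).le (hγΓ x))
    · have hx' : x ∉ {x | V x ≤ K} ∪ {x | 1 < |u x|} := fun h => hx (subset_toMeasurable _ _ h)
      rw [Set.mem_union, not_or] at hx'
      obtain ⟨hV, h1⟩ := hx'
      rw [Set.mem_ofPred_eq, not_le] at hV
      rw [Set.mem_ofPred_eq, not_lt] at h1
      refine le_add_left ?_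
      rw [← ENNReal.ofReal_mul (inv_nonneg.mpr hK.le)]
      refine ENNReal.ofReal_le_ofReal ?_
      have hH : |u x| ^ γ x ≤ Hfun p q a x |u x| :=
        (Real.rpow_le_rpow_of_exponent_ge' (abs_nonneg _) h1 (by linarith [hO.one_lt_p x])
          ((hO.p_lt_q x).le.trans (hqγ x))).trans (rpow_le_Hfun (hO.a_nonneg x) (abs_nonneg _))
      have hH0 : 0 ≤ Hfun p q a x |u x| := (Real.rpow_nonneg (abs_nonneg _) _).trans hH
      rw [inv_mul_eq_div, le_div_iff₀ hK]
      nlinarith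
  refine (lintegral_mono hpt).trans_lt ?_
  rw [lintegral_add_left (measurable_const.indicator hTm), lintegral_indicator_const hTm,
    lintegral_const_mul'' _ (hO.aemeasurable_mul_Hfun hu.continuous)]
  exact ENNReal.add_lt_top.mpr ⟨ENNReal.mul_lt_top ENNReal.ofReal_lt_top hTfin,
    ENNReal.mul_lt_top ENNReal.ofReal_lt_top (lintegral_mul_Hfun_lt_top hfin)⟩

end FiniteModular

section Mollification

variable {N : ℕ}

/-- Smooth approximation of a `C¹` compactly supported function together with its gradient. -/
theorem exists_contDiff_approx {φ : EuclideanSpace ℝ (Fin N) → ℝ} (hφ : ContDiff ℝ 1 φ)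
    (hφc : HasCompactSupport φ) {ε : ℝ} (hε : 0 < ε) :
    ∃ ψ : EuclideanSpace ℝ (Fin N) → ℝ, ContDiff ℝ (⊤ : ℕ∞) ψ ∧ HasCompactSupport ψ ∧
      (∀ x, |ψ x - φ x| ≤ ε ∧ ‖gradient ψ x - gradient φ x‖ ≤ ε) ∧
      ∀ x ∉ Metric.cthickening 1 (tsupport φ), ψ x = φ x ∧ gradient ψ x = gradient φ x := by
  have hφ' : Continuous (fderiv ℝ φ) := hφ.continuous_fderiv one_ne_zero
  obtain ⟨δ₁, hδ₁, h₁⟩ := Metric.uniformContinuous_iff.mp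
    (hφ.continuous.uniformContinuous_of_tendsto_cocompact hφc.is_zero_at_infty) ε hε
  obtain ⟨δ₂, hδ₂, h₂⟩ := Metric.uniformContinuous_iff.mp
    (hφ'.uniformContinuous_of_tendsto_cocompact (hφc.fderiv ℝ).is_zero_at_infty) ε hε
  set δ : ℝ := min 1 (min δ₁ δ₂) with hδ
  have hδ0 : 0 < δ := lt_min one_pos (lt_min hδ₁ hδ₂)
  let η : ContDiffBump (0 : EuclideanSpace ℝ (Fin N)) := ⟨δ / 2, δ, by positivity, by linarith⟩
  set ψ : EuclideanSpace ℝ (Fin N) → ℝ :=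
    convolution (η.normed volume) φ (ContinuousLinearMap.lsmul ℝ ℝ) volume with hψ
  have hηc : HasCompactSupport (η.normed volume) := η.hasCompactSupport_normed
  have hψc : HasCompactSupport ψ := hηc.convolution _ hφc
  have hψs : ContDiff ℝ (⊤ : ℕ∞) ψ :=
    hηc.contDiff_convolution_left _ η.contDiff_normed hφ.continuous.locallyIntegrable
  have hψd : ∀ x, fderiv ℝ ψ x = convolution (η.normed volume) (fderiv ℝ φ)
      (ContinuousLinearMap.lsmul ℝ ℝ) volume x := fun x =>
    (hφc.hasFDerivAt_convolution_right _ η.continuous_normed.locallyIntegrable hφ x).fderiv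
  have hgrad : ∀ x, ‖gradient ψ x - gradient φ x‖ = dist (convolution (η.normed volume)
      (fderiv ℝ φ) (ContinuousLinearMap.lsmul ℝ ℝ) volume x) (fderiv ℝ φ x) := fun x => by
    rw [gradient, gradient, ← map_sub, LinearIsometryEquiv.norm_map, hψd, dist_eq_norm]
  have hdist : ∀ x : EuclideanSpace ℝ (Fin N), ∀ y ∈ Metric.ball x η.rOut, dist y x < δ :=
    fun x y hy => hy
  refine ⟨ψ, hψs, hψc, fun x => ⟨?_, ?_⟩, fun x hx => ?_⟩
  · rw [← Real.dist_eq]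
    refine η.dist_normed_convolution_le hφ.continuous.aestronglyMeasurable fun y hy => ?_
    exact (h₁ ((hdist x y hy).trans_le ((min_le_right _ _).trans (min_le_left _ _)))).le
  · rw [hgrad]
    refine η.dist_normed_convolution_le hφ'.aestronglyMeasurable fun y hy => ?_
    exact (h₂ ((hdist x y hy).trans_le ((min_le_right _ _).trans (min_le_right _ _)))).le
  · have hout : ∀ y ∈ Metric.ball x η.rOut, y ∉ tsupport φ := fun y hy hyt =>
      hx (Metric.mem_cthickening_of_dist_le x y 1 _ hyt
        (by rw [dist_comm]; exact (hdist x y hy).le.trans (min_le_left _ _)))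
    have hx0 : x ∉ tsupport φ := hout x (Metric.mem_ball_self η.rOut_pos)
    have hφ0 : ∀ y ∉ tsupport φ, φ y = 0 := fun y => image_eq_zero_of_notMem_tsupport
    have hφ'0 : ∀ y ∉ tsupport φ, fderiv ℝ φ y = 0 := fun y hy =>
      image_eq_zero_of_notMem_tsupport fun h => hy (tsupport_fderiv_subset ℝ h)
    constructor
    · refine dist_le_zero.mp (η.dist_normed_convolution_le
        hφ.continuous.aestronglyMeasurable fun y hy => ?_)
      rw [hφ0 y (hout y hy), hφ0 x hx0, dist_self]
    · rw [← sub_eq_zero, ← norm_le_zero_iff, hgrad]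
      refine η.dist_normed_convolution_le hφ'.aestronglyMeasurable fun y hy => ?_
      rw [hφ'0 y (hout y hy), hφ'0 x hx0, dist_self]

theorem MeasureTheory.LocallyIntegrable.integrable_mul_of_hasCompactSupport
    {b φ : EuclideanSpace ℝ (Fin N) → ℝ} (hb : LocallyIntegrable b) (hφ : Continuous φ)
    (hφc : HasCompactSupport φ) : Integrable fun x => b x * φ x := by
  simpa only [smul_eq_mul, mul_comm] using
    hb.integrable_smul_left_of_hasCompactSupport hφ hφc

/-- A distributional identity extends to `C¹` compactly supported test functions. -/
theorem integral_inner_gradient_add_eq_zero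
    {X : EuclideanSpace ℝ (Fin N) → EuclideanSpace ℝ (Fin N)}
    {b : EuclideanSpace ℝ (Fin N) → ℝ} (hX : LocallyIntegrable X) (hb : LocallyIntegrable b)
    (h : ∀ φ : EuclideanSpace ℝ (Fin N) → ℝ, ContDiff ℝ (⊤ : ℕ∞) φ → HasCompactSupport φ →
      (∫ x, inner ℝ (X x) (gradient φ x)) + ∫ x, b x * φ x = 0)
    {φ : EuclideanSpace ℝ (Fin N) → ℝ} (hφ : ContDiff ℝ 1 φ) (hφc : HasCompactSupport φ) :
    (∫ x, inner ℝ (X x) (gradient φ x)) + ∫ x, b x * φ x = 0 := by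
  have hinteg : ∀ ψ : EuclideanSpace ℝ (Fin N) → ℝ, ContDiff ℝ 1 ψ → HasCompactSupport ψ →
      Integrable (fun x => inner ℝ (X x) (gradient ψ x)) ∧ Integrable (fun x => b x * ψ x) :=
    fun ψ hψ hψc => ⟨integrable_inner_of_hasCompactSupport hX hψ.continuous_gradient hψc.gradient,
      hb.integrable_mul_of_hasCompactSupport hψ.continuous hψc⟩
  set K := Metric.cthickening 1 (tsupport φ) with hK
  have hKc : IsCompact K := hφc.isCompact.cthickening
  have hKm : MeasurableSet K := Metric.isClosed_cthickening.measurableSet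
  have hD : Integrable (K.indicator fun x => ‖X x‖ + |b x|) :=
    (integrable_indicator_iff hKm).mpr
      ((hX.integrableOn_isCompact hKc).norm.add (hb.integrableOn_isCompact hKc).abs)
  set D : ℝ := ∫ x, K.indicator (fun x => ‖X x‖ + |b x|) x with hDdef
  have hD0 : 0 ≤ D := integral_nonneg fun x =>
    Set.indicator_nonneg (fun x _ => by positivity) x
  set A : ℝ := (∫ x, inner ℝ (X x) (gradient φ x)) + ∫ x, b x * φ x with hA
  have hsmall : ∀ ε > 0, |A| ≤ ε * D := fun ε hε => by
    obtain ⟨ψ, hψ, hψc, hle, heq⟩ := exists_contDiff_approx hφ hφc hε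
    have hψ1 : ContDiff ℝ 1 ψ := hψ.of_le (by exact_mod_cast le_top)
    obtain ⟨i1, i2⟩ := hinteg φ hφ hφc
    obtain ⟨i3, i4⟩ := hinteg ψ hψ1 hψc
    have hAe : -A = ∫ x, ((inner ℝ (X x) (gradient ψ x) + b x * ψ x) -
        (inner ℝ (X x) (gradient φ x) + b x * φ x)) := by
      have i5 : Integrable fun x => inner ℝ (X x) (gradient φ x) + b x * φ x := i1.add i2
      have i6 : Integrable fun x => inner ℝ (X x) (gradient ψ x) + b x * ψ x := i3.add i4
      rw [integral_sub i6 i5, integral_add i3 i4, integral_add i1 i2, h ψ hψ hψc, zero_sub]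
    rw [← abs_neg, hAe, ← Real.norm_eq_abs, hDdef, ← integral_const_mul]
    refine norm_integral_le_of_norm_le (hD.const_mul ε) (Eventually.of_forall fun x => ?_)
    have e : (inner ℝ (X x) (gradient ψ x) + b x * ψ x) -
        (inner ℝ (X x) (gradient φ x) + b x * φ x) =
        inner ℝ (X x) (gradient ψ x - gradient φ x) + b x * (ψ x - φ x) := by
      rw [inner_sub_right]; ring
    rw [e]
    by_cases hx : x ∈ K
    · rw [Set.indicator_of_mem hx]
      calc _ ≤ ‖X x‖ * ‖gradient ψ x - gradient φ x‖ + |b x| * |ψ x - φ x| := by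
            refine (norm_add_le _ _).trans (add_le_add (norm_inner_le_norm _ _) ?_)
            rw [Real.norm_eq_abs, abs_mul]
        _ ≤ ‖X x‖ * ε + |b x| * ε := by
            have := hle x
            gcongr
            exacts [this.2, this.1]
        _ = ε * (‖X x‖ + |b x|) := by ring
    · obtain ⟨h1, h2⟩ := heq x hx
      simp [Set.indicator_of_notMem hx, h1, h2]
  have hlim : Tendsto (fun ε : ℝ => ε * D) (nhdsWithin 0 (Set.Ioi 0)) (nhds 0) := by
    have : Tendsto (fun ε : ℝ => ε * D) (nhds 0) (nhds (0 * D)) := tendsto_id.mul_const D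
    rw [zero_mul] at this
    exact this.mono_left nhdsWithin_le_nhds
  exact abs_nonpos_iff.mp (ge_of_tendsto hlim (eventually_nhdsWithin_of_forall hsmall))

end Mollification

section WeakSolutions

variable {N : ℕ} {p q a V γ u : EuclideanSpace ℝ (Fin N) → ℝ} {Cm : ℝ}

theorem gradient_neg (u : EuclideanSpace ℝ (Fin N) → ℝ) (x : EuclideanSpace ℝ (Fin N)) :
    gradient (-u) x = -gradient u x := by
  rw [gradient, gradient, fderiv_neg, map_neg]

theorem doublePhaseFlux_neg (p q a u : EuclideanSpace ℝ (Fin N) → ℝ)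
    (x : EuclideanSpace ℝ (Fin N)) :
    doublePhaseFlux p q a (-u) x = -doublePhaseFlux p q a u x := by
  simp only [doublePhaseFlux, gradient_neg, norm_neg, smul_neg]

theorem locallyIntegrable_of_abs_le {f h : EuclideanSpace ℝ (Fin N) → ℝ}
    (hf : AEStronglyMeasurable f) (hh : LocallyIntegrable h)
    (hle : ∀ᵐ x, |f x| ≤ h x) : LocallyIntegrable f :=
  hh.mono hf (hle.mono fun _ hx => hx.trans (le_abs_self _))

/-- A function solving an equation whose lower order term is controlled on `{v > 0}` is a
subsolution. -/
theorem IsSubsolution.of_forall_eq_zero {v b : EuclideanSpace ℝ (Fin N) → ℝ}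
    (hv : Continuous v) (hγ : Continuous γ) (hγ1 : ∀ x, 1 < γ x) (hb : LocallyIntegrable b)
    (h : ∀ φ : EuclideanSpace ℝ (Fin N) → ℝ, ContDiff ℝ 1 φ → HasCompactSupport φ →
      (∫ x, inner ℝ (doublePhaseFlux p q a v x) (gradient φ x)) + ∫ x, b x * φ x = 0)
    (hle : ∀ᵐ x, 0 < v x → -b x ≤ Cm * |v x| ^ (γ x - 1)) : IsSubsolution p q a γ Cm v := by
  intro φ hφ hφc hφ0 hφv
  have hc : Continuous fun x => Cm * |v x| ^ (γ x - 1) :=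
    continuous_const.mul (continuous_rpow_of_pos hv.abs (hγ.sub continuous_const)
      fun x => sub_pos.mpr (hγ1 x))
  have e : ∫ x, inner ℝ (doublePhaseFlux p q a v x) (gradient φ x) = ∫ x, -(b x * φ x) := by
    rw [integral_neg]
    linarith [h φ hφ hφc]
  rw [e]
  refine integral_mono_ae (hb.integrable_mul_of_hasCompactSupport hφ.continuous hφc).neg
    ((hc.mul hφ.continuous).integrable_of_hasCompactSupport hφc.mul_left) ?_
  filter_upwards [hle] with x hx
  rcases le_or_gt (v x) 0 with h0 | h0
  · simp [hφv x h0]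
  · rw [← neg_mul]
    exact mul_le_mul_of_nonneg_right (hx h0) (hφ0 x)

/-- The positive and negative parts of a weak solution are subsolutions. -/
theorem CondO.isSubsolution_of_weak (hO : CondO N p q a V) (hu : ContDiff ℝ 1 u)
    (hγ : Continuous γ) (hγ1 : ∀ x, 1 < γ x) {g : EuclideanSpace ℝ (Fin N) → ℝ → ℝ}
    (hgm : ∀ t : ℝ, Measurable fun x => g x t) (hgc : ∀ x, Continuous fun t => g x t)
    (hg : ∀ᵐ x ∂(volume : Measure (EuclideanSpace ℝ (Fin N))),
      ∀ t : ℝ, |g x t| ≤ Cm * |t| ^ (γ x - 1))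
    (hw : ∀ φ : EuclideanSpace ℝ (Fin N) → ℝ, ContDiff ℝ (⊤ : ℕ∞) φ → HasCompactSupport φ →
      (∫ x, inner ℝ (doublePhaseFlux p q a u x) (gradient φ x)) +
        (∫ x, V x * ((|u x| ^ (p x - 2) * u x + a x * |u x| ^ (q x - 2) * u x) * φ x)) =
        ∫ x, g x (u x) * φ x) :
    IsSubsolution p q a γ Cm u ∧ IsSubsolution p q a γ Cm (-u) := by
  set w : EuclideanSpace ℝ (Fin N) → ℝ := fun x =>
    |u x| ^ (p x - 2) * u x + a x * |u x| ^ (q x - 2) * u x with hwdef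
  have hp1 := hO.one_lt_p
  have hq1 := hO.one_lt_q
  have hwm : Measurable w := by
    have h1 := hu.continuous.measurable
    have h2 := hO.continuous_p.measurable
    have h3 := hO.continuous_q.measurable
    have h4 := hO.continuous_a.measurable
    have h5 : Measurable fun x => |u x| := hu.continuous.abs.measurable
    exact ((h5.pow (h2.sub_const 2)).mul h1).add ((h4.mul (h5.pow (h3.sub_const 2))).mul h1)
  have hwle : ∀ x, |w x| ≤ |u x| ^ (p x - 1) + a x * |u x| ^ (q x - 1) := fun x => by
    refine (abs_add_le _ _).trans (le_of_eq ?_)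
    rw [abs_mul, abs_mul, abs_mul, abs_of_nonneg (hO.a_nonneg x),
      abs_of_nonneg (Real.rpow_nonneg (abs_nonneg (u x)) _),
      abs_of_nonneg (Real.rpow_nonneg (abs_nonneg (u x)) _), mul_assoc,
      rpow_sub_two_mul_self (abs_nonneg _) (hp1 x), rpow_sub_two_mul_self (abs_nonneg _) (hq1 x)]
  have hwc : Continuous fun x => |u x| ^ (p x - 1) + a x * |u x| ^ (q x - 1) :=
    (continuous_rpow_of_pos hu.continuous.abs (hO.continuous_p.sub continuous_const)
      fun x => sub_pos.mpr (hp1 x)).add (hO.continuous_a.mul (continuous_rpow_of_pos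
        hu.continuous.abs (hO.continuous_q.sub continuous_const) fun x => sub_pos.mpr (hq1 x)))
  have hVw : LocallyIntegrable fun x => V x * w x := by
    refine locallyIntegrable_of_abs_le
      (hO.V_loc.aestronglyMeasurable.mul hwm.aestronglyMeasurable)
      (hO.V_loc.mul_continuous hwc) ?_
    filter_upwards [hO.V_nonneg] with x hx
    rw [abs_mul, abs_of_nonneg hx]
    exact mul_le_mul_of_nonneg_left (hwle x) hx
  have hgi : LocallyIntegrable fun x => g x (u x) := by
    have hm : Measurable (Function.uncurry fun t x => g x t) :=
      measurable_uncurry_of_continuous_of_measurable hgc hgm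
    refine locallyIntegrable_of_abs_le
      (hm.comp (hu.continuous.measurable.prodMk measurable_id)).aestronglyMeasurable
      (h := fun x => Cm * |u x| ^ (γ x - 1)) (Continuous.locallyIntegrable ?_)
      (hg.mono fun x hx => hx (u x))
    exact continuous_const.mul (continuous_rpow_of_pos hu.continuous.abs
      (hγ.sub continuous_const) fun x => sub_pos.mpr (hγ1 x))
  set b : EuclideanSpace ℝ (Fin N) → ℝ := fun x => V x * w x - g x (u x) with hb
  have hbi : LocallyIntegrable b := hVw.sub hgi
  have hX := locallyIntegrable_doublePhaseFlux hO.continuous_p hO.continuous_q hO.continuous_a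
    hp1 hq1 hO.a_nonneg hu
  have hweak : ∀ φ : EuclideanSpace ℝ (Fin N) → ℝ, ContDiff ℝ 1 φ → HasCompactSupport φ →
      (∫ x, inner ℝ (doublePhaseFlux p q a u x) (gradient φ x)) + ∫ x, b x * φ x = 0 :=
    fun φ hφ hφc => integral_inner_gradient_add_eq_zero hX hbi (fun ψ hψ hψc => by
      have i1 := hVw.integrable_mul_of_hasCompactSupport hψ.continuous hψc
      have i2 := hgi.integrable_mul_of_hasCompactSupport hψ.continuous hψc
      have h1 : ∫ x, b x * ψ x = (∫ x, V x * w x * ψ x) - ∫ x, g x (u x) * ψ x := by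
        rw [← integral_sub i1 i2]
        simp only [hb, sub_mul]
      have h2 := hw ψ hψ hψc
      simp only [← mul_assoc] at h2
      simp only [hwdef] at h1 ⊢
      rw [h1]
      linarith) hφ hφc
  have hfac : ∀ x, w x = (|u x| ^ (p x - 2) + a x * |u x| ^ (q x - 2)) * u x := fun x => by
    simp only [hwdef]; ring
  have hcoef : ∀ x, 0 ≤ |u x| ^ (p x - 2) + a x * |u x| ^ (q x - 2) := fun x => by
    have := hO.a_nonneg x
    positivity
  refine ⟨.of_forall_eq_zero hu.continuous hγ hγ1 hbi hweak ?_,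
    .of_forall_eq_zero (b := -b) hu.continuous.neg hγ hγ1 hbi.neg (fun φ hφ hφc => ?_) ?_⟩
  · filter_upwards [hg, hO.V_nonneg] with x hgx hVx h0
    have h1 := (le_abs_self _).trans (hgx (u x))
    have h2 : 0 ≤ V x * w x := by
      rw [hfac]
      exact mul_nonneg hVx (mul_nonneg (hcoef x) h0.le)
    simp only [hb]
    linarith
  · have := hweak φ hφ hφc
    simp only [doublePhaseFlux_neg, inner_neg_left, Pi.neg_apply, neg_mul, integral_neg]
    linarith
  · filter_upwards [hg, hO.V_nonneg] with x hgx hVx h0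
    rw [Pi.neg_apply] at h0
    have h1 := (neg_le_abs _).trans (hgx (u x))
    have h2 : V x * w x ≤ 0 := by
      rw [hfac]
      exact mul_nonpos_of_nonneg_of_nonpos hVx
        (mul_nonpos_of_nonneg_of_nonpos (hcoef x) (by linarith))
    simp only [hb, Pi.neg_apply, neg_neg, abs_neg]
    linarith

end WeakSolutions

section Luxemburg

variable {N : ℕ}

theorem rpow_le_max_rpow {τ r r₁ r₂ : ℝ} (hτ : 0 < τ) (h₁ : r₁ ≤ r) (h₂ : r ≤ r₂) :
    τ ^ r ≤ max (τ ^ r₁) (τ ^ r₂) := by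
  rcases le_total τ 1 with h | h
  · exact le_max_of_le_left (Real.rpow_le_rpow_of_exponent_ge hτ h h₁)
  · exact le_max_of_le_right (Real.rpow_le_rpow_of_exponent_le h h₂)

theorem max_rpow_rpow_le {τ r₁ r₂ e e₁ e₂ : ℝ} (hτ : 0 < τ) (hr₁ : 0 ≤ r₁) (hr : r₁ ≤ r₂)
    (he₁ : 0 ≤ e₁) (h₁ : e₁ ≤ e) (h₂ : e ≤ e₂) :
    max (τ ^ r₁) (τ ^ r₂) ^ e ≤ max (τ ^ (r₁ * e₁)) (τ ^ (r₂ * e₂)) := by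
  have hmul : ∀ r, r₁ ≤ r → r ≤ r₂ → r₁ * e₁ ≤ r * e ∧ r * e ≤ r₂ * e₂ := fun r h h' =>
    ⟨mul_le_mul h h₁ he₁ (hr₁.trans h), mul_le_mul h' h₂ (he₁.trans h₁) (hr₁.trans hr)⟩
  rcases max_choice (τ ^ r₁) (τ ^ r₂) with h | h <;> rw [h, ← Real.rpow_mul hτ.le]
  · exact rpow_le_max_rpow hτ (hmul r₁ le_rfl hr).1 (hmul r₁ le_rfl hr).2
  · exact rpow_le_max_rpow hτ (hmul r₂ hr le_rfl).1 (hmul r₂ hr le_rfl).2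

/-- A bound valid for every admissible scaling passes to the Luxemburg norm. -/
theorem le_comp_luxNormOn {Φ : EuclideanSpace ℝ (Fin N) → ℝ → ℝ}
    {U : Set (EuclideanSpace ℝ (Fin N))} {u : EuclideanSpace ℝ (Fin N) → ℝ} {f : ℝ → ℝ}
    (hf : Continuous f) {b : ℝ}
    (hne : ∃ τ > 0, ∫⁻ x in U, ENNReal.ofReal (Φ x (|u x| / τ)) ≤ 1)
    (h : ∀ τ > 0, ∫⁻ x in U, ENNReal.ofReal (Φ x (|u x| / τ)) ≤ 1 → b ≤ f τ) :
    b ≤ f (luxNormOn Φ U u) :=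
  closure_minimal (fun τ hτ => h τ hτ.1 hτ.2) (isClosed_le continuous_const hf)
    (csInf_mem_closure hne ⟨0, fun _ hτ => hτ.1.le⟩)

/-- A bounded function with integrable lower power has finite Luxemburg norm. -/
theorem exists_modular_div_le_one {γ s α u : EuclideanSpace ℝ (Fin N) → ℝ} {S Λ M : ℝ}
    (hγ1 : ∀ x, 1 ≤ γ x) (hγs : ∀ x, γ x ≤ s x) (hs : ∀ x, s x ≤ S) (hΛ : 0 ≤ Λ)
    (hα : ∀ x, α x ≤ Λ) (hM : ∀ x, |u x| ≤ M) (hu : Integrable fun x => |u x| ^ γ x) :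
    ∃ τ > 0, ∫⁻ x in Set.univ, ENNReal.ofReal
      ((|u x| / τ) ^ γ x + α x * (|u x| / τ) ^ s x) ≤ 1 := by
  set M₁ : ℝ := max 1 M with hM₁
  have hM1 : 1 ≤ M₁ := le_max_left _ _
  set D : ℝ := 1 + Λ * M₁ ^ S with hD
  have hD0 : 0 ≤ D := by positivity
  set I : ℝ := ∫ x, |u x| ^ γ x with hI
  set τ : ℝ := max 1 (D * I) with hτ
  have hτ1 : 1 ≤ τ := le_max_left _ _
  have hτ0 : 0 < τ := by linarith
  refine ⟨τ, hτ0, ?_⟩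
  have hpt : ∀ x, (|u x| / τ) ^ γ x + α x * (|u x| / τ) ^ s x ≤ D / τ * |u x| ^ γ x := fun x => by
    have ht0 : 0 ≤ |u x| / τ := by positivity
    have htM : |u x| / τ ≤ M₁ :=
      (div_le_self (abs_nonneg _) hτ1).trans ((hM x).trans (le_max_right _ _))
    have hγx := hγ1 x
    have h1 : (|u x| / τ) ^ s x ≤ M₁ ^ S * (|u x| / τ) ^ γ x := by
      rcases ht0.eq_or_lt with h0 | h0
      · rw [← h0, Real.zero_rpow (by linarith [hγs x])]
        positivity
      · rw [show s x = (s x - γ x) + γ x by ring, Real.rpow_add h0]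
        refine mul_le_mul_of_nonneg_right ?_ (by positivity)
        exact (Real.rpow_le_rpow ht0 htM (by linarith [hγs x])).trans
          (Real.rpow_le_rpow_of_exponent_le hM1 (by linarith [hs x]))
    have h2 : (|u x| / τ) ^ γ x ≤ |u x| ^ γ x / τ := by
      rw [Real.div_rpow (abs_nonneg _) hτ0.le]
      refine div_le_div_of_nonneg_left (by positivity) hτ0 ?_
      simpa using Real.rpow_le_rpow_of_exponent_le hτ1 hγx
    calc (|u x| / τ) ^ γ x + α x * (|u x| / τ) ^ s x
        ≤ (|u x| / τ) ^ γ x + Λ * (M₁ ^ S * (|u x| / τ) ^ γ x) := by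
          have := hα x
          gcongr
      _ = D * (|u x| / τ) ^ γ x := by rw [hD]; ring
      _ ≤ D * (|u x| ^ γ x / τ) := by gcongr
      _ = D / τ * |u x| ^ γ x := by ring
  rw [setLIntegral_univ]
  calc _ ≤ ∫⁻ x, ENNReal.ofReal (D / τ * |u x| ^ γ x) :=
        lintegral_mono fun x => ENNReal.ofReal_le_ofReal (hpt x)
    _ = ENNReal.ofReal (∫ x, D / τ * |u x| ^ γ x) :=
        (ofReal_integral_eq_lintegral_ofReal (hu.const_mul _)
          (Eventually.of_forall fun x => by positivity)).symm
    _ ≤ 1 := by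
        rw [integral_const_mul, ← ENNReal.ofReal_one]
        refine ENNReal.ofReal_le_ofReal ?_
        rw [div_mul_eq_mul_div, div_le_one hτ0]
        exact le_max_right _ _

theorem setIntegral_abs_rpow_le_of_modular {γ s α u : EuclideanSpace ℝ (Fin N) → ℝ}
    {cγ Γ τ : ℝ} (hγ : Continuous γ) (hu : Continuous u) (hcγ : 0 < cγ) (hγ1 : ∀ x, cγ ≤ γ x)
    (hγΓ : ∀ x, γ x ≤ Γ) (hα : ∀ x, 0 ≤ α x) (hτ : 0 < τ)
    (h : ∫⁻ x in Set.univ, ENNReal.ofReal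
      ((|u x| / τ) ^ γ x + α x * (|u x| / τ) ^ s x) ≤ 1)
    (y : EuclideanSpace ℝ (Fin N)) (R : ℝ) :
    ∫ x in Metric.closedBall y R, |u x| ^ γ x ≤ max (τ ^ cγ) (τ ^ Γ) := by
  have hγ0 : ∀ x, 0 < γ x := fun x => hcγ.trans_le (hγ1 x)
  have hc1 : Continuous fun x => |u x| ^ γ x := continuous_rpow_of_pos hu.abs hγ hγ0
  have hc2 : Continuous fun x => (|u x| / τ) ^ γ x :=
    continuous_rpow_of_pos (hu.abs.div_const τ) hγ hγ0
  have h1 : ∫ x in Metric.closedBall y R, (|u x| / τ) ^ γ x ≤ 1 := by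
    rw [integral_eq_lintegral_of_nonneg_ae
      (Eventually.of_forall fun x => by positivity) hc2.aestronglyMeasurable]
    refine ENNReal.toReal_le_of_le_ofReal zero_le_one ?_
    rw [ENNReal.ofReal_one]
    refine le_trans ?_ h
    refine (lintegral_mono_set (Set.subset_univ _)).trans
      (lintegral_mono fun x => ENNReal.ofReal_le_ofReal ?_)
    have := hα x
    exact le_add_of_nonneg_right (by positivity)
  have hpt : ∀ x ∈ Metric.closedBall y R,
      |u x| ^ γ x ≤ max (τ ^ cγ) (τ ^ Γ) * (|u x| / τ) ^ γ x := fun x _ => by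
    calc |u x| ^ γ x = τ ^ γ x * (|u x| / τ) ^ γ x := by
          rw [← Real.mul_rpow hτ.le (by positivity), mul_div_cancel₀ _ hτ.ne']
      _ ≤ _ := mul_le_mul_of_nonneg_right (rpow_le_max_rpow hτ (hγ1 x) (hγΓ x)) (by positivity)
  refine (setIntegral_closedBall_mono hc1 (continuous_const.mul hc2)
    (g := fun x => max (τ ^ cγ) (τ ^ Γ) * (|u x| / τ) ^ γ x) hpt).trans ?_
  rw [integral_const_mul]
  exact mul_le_of_le_one_right (by positivity) h1

end Luxemburg

section Main

variable {N : ℕ} {p q a V γ : EuclideanSpace ℝ (Fin N) → ℝ}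

theorem CondO.two_le (hO : CondO N p q a V) : 2 ≤ N := by
  have h : (1 : ℝ) < N := (hO.one_lt_q 0).trans (hO.q_lt_N 0)
  exact_mod_cast h

theorem max_zero_le_abs_of {s t : ℝ} (h : s = t ∨ s = -t) : max s 0 ≤ |t| := by
  rcases h with rfl | rfl
  · exact max_le (le_abs_self s) (abs_nonneg s)
  · exact max_le (neg_le_abs t) (abs_nonneg t)

/-- The pointwise a-priori estimate in terms of any admissible scaling. -/
theorem CondO.exists_uniform_bound (hO : CondO N p q a V)
    (hγlip : ∃ K : NNReal, LipschitzWith K γ) (hγbdd : ∃ C : ℝ, ∀ x, γ x ≤ C)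
    (hqγ : ∃ c₁ c₂ : ℝ, c₁ < c₂ ∧ (∀ x, q x ≤ c₁) ∧ ∀ x, c₂ ≤ γ x)
    (hγsub : ∃ c > (0 : ℝ), ∀ x, c ≤ N * p x / (N - p x) - γ x) {Cm : ℝ} (hCm : 0 ≤ Cm) :
    ∃ K > (0 : ℝ), ∃ τ₁ > (0 : ℝ), ∃ τ₂ > (0 : ℝ),
      ∀ u : EuclideanSpace ℝ (Fin N) → ℝ, ContDiff ℝ 1 u →
      rhoV p q a V u < ⊤ → IsSubsolution p q a γ Cm u → IsSubsolution p q a γ Cm (-u) →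
      (∃ M, ∀ x, |u x| ≤ M) ∧
      ∀ (α s : EuclideanSpace ℝ (Fin N) → ℝ) (τ : ℝ), (∀ x, 0 ≤ α x) → 0 < τ →
        ∫⁻ x in Set.univ, ENNReal.ofReal
          ((|u x| / τ) ^ γ x + α x * (|u x| / τ) ^ s x) ≤ 1 →
        ∀ y, |u y| ≤ K * max (τ ^ τ₁) (τ ^ τ₂) := by
  have hN := hO.two_le
  have hN1 : (0 : ℝ) < N - 1 := by
    have : (2 : ℝ) ≤ N := by exact_mod_cast hN
    linarith
  obtain ⟨C, hC⟩ := exists_isSobolevConst hN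
  obtain ⟨Kp, hp⟩ := hO.lip_p
  obtain ⟨cp, hcp, hp1⟩ := hO.inf_p
  obtain ⟨cN, hcN, hqN⟩ := hO.sup_q
  obtain ⟨L, hγ⟩ := hγlip
  obtain ⟨Γ₀, hΓ₀⟩ := hγbdd
  obtain ⟨c₁, c₂, hc₁₂, hqc₁, hγc₂⟩ := hqγ
  obtain ⟨c, hc, hgap⟩ := hγsub
  obtain ⟨Λ₀, hΛ₀⟩ := hO.a_bdd
  have hpN : ∀ x, p x ≤ cN := fun x => (hO.p_lt_q x).le.trans (hqN x)
  have hc₂ : 1 < c₂ := by linarith [hO.one_lt_q 0, hqc₁ 0]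
  obtain ⟨Γ, d, ρ, hΓ, hΓ₀Γ, hd, hdΓ, hρ, hρ1, hexp'⟩ :=
    exists_isIterationExponent hN hp hcp hp1 hcN hpN L Γ₀ hc₂ hc
  have hexp := hexp' γ hγ hγc₂ hΓ₀ hgap
  have hΛ : 0 ≤ max Λ₀ 0 := le_max_right _ _
  have hγΓ : ∀ x, γ x ≤ Γ := fun x => (hΓ₀ x).trans hΓ₀Γ
  have hadm : Admissible p q a γ (max Λ₀ 0) Γ :=
    { two_le := hN
      cont_p := hp.continuous
      cont_q := hO.continuous_q
      cont_a := hO.continuous_a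
      cont_γ := hγ.continuous
      one_lt_p := hO.one_lt_p
      p_le_q := fun x => (hO.p_lt_q x).le
      q_le_N := fun x => (hO.q_lt_N x).le
      q_le_γ := fun x => (hqc₁ x).trans (hc₁₂.le.trans (hγc₂ x))
      γ_le := hγΓ
      a_nonneg := hO.a_nonneg
      a_le := fun x => (hΛ₀ x).trans (le_max_left _ _) }
  obtain ⟨K, hK, hbd⟩ := exists_local_sup_bound hC hN hCm hΛ hΓ hd hdΓ hρ hρ1
  set e₁ : ℝ := 1 / ((N - 1) * d) with he₁
  set e₂ : ℝ := 1 / ((N - 1) * (3 * Γ)) with he₂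
  have he₂0 : 0 < e₂ := by positivity
  have he₁0 : 0 < e₁ := by positivity
  have he : e₂ ≤ e₁ := one_div_le_one_div_of_le (by positivity)
    (mul_le_mul_of_nonneg_left (by linarith) hN1.le)
  have hc₂Γ : c₂ ≤ Γ := (hγc₂ 0).trans (hγΓ 0)
  refine ⟨K, hK, c₂ * e₂, by positivity, Γ * e₁, by positivity, fun u hu hfin hs hs' => ⟨?_, ?_⟩⟩
  · have hinteg := hO.integrable_gradient_rpow hu hfin
    have hvol := (hO.volume_one_lt_abs_lt_top hu hfin).ne
    have hsub : {x | 1 < u x} ⊆ {x | 1 < |u x|} := fun x (hx : 1 < u x) =>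
      lt_of_lt_of_le hx (le_abs_self _)
    have hsub' : {x | 1 < (-u) x} ⊆ {x | 1 < |u x|} := fun x (hx : 1 < -u x) =>
      lt_of_lt_of_le hx (neg_le_abs (u x))
    have hinteg' : Integrable fun x => ‖gradient (-u) x‖ ^ p x := by
      simpa only [gradient_neg, norm_neg] using hinteg
    obtain ⟨M, hM⟩ := hs.exists_bound hC hp hcp hp1 hcN hpN hγ hc hgap hadm hexp hCm hΛ hΓ hd hdΓ
      hρ hu (measure_ne_top_of_subset hsub hvol) hinteg
    obtain ⟨M', hM'⟩ := hs'.exists_bound hC hp hcp hp1 hcN hpN hγ hc hgap hadm hexp hCm hΛ hΓ hd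
      hdΓ hρ hu.neg (measure_ne_top_of_subset hsub' hvol) hinteg'
    exact ⟨max M M', fun x => abs_le'.mpr
      ⟨(hM x).trans (le_max_left _ _), (hM' x).trans (le_max_right _ _)⟩⟩
  · intro α s τ hα hτ hmod y
    obtain ⟨β, hβ⟩ := hexp y
    set Z : ℝ := max (τ ^ c₂) (τ ^ Γ) with hZ
    have hZ0 : 0 < Z := lt_max_of_lt_left (Real.rpow_pos_of_pos hτ _)
    have hγ0 : ∀ x, 0 < γ x := fun x => by linarith [hγc₂ x]
    have hle : ∀ v : EuclideanSpace ℝ (Fin N) → ℝ, ContDiff ℝ 1 v → IsSubsolution p q a γ Cm v →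
        (∀ x, max (v x) 0 ≤ |u x|) → v y ≤ K * max (τ ^ (c₂ * e₂)) (τ ^ (Γ * e₁)) :=
      fun v hv hvs hvu => by
      refine (hbd p q a γ v y β hadm hβ hvs hv Z hZ0 ?_).trans
        (mul_le_mul_of_nonneg_left ?_ hK.le)
      · exact (setIntegral_closedBall_mono (continuous_rpow_of_pos
          (hv.continuous.max continuous_const) hγ.continuous hγ0)
          (continuous_rpow_of_pos hu.continuous.abs hγ.continuous hγ0)
          fun x _ => Real.rpow_le_rpow (le_max_right _ _) (hvu x) (hγ0 x).le).trans
          (setIntegral_abs_rpow_le_of_modular hγ.continuous hu.continuous (by linarith) hγc₂ hγΓ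
            hα hτ hmod y ρ)
      · exact max_le (max_rpow_rpow_le hτ (by linarith) hc₂Γ he₂0.le he le_rfl)
          (max_rpow_rpow_le hτ (by linarith) hc₂Γ he₂0.le le_rfl he)
    exact abs_le'.mpr ⟨hle u hu hs fun x => max_zero_le_abs_of (Or.inl rfl),
      hle (-u) hu.neg hs' fun x => max_zero_le_abs_of (Or.inr rfl)⟩

theorem exists_sobolev_conj_le {cN : ℝ} (hcN : cN < N) (hp0 : ∀ x, 0 < p x)
    (hpN : ∀ x, p x ≤ cN) : ∃ S, ∀ x, (N : ℝ) * p x / (N - p x) ≤ S :=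
  ⟨N * cN / (N - cN), fun x => by
    have := hp0 x
    have := hpN x
    exact div_le_div₀ (mul_nonneg (Nat.cast_nonneg _) (by linarith)) (by gcongr)
      (by linarith) (by linarith)⟩

end Main

/-- **Uniform a-priori bound for truncated Schrödinger double phase problems.**
Under (O), for `γ` bounded Lipschitz with `sup q < inf γ` and `inf (p* − γ) > 0`, and
`C_m > 0`, there are `C₀, τ₁, τ₂ > 0` depending only on the data (not on `u` or `g`)
such that: for every Carathéodory `g` with `|g(x,t)| ≤ C_m |t|^{γ(x)−1}`, every weak
solution `u ∈ X_V` of the double phase problem with right-hand side `g` is bounded and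
`‖u‖_{L^∞(ℝ^N)} ≤ C₀ max{‖u‖_{L^{F_γ}(ℝ^N)}^{τ₁}, ‖u‖_{L^{F_γ}(ℝ^N)}^{τ₂}}`, where
`F_γ(x,t) = t^{γ(x)} + a(x)^{s(x)/q(x)} t^{s(x)}` and `s = (γ + p*)/2`. -/
theorem stmt19 {N : ℕ} (p q a V : EuclideanSpace ℝ (Fin N) → ℝ) (hO : CondO N p q a V)
    (γ : EuclideanSpace ℝ (Fin N) → ℝ)
    (hγlip : ∃ K : NNReal, LipschitzWith K γ) (hγbdd : ∃ C : ℝ, ∀ x, γ x ≤ C)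
    (hqγ : ∃ c₁ c₂ : ℝ, c₁ < c₂ ∧ (∀ x, q x ≤ c₁) ∧ ∀ x, c₂ ≤ γ x)
    (hγsub : ∃ c > (0 : ℝ), ∀ x, c ≤ N * p x / (N - p x) - γ x)
    (Cm : ℝ) (hCm : 0 < Cm) :
    ∃ C₀ > (0 : ℝ), ∃ τ₁ > (0 : ℝ), ∃ τ₂ > (0 : ℝ),
      ∀ g : EuclideanSpace ℝ (Fin N) → ℝ → ℝ,
        (∀ t : ℝ, Measurable fun x => g x t) →
        (∀ x, Continuous fun t => g x t) →
        (∀ᵐ x ∂(volume : Measure (EuclideanSpace ℝ (Fin N))),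
          ∀ t : ℝ, |g x t| ≤ Cm * |t| ^ (γ x - 1)) →
        ∀ u : EuclideanSpace ℝ (Fin N) → ℝ, ContDiff ℝ 1 u →
          -- u ∈ X_V : finite modular and approximable by C_c^∞ functions
          rhoV p q a V u < ⊤ →
          (∃ φ : ℕ → EuclideanSpace ℝ (Fin N) → ℝ,
            (∀ n, ContDiff ℝ (⊤ : ℕ∞) (φ n) ∧ HasCompactSupport (φ n)) ∧
            Tendsto (fun n => VNorm p q a V fun x => u x - φ n x) atTop (nhds 0)) →
          -- u is a weak solution of the double phase problem with reaction g
          (∀ φ : EuclideanSpace ℝ (Fin N) → ℝ, ContDiff ℝ (⊤ : ℕ∞) φ → HasCompactSupport φ →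
            (∫ x, @inner ℝ _ _
                ((‖gradient u x‖ ^ (p x - 2) + a x * ‖gradient u x‖ ^ (q x - 2)) •
                  gradient u x) (gradient φ x)) +
              (∫ x, V x * ((|u x| ^ (p x - 2) * u x + a x * |u x| ^ (q x - 2) * u x) * φ x)) =
              ∫ x, g x (u x) * φ x) →
          -- conclusion: u ∈ L^∞(ℝ^N) with the uniform a-priori bound
          (eLpNorm u ⊤ volume < ⊤ ∧
            eLpNorm u ⊤ volume ≤ ENNReal.ofReal (C₀ * max
              (luxNormOn (fun x t => t ^ γ x +
                a x ^ (((γ x + N * p x / (N - p x)) / 2) / q x) *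
                  t ^ ((γ x + N * p x / (N - p x)) / 2)) Set.univ u ^ τ₁)
              (luxNormOn (fun x t => t ^ γ x +
                a x ^ (((γ x + N * p x / (N - p x)) / 2) / q x) *
                  t ^ ((γ x + N * p x / (N - p x)) / 2)) Set.univ u ^ τ₂))) := by
  obtain ⟨K, hK, τ₁, hτ₁, τ₂, hτ₂, hmain⟩ :=
    hO.exists_uniform_bound hγlip hγbdd hqγ hγsub hCm.le
  obtain ⟨L, hγ⟩ := hγlip
  obtain ⟨Γ, hΓ⟩ := hγbdd
  obtain ⟨c₁, c₂, hc₁₂, hqc₁, hγc₂⟩ := hqγ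
  obtain ⟨c, hc, hgap⟩ := hγsub
  obtain ⟨Λ, hΛ⟩ := hO.a_bdd
  obtain ⟨cN, hcN, hqN⟩ := hO.sup_q
  obtain ⟨S, hS⟩ := exists_sobolev_conj_le hcN (fun x => one_pos.trans (hO.one_lt_p x))
    fun x => (hO.p_lt_q x).le.trans (hqN x)
  have hqγ' : ∀ x, q x ≤ γ x := fun x => (hqc₁ x).trans (hc₁₂.le.trans (hγc₂ x))
  have hγ1 : ∀ x, 1 < γ x := fun x => (hO.one_lt_q x).trans_le (hqγ' x)
  refine ⟨K, hK, τ₁, hτ₁, τ₂, hτ₂, fun g hgm hgc hg u hu hfin _ hw => ?_⟩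
  obtain ⟨hs, hs'⟩ := hO.isSubsolution_of_weak hu hγ.continuous hγ1 hgm hgc hg hw
  obtain ⟨⟨M, hM⟩, hτ⟩ := hmain u hu hfin hs hs'
  set s : EuclideanSpace ℝ (Fin N) → ℝ := fun x => (γ x + N * p x / (N - p x)) / 2 with hsdef
  have hγs : ∀ x, γ x ≤ s x := fun x => by
    have := hgap x
    simp only [hsdef]
    linarith
  have hsS : ∀ x, s x ≤ (Γ + S) / 2 := fun x => by
    have := hΓ x
    have := hS x
    simp only [hsdef]
    linarith
  have hα : ∀ x, a x ^ (s x / q x) ≤ max 1 Λ ^ ((Γ + S) / 2) := fun x => by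
    have hs0 : 0 ≤ s x := by linarith [hγ1 x, hγs x]
    exact (Real.rpow_le_rpow (hO.a_nonneg x) ((hΛ x).trans (le_max_right 1 Λ))
      (div_nonneg hs0 (by linarith [hO.one_lt_q x]))).trans
      (Real.rpow_le_rpow_of_exponent_le (le_max_left 1 Λ)
        ((div_le_self hs0 (hO.one_lt_q x).le).trans (hsS x)))
  have hne := exists_modular_div_le_one (fun x => (hγ1 x).le) hγs hsS (by positivity) hα hM
    (hO.integrable_abs_rpow hu hfin hγ.continuous hqγ' hΓ hM)
  have hcont : Continuous fun τ : ℝ => K * max (τ ^ τ₁) (τ ^ τ₂) :=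
    continuous_const.mul ((Real.continuous_rpow_const hτ₁.le).max
      (Real.continuous_rpow_const hτ₂.le))
  have hbd := fun y => le_comp_luxNormOn
    (Φ := fun x t => t ^ γ x + a x ^ (s x / q x) * t ^ s x) hcont hne fun τ hτ0 hmod =>
      hτ (fun x => a x ^ (s x / q x)) s τ (fun x => Real.rpow_nonneg (hO.a_nonneg x) _) hτ0 hmod y
  have hle := eLpNormEssSup_le_of_ae_bound (f := u) (μ := volume)
    (Eventually.of_forall hbd)
  rw [eLpNorm_exponent_top]
  exact ⟨hle.trans_lt ENNReal.ofReal_lt_top, hle⟩
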